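/- Fix an integer r ≥ 2 and an r-critical graph F. Then there exists a sequence of integers (m_n) such that P(α_F(G_{n,1/2}) ∈ [m_n − r, m_n]) → 1 as n → ∞. -/

import Mathlib

open scoped Classical

/-- Probability of an event under the uniform measure on simple graphs on `Fin n`
(equivalently, `G_{n,1/2}`). -/
noncomputable def grPr (n : ℕ) (S : Set (SimpleGraph (Fin n))) : ℝ :=
  ((PMF.uniformOfFintype (SimpleGraph (Fin n))).toOuterMeasure S).toReal

/-- `G` contains a (not necessarily induced) copy of `F` as a subgraph. -/
def HasCopy {V : Type*} {W : Type*} (F : SimpleGraph V) (G : SimpleGraph W) : Prop :=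
  ∃ f : V ↪ W, ∀ a b, F.Adj a b → G.Adj (f a) (f b)

/-- `α_F(G)`: the maximum number of vertices in an induced `F`-free subgraph of `G`. -/
noncomputable def alphaF {V : Type*} (F : SimpleGraph V) (n : ℕ) (G : SimpleGraph (Fin n)) : ℕ :=
  sSup {m | ∃ s : Finset (Fin n), s.card = m ∧ ¬ HasCopy F (G.induce (s : Set (Fin n)))}

/-- `F` is `r`-critical: `χ(F) = r + 1` and some edge's deletion reduces the
chromatic number to `r`. -/
def IsCritical {V : Type*} (r : ℕ) (F : SimpleGraph V) : Prop :=
  F.chromaticNumber = (r + 1 : ℕ) ∧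
    ∃ e ∈ F.edgeSet, (F.deleteEdges {e}).chromaticNumber = (r : ℕ)

/-- Few subsets of an `N`-element set have at most `ε N` elements. -/
theorem exists_card_small_subsets_le {h : ℝ} (hh : 0 < h) :
    ∃ ε : ℝ, 0 < ε ∧ ∀ {α : Type} (s : Finset α) (N : ℝ), (s.card : ℝ) ≤ N →
      ((s.powerset.filter fun t => (t.card : ℝ) ≤ ε * N).card : ℝ) ≤ (2 : ℝ) ^ (h * N) := by
  have h1 : (1 : ℝ) < 2 ^ (h / 2) := Real.one_lt_rpow (by norm_num) (by positivity)
  set x : ℝ := min 1 (2 ^ (h / 2) - 1) with hx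
  have hx0 : 0 < x := lt_min one_pos (by linarith)
  have hx1 : x ≤ 1 := min_le_left _ _
  have hx2 : 1 + x ≤ 2 ^ (h / 2) := by linarith [min_le_right (1 : ℝ) (2 ^ (h / 2) - 1)]
  have hlog : Real.log x ≤ 0 := Real.log_nonpos hx0.le hx1
  have hl2 : 0 < Real.log 2 := Real.log_pos (by norm_num)
  set ε : ℝ := (h / 2 * Real.log 2) / (1 - Real.log x) with hε
  have hε0 : 0 < ε := by apply div_pos <;> [positivity; linarith]
  have hxe : x ^ (-ε) ≤ 2 ^ (h / 2) := by
    rw [← Real.log_le_log_iff (by positivity) (by positivity), Real.log_rpow hx0,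
      Real.log_rpow (by norm_num)]
    have : ε * (1 - Real.log x) = h / 2 * Real.log 2 := div_mul_cancel₀ _ (by linarith)
    linarith
  refine ⟨ε, hε0, fun {α} s N hs => ?_⟩
  have hN : 0 ≤ N := le_trans (by positivity) hs
  have key : ((s.powerset.filter fun t => (t.card : ℝ) ≤ ε * N).card : ℝ)
      ≤ x ^ (-(ε * N)) * (1 + x) ^ s.card := by
    have hsum : (1 + x) ^ s.card = ∑ t ∈ s.powerset, x ^ t.card := by
      rw [add_comm, ← Finset.sum_pow_mul_eq_add_pow]; simp
    rw [hsum, Finset.mul_sum, Finset.card_eq_sum_ones, Nat.cast_sum]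
    refine le_trans ?_ (Finset.sum_le_sum_of_subset_of_nonneg (Finset.filter_subset
      (fun t : Finset α => (t.card : ℝ) ≤ ε * N) s.powerset) fun t _ _ => by positivity)
    refine Finset.sum_le_sum fun t ht => ?_
    rw [← Real.rpow_natCast, ← Real.rpow_add hx0, Nat.cast_one]
    exact Real.one_le_rpow_of_pos_of_le_one_of_nonpos hx0 hx1
      (by linarith [(Finset.mem_filter.1 ht).2])
  refine key.trans ?_
  have e1 : x ^ (-(ε * N)) ≤ 2 ^ (h / 2 * N) := by
    rw [← neg_mul, Real.rpow_mul hx0.le, Real.rpow_mul (by norm_num)]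
    exact Real.rpow_le_rpow (by positivity) hxe hN
  have e2 : (1 + x) ^ s.card ≤ (2 : ℝ) ^ (h / 2 * N) := by
    rw [← Real.rpow_natCast, Real.rpow_mul (by norm_num)]
    calc (1 + x) ^ (s.card : ℝ) ≤ (1 + x) ^ N := Real.rpow_le_rpow_of_exponent_le (by linarith) hs
      _ ≤ _ := Real.rpow_le_rpow (by linarith) hx2 hN
  calc x ^ (-(ε * N)) * (1 + x) ^ s.card ≤ 2 ^ (h / 2 * N) * 2 ^ (h / 2 * N) := by gcongr
    _ = 2 ^ (h * N) := by rw [← Real.rpow_add (by norm_num)]; ring_nf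

/-- Size of the candidate sets, in units of the density scale, that suffices to embed greedily a
graph on a given number of vertices into pairs of density `d`. -/
noncomputable def embedConst (d : ℝ) : ℕ → ℝ
  | 0 => 1
  | h + 1 => (embedConst d h + h + 1) / d

theorem one_le_embedConst {d : ℝ} (hd : 0 < d) (hd1 : d ≤ 1) (h : ℕ) : 1 ≤ embedConst d h := by
  induction h with
  | zero => simp [embedConst]
  | succ h ih =>
    rw [embedConst, le_div_iff₀ hd]
    have : (0 : ℝ) ≤ h := by positivity
    linarith

/-- Greedy embedding into hereditarily dense pairs of candidate sets. -/
theorem exists_embedding_of_dense {U W : Type} [Nonempty W] (F : SimpleGraph U)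
    (H : SimpleGraph W) {d b : ℝ} (hd : 0 < d) (hd1 : d ≤ 1) (hb : 1 ≤ b) (T : Finset U) :
    ∀ C : U → Finset W, (∀ u ∈ T, embedConst d T.card * b ≤ (C u).card) →
    (∀ u ∈ T, ∀ u' ∈ T, F.Adj u u' → ∀ A ⊆ C u, ∀ B ⊆ C u', b ≤ A.card → b ≤ B.card →
      d * A.card * B.card ≤ ((A ×ˢ B).filter fun p => H.Adj p.1 p.2).card) →
    ∃ g : U → W, Set.InjOn g T ∧ (∀ u ∈ T, g u ∈ C u) ∧
      ∀ u ∈ T, ∀ u' ∈ T, F.Adj u u' → H.Adj (g u) (g u') := by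
  induction T using Finset.induction_on with
  | empty => exact fun C _ _ => ⟨fun _ => Classical.arbitrary W, by simp, by simp, by simp⟩
  | insert x T hx ih =>
    intro C hC hD
    rw [Finset.card_insert_of_notMem hx] at hC
    have hκ := one_le_embedConst hd hd1 T.card
    have hκ' : d * embedConst d (T.card + 1) = embedConst d T.card + T.card + 1 := by
      rw [embedConst]; field_simp
    have hκb : embedConst d T.card * b + T.card * b + b ≤ embedConst d (T.card + 1) * b := by
      have : embedConst d T.card + T.card + 1 ≤ embedConst d (T.card + 1) := by
        rw [← hκ']
        exact mul_le_of_le_one_left (zero_le_one.trans (one_le_embedConst hd hd1 _)) hd1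
      nlinarith
    have hT0 : (0 : ℝ) ≤ T.card := by positivity
    have hb0 : 0 ≤ (T.card : ℝ) * b := by positivity
    let bad : U → Finset W := fun y => if F.Adj x y then
      (C x).filter fun v => (((C y).filter fun w => H.Adj v w).card : ℝ) < d * (C y).card else ∅
    have hbad : ∀ y ∈ T, ((bad y).card : ℝ) ≤ b := by
      intro y hy
      by_cases hxy : F.Adj x y
      · by_contra! hlt
        have hsub : bad y ⊆ C x := by simp only [bad, if_pos hxy]; exact Finset.filter_subset _ _
        have hCy : b ≤ (C y).card := by
          have := hC y (Finset.mem_insert_of_mem hy); nlinarith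
        have h1 := hD x (Finset.mem_insert_self _ _) y (Finset.mem_insert_of_mem hy) hxy (bad y)
          hsub (C y) subset_rfl hlt.le hCy
        have h2 : (((bad y ×ˢ C y).filter fun p => H.Adj p.1 p.2).card : ℝ)
            = ∑ v ∈ bad y, (((C y).filter fun w => H.Adj v w).card : ℝ) := by
          rw [Finset.card_filter, Finset.sum_product]
          simp only [Finset.card_filter]
          push_cast
          rfl
        have hne : (bad y).Nonempty := by
          rw [← Finset.card_pos, ← Nat.cast_pos (α := ℝ)]; linarith
        have h3 : ∑ v ∈ bad y, (((C y).filter fun w => H.Adj v w).card : ℝ)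
            < ∑ _v ∈ bad y, d * (C y).card := by
          refine Finset.sum_lt_sum_of_nonempty hne fun v hv => ?_
          simp only [bad, if_pos hxy] at hv
          exact (Finset.mem_filter.1 hv).2
        rw [Finset.sum_const, nsmul_eq_mul] at h3
        nlinarith
      · simp only [bad, if_neg hxy, Finset.card_empty, Nat.cast_zero]; linarith
    have hunion : ((T.biUnion bad).card : ℝ) ≤ T.card * b := by
      calc ((T.biUnion bad).card : ℝ) ≤ ∑ y ∈ T, ((bad y).card : ℝ) := by
            exact_mod_cast Finset.card_biUnion_le
        _ ≤ ∑ _y ∈ T, b := Finset.sum_le_sum hbad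
        _ = _ := by simp
    obtain ⟨v, hv, hvb⟩ : ∃ v ∈ C x, v ∉ T.biUnion bad := by
      by_contra! hcon
      have h1 : ((C x).card : ℝ) ≤ (T.biUnion bad).card := by
        exact_mod_cast Finset.card_le_card hcon
      have := hC x (Finset.mem_insert_self _ _)
      nlinarith
    let C' : U → Finset W := fun y =>
      (if F.Adj x y then (C y).filter fun w => H.Adj v w else C y).erase v
    have hC'sub : ∀ y, C' y ⊆ C y := fun y => (Finset.erase_subset _ _).trans (by
      split_ifs
      · exact Finset.filter_subset _ _
      · exact subset_rfl)
    obtain ⟨g, hg1, hg2, hg3⟩ := ih C' (fun y hy => by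
      have h0 := hC y (Finset.mem_insert_of_mem hy)
      have h1 : d * (C y).card
          ≤ ((if F.Adj x y then (C y).filter fun w => H.Adj v w else C y).card : ℝ) := by
        split_ifs with hxy
        · by_contra! hlt
          refine hvb (Finset.mem_biUnion.2 ⟨y, hy, ?_⟩)
          simp only [bad, if_pos hxy]
          exact Finset.mem_filter.2 ⟨hv, hlt⟩
        · exact mul_le_of_le_one_left (by positivity) hd1
      have h2 : ((if F.Adj x y then (C y).filter fun w => H.Adj v w else C y).card : ℝ) - 1
          ≤ (C' y).card := by
        have := Finset.pred_card_le_card_erase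
          (s := if F.Adj x y then (C y).filter fun w => H.Adj v w else C y) (a := v)
        rw [sub_le_iff_le_add]
        exact_mod_cast Nat.sub_le_iff_le_add.1 this
      have h3 : embedConst d T.card * b + T.card * b + b ≤ d * (C y).card := by
        calc _ = (d * embedConst d (T.card + 1)) * b := by rw [hκ']; ring
          _ = d * (embedConst d (T.card + 1) * b) := by ring
          _ ≤ _ := by gcongr
      linarith) (fun u hu u' hu' huu A hA B hB => hD u (Finset.mem_insert_of_mem hu) u'
        (Finset.mem_insert_of_mem hu') huu A (hA.trans (hC'sub u)) B (hB.trans (hC'sub u')))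
    have hne : ∀ u ∈ T, u ≠ x := fun u hu h => hx (h ▸ hu)
    have hgv : ∀ u ∈ T, g u ≠ v := fun u hu => Finset.ne_of_mem_erase (hg2 u hu)
    have hadj : ∀ u ∈ T, F.Adj x u → H.Adj v (g u) := by
      intro u hu hxu
      have := Finset.mem_of_mem_erase (hg2 u hu)
      rw [if_pos hxu] at this
      exact (Finset.mem_filter.1 this).2
    refine ⟨Function.update g x v, ?_, ?_, ?_⟩
    · intro u hu u' hu' huu
      simp only [Finset.coe_insert, Set.mem_insert_iff, Finset.mem_coe] at hu hu'
      rcases hu with rfl | hu <;> rcases hu' with rfl | hu'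
      · rfl
      · rw [Function.update_self, Function.update_of_ne (hne _ hu')] at huu
        exact absurd huu.symm (hgv _ hu')
      · rw [Function.update_self, Function.update_of_ne (hne _ hu)] at huu
        exact absurd huu (hgv _ hu)
      · rw [Function.update_of_ne (hne _ hu), Function.update_of_ne (hne _ hu')] at huu
        exact hg1 hu hu' huu
    · intro u hu
      rw [Finset.mem_insert] at hu
      rcases hu with rfl | hu
      · rwa [Function.update_self]
      · rw [Function.update_of_ne (hne _ hu)]; exact hC'sub u (hg2 u hu)
    · intro u hu u' hu' huu
      rw [Finset.mem_insert] at hu hu'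
      rcases hu with rfl | hu <;> rcases hu' with rfl | hu'
      · exact absurd huu (F.loopless.irrefl _)
      · rw [Function.update_self, Function.update_of_ne (hne _ hu')]; exact hadj _ hu' huu
      · rw [Function.update_self, Function.update_of_ne (hne _ hu)]
        exact (hadj _ hu huu.symm).symm
      · rw [Function.update_of_ne (hne _ hu), Function.update_of_ne (hne _ hu')]
        exact hg3 u hu u' hu' huu

/-- Stability for Turán's theorem: a set without `(r+2)`-cliques has an `(r+1)`-colouring for which
the number of edges plus the number of monochromatic edges is at most the number of bichromatic
pairs. -/
theorem exists_coloring_of_cliqueFreeOn {W : Type} (H : SimpleGraph W) (r : ℕ) :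
    ∀ A : Finset W, (∀ K ⊆ A, ¬ H.IsNClique (r + 2) K) →
    ∃ c : W → ℕ, (∀ v ∈ A, c v < r + 1) ∧
      (∑ u ∈ A, ∑ v ∈ A, if H.Adj u v then 1 else 0)
        + (∑ u ∈ A, ∑ v ∈ A, if H.Adj u v ∧ c u = c v then 1 else 0)
        ≤ ∑ u ∈ A, ∑ v ∈ A, if c u ≠ c v then 1 else 0 := by
  induction r with
  | zero =>
    intro A hA
    have : ∀ u ∈ A, ∀ v ∈ A, ¬ H.Adj u v := by
      intro u hu v hv huv
      refine hA {u, v} (by intro x; simp; rintro (rfl | rfl) <;> assumption) ?_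
      rw [SimpleGraph.isNClique_iff, SimpleGraph.isClique_iff]
      refine ⟨?_, by rw [Finset.card_pair huv.ne]⟩
      simp [huv]
    refine ⟨fun _ => 0, by simp, ?_⟩
    simpa using this
  | succ r ih =>
    intro A hA
    rcases A.eq_empty_or_nonempty with rfl | hne
    · exact ⟨fun _ => 0, by simp, by simp⟩
    obtain ⟨x, hx, hmax⟩ := A.exists_max_image (fun u => (A.filter fun v => H.Adj u v).card) hne
    set N := A.filter fun v => H.Adj x v with hN
    set B := A \ N with hB
    have hNA : N ⊆ A := Finset.filter_subset _ _
    obtain ⟨c, hc1, hc2⟩ := ih N (fun K hK hclique => by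
      refine hA (insert x K) (Finset.insert_subset hx (hK.trans hNA)) ?_
      exact hclique.insert fun b hb => (Finset.mem_filter.1 (hK hb)).2)
    have hdisj : Disjoint N B := Finset.disjoint_sdiff
    have hAu : A = N ∪ B := (Finset.union_sdiff_of_subset hNA).symm
    have hBN : ∀ v ∈ B, v ∉ N := fun v hv => (Finset.mem_sdiff.1 hv).2
    let c' : W → ℕ := fun v => if v ∈ N then c v else r + 1
    have cN : ∀ v ∈ N, c' v = c v := fun v hv => if_pos hv
    have cB : ∀ v ∈ B, c' v = r + 1 := fun v hv => if_neg (hBN v hv)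
    have cNB : ∀ u ∈ N, ∀ v ∈ B, c' u ≠ c' v := fun u hu v hv => by
      rw [cN u hu, cB v hv]; exact (hc1 u hu).ne
    have split : ∀ f : W → W → ℕ, ∑ u ∈ A, ∑ v ∈ A, f u v
        = ∑ u ∈ N, ∑ v ∈ N, f u v + ∑ u ∈ N, ∑ v ∈ B, f u v
          + (∑ u ∈ B, ∑ v ∈ N, f u v + ∑ u ∈ B, ∑ v ∈ B, f u v) := by
      intro f
      rw [hAu, Finset.sum_union hdisj]
      simp only [Finset.sum_union hdisj, Finset.sum_add_distrib]
    refine ⟨c', fun v hv => ?_, ?_⟩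
    · by_cases hvN : v ∈ N
      · rw [cN v hvN]; exact (hc1 v hvN).trans (by omega)
      · simp [c', hvN]
    have hdeg : ∑ u ∈ B, ∑ v ∈ N, (if H.Adj u v then 1 else 0)
        + ∑ u ∈ B, ∑ v ∈ B, (if H.Adj u v then 1 else 0) ≤ B.card * N.card := by
      rw [← Finset.sum_add_distrib]
      refine (Finset.sum_le_card_nsmul B _ N.card fun u hu => ?_).trans_eq (smul_eq_mul _ _)
      rw [← Finset.sum_union hdisj, ← hAu, ← Finset.card_filter]
      exact hmax u (hAu ▸ Finset.mem_union_right _ hu)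
    have hsymm : ∑ u ∈ N, ∑ v ∈ B, (if H.Adj u v then 1 else 0)
        = ∑ u ∈ B, ∑ v ∈ N, (if H.Adj u v then 1 else 0) := by
      rw [Finset.sum_comm]; simp only [H.adj_comm]
    have i1 : ∑ u ∈ N, ∑ v ∈ N, (if H.Adj u v ∧ c' u = c' v then 1 else 0)
        = ∑ u ∈ N, ∑ v ∈ N, (if H.Adj u v ∧ c u = c v then 1 else 0) :=
      Finset.sum_congr rfl fun u hu => Finset.sum_congr rfl fun v hv => by rw [cN u hu, cN v hv]
    have i2 : ∑ u ∈ N, ∑ v ∈ B, (if H.Adj u v ∧ c' u = c' v then 1 else 0) = 0 :=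
      Finset.sum_eq_zero fun u hu => Finset.sum_eq_zero fun v hv => by simp [cNB u hu v hv]
    have i3 : ∑ u ∈ B, ∑ v ∈ N, (if H.Adj u v ∧ c' u = c' v then 1 else 0) = 0 :=
      Finset.sum_eq_zero fun u hu => Finset.sum_eq_zero fun v hv => by
        simp [(cNB v hv u hu).symm]
    have i4 : ∑ u ∈ B, ∑ v ∈ B, (if H.Adj u v ∧ c' u = c' v then 1 else 0)
        = ∑ u ∈ B, ∑ v ∈ B, (if H.Adj u v then 1 else 0) :=
      Finset.sum_congr rfl fun u hu => Finset.sum_congr rfl fun v hv => by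
        simp [cB u hu, cB v hv]
    have x1 : ∑ u ∈ N, ∑ v ∈ N, (if c' u ≠ c' v then 1 else 0)
        = ∑ u ∈ N, ∑ v ∈ N, (if c u ≠ c v then 1 else 0) :=
      Finset.sum_congr rfl fun u hu => Finset.sum_congr rfl fun v hv => by rw [cN u hu, cN v hv]
    have x2 : ∑ u ∈ N, ∑ v ∈ B, (if c' u ≠ c' v then 1 else 0) = N.card * B.card := by
      rw [Finset.sum_congr rfl fun u hu => Finset.sum_congr rfl fun v hv =>
        if_pos (cNB u hu v hv)]
      simp
    have x3 : ∑ u ∈ B, ∑ v ∈ N, (if c' u ≠ c' v then 1 else 0) = B.card * N.card := by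
      rw [Finset.sum_congr rfl fun u hu => Finset.sum_congr rfl fun v hv =>
        if_pos (cNB v hv u hu).symm]
      simp
    rw [split, split fun u v => if H.Adj u v ∧ c' u = c' v then 1 else 0,
      split fun u v => if c' u ≠ c' v then 1 else 0, i1, i2, i3, i4, x1, x2, x3, hsymm,
      mul_comm N.card]
    omega

/-- The edge set of a graph on a finite type, as a finset. -/
noncomputable def edges {W : Type} [Fintype W] (G : SimpleGraph W) : Finset (Sym2 W) :=
  Finset.univ.filter (· ∈ G.edgeSet)

section Edges

variable {W : Type} [Fintype W]

theorem mem_edges {G : SimpleGraph W} {e : Sym2 W} : e ∈ edges G ↔ e ∈ G.edgeSet := by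
  simp [edges]

theorem mk_mem_edges {G : SimpleGraph W} {u v : W} : s(u, v) ∈ edges G ↔ G.Adj u v := by
  simp [edges]

theorem edges_injective : Function.Injective (edges : SimpleGraph W → Finset (Sym2 W)) := by
  intro G H h
  ext u v
  rw [← mk_mem_edges, h, mk_mem_edges]

theorem edges_mono {G H : SimpleGraph W} (h : G ≤ H) : edges G ⊆ edges H := fun _ he =>
  mem_edges.2 (SimpleGraph.edgeSet_mono h (mem_edges.1 he))

theorem two_mul_card_edges (G : SimpleGraph W) :
    2 * (edges G).card = ∑ u, ∑ v, if G.Adj u v then 1 else 0 := by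
  have h1 : edges G = G.edgeFinset := by ext e; simp [mem_edges]
  rw [h1, SimpleGraph.two_mul_card_edgeFinset, Finset.card_filter, Fintype.sum_prod_type]

theorem card_edges_top : (edges (⊤ : SimpleGraph W)).card = (Fintype.card W).choose 2 := by
  have h1 : edges (⊤ : SimpleGraph W) = (⊤ : SimpleGraph W).edgeFinset := by
    ext e; simp [mem_edges]
  rw [h1, SimpleGraph.card_edgeFinset_top_eq_card_choose_two]

theorem exists_edges_eq {D : Finset (Sym2 W)} (hD : D ⊆ edges ⊤) :
    ∃ G : SimpleGraph W, edges G = D := by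
  refine ⟨SimpleGraph.fromEdgeSet D, ?_⟩
  ext e
  rw [mem_edges, SimpleGraph.edgeSet_fromEdgeSet]
  constructor
  · exact fun h => h.1
  · exact fun h => ⟨h, by simpa using (mem_edges.1 (hD h))⟩

theorem card_edges_le_sq (G : SimpleGraph W) : (edges G).card ≤ Fintype.card W ^ 2 := by
  calc (edges G).card ≤ (edges (⊤ : SimpleGraph W)).card := Finset.card_le_card (edges_mono le_top)
    _ ≤ _ := by rw [card_edges_top]; exact Nat.choose_le_pow _ _

/-- The number of graphs missing a prescribed set of pairs. -/
theorem card_graphs_disjoint (D : Finset (Sym2 W)) (hD : D ⊆ edges ⊤) :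
    (Finset.univ.filter fun G : SimpleGraph W => Disjoint (edges G) D).card
      = 2 ^ ((Fintype.card W).choose 2 - D.card) := by
  rw [← card_edges_top, ← Finset.card_sdiff_of_subset hD, ← Finset.card_powerset]
  refine Finset.card_bij (fun G _ => edges G) (fun G hG => ?_)
    (fun G _ G' _ h => edges_injective h) (fun E hE => ?_)
  · rw [Finset.mem_powerset]
    exact Finset.subset_sdiff.2 ⟨edges_mono le_top, (Finset.mem_filter.1 hG).2⟩
  · rw [Finset.mem_powerset, Finset.subset_sdiff] at hE
    obtain ⟨G, rfl⟩ := exists_edges_eq hE.1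
    exact ⟨G, by simp [hE.2], rfl⟩

theorem card_graphs : Fintype.card (SimpleGraph W) = 2 ^ (Fintype.card W).choose 2 := by
  simpa using card_graphs_disjoint (W := W) ∅ (Finset.empty_subset _)

end Edges

theorem card_le_of_forall_exists {I α : Type*} [Fintype I] (Q : I → Prop)
    (P : I → α → Prop) (B : ℝ) (hB : 0 ≤ B)
    (h : ∀ i, Q i → ∀ t : Finset α, (∀ a ∈ t, P i a) → (t.card : ℝ) ≤ B)
    (s : Finset α) (hs : ∀ a ∈ s, ∃ i, Q i ∧ P i a) :
    (s.card : ℝ) ≤ Fintype.card I * B := by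
  have h1 : s ⊆ (Finset.univ.filter Q).biUnion fun i => s.filter (P i) := by
    intro a ha
    obtain ⟨i, hi, hP⟩ := hs a ha
    exact Finset.mem_biUnion.2 ⟨i, Finset.mem_filter.2 ⟨Finset.mem_univ _, hi⟩,
      Finset.mem_filter.2 ⟨ha, hP⟩⟩
  calc (s.card : ℝ) ≤ ∑ i ∈ Finset.univ.filter Q, ((s.filter (P i)).card : ℝ) := by
        exact_mod_cast (Finset.card_le_card h1).trans Finset.card_biUnion_le
    _ ≤ ∑ i ∈ Finset.univ.filter Q, B :=
        Finset.sum_le_sum fun i hi => h i (Finset.mem_filter.1 hi).2 _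
          fun a ha => (Finset.mem_filter.1 ha).2
    _ ≤ Fintype.card I * B := by
        rw [Finset.sum_const, nsmul_eq_mul]
        gcongr
        exact Finset.card_le_univ _

theorem eq_of_inter_eq_of_sdiff_eq {α : Type*} [DecidableEq α] {s t D D' : Finset α} (h1 : s ∩ D = t ∩ D)
    (h2 : s ∩ D' = t ∩ D') (h3 : s \ (D ∪ D') = t \ (D ∪ D')) : s = t := by
  rw [← Finset.sdiff_union_inter s (D ∪ D'), ← Finset.sdiff_union_inter t (D ∪ D'), h3,
    Finset.inter_union_distrib_left, Finset.inter_union_distrib_left, h1, h2]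

theorem card_sparse_graphs_le {W : Type} [Fintype W] {d d₀ ε g : ℝ} (hdd : d ≤ d₀)
    (hdc : ∀ {α : Type} (s : Finset α) (N : ℝ), (s.card : ℝ) ≤ N →
      ((s.powerset.filter fun t => (t.card : ℝ) ≤ d₀ * N).card : ℝ) ≤ 2 ^ (1 / 2 * N))
    (hεc : ∀ {α : Type} (s : Finset α) (N : ℝ), (s.card : ℝ) ≤ N →
      ((s.powerset.filter fun t => (t.card : ℝ) ≤ ε * N).card : ℝ) ≤ 2 ^ (g * N))
    (D D' : Finset (Sym2 W)) (𝒮 : Finset (SimpleGraph W))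
    (h𝒮 : ∀ H ∈ 𝒮, ((edges H ∩ D').card : ℝ) ≤ d * D'.card ∧
      ((edges H \ (D ∪ D')).card : ℝ) ≤ ε * (Fintype.card W : ℝ) ^ 2) :
    (𝒮.card : ℝ) ≤ 2 ^ ((D.card : ℝ) + 1 / 2 * D'.card + g * (Fintype.card W : ℝ) ^ 2) := by
  set m := Fintype.card W with hm
  obtain ⟨P1, hP1⟩ : ∃ P1, P1 = D.powerset := ⟨_, rfl⟩
  obtain ⟨P2, hP2⟩ : ∃ P2, P2 = D'.powerset.filter fun t => (t.card : ℝ) ≤ d₀ * (D'.card : ℝ) :=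
    ⟨_, rfl⟩
  obtain ⟨P3, hP3⟩ : ∃ P3, P3 = (edges (⊤ : SimpleGraph W)).powerset.filter
      fun t => (t.card : ℝ) ≤ ε * (m : ℝ) ^ 2 := ⟨_, rfl⟩
  have hle : 𝒮.card ≤ (P1 ×ˢ P2 ×ˢ P3).card := by
    refine Finset.card_le_card_of_injOn
      (fun H => (edges H ∩ D, edges H ∩ D', edges H \ (D ∪ D'))) ?_ ?_
    · intro H hH
      obtain ⟨h1, h2⟩ := h𝒮 H hH
      rw [Finset.mem_coe, Finset.mem_product, Finset.mem_product, hP1, hP2, hP3,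
        Finset.mem_powerset, Finset.mem_filter, Finset.mem_filter, Finset.mem_powerset,
        Finset.mem_powerset]
      exact ⟨Finset.inter_subset_right, ⟨Finset.inter_subset_right, h1.trans (by gcongr)⟩,
        Finset.sdiff_subset.trans (edges_mono le_top), h2⟩
    · intro H _ H' _ h
      simp only [Prod.mk.injEq] at h
      exact edges_injective (eq_of_inter_eq_of_sdiff_eq h.1 h.2.1 h.2.2)
  have h1 : (P1.card : ℝ) = 2 ^ (D.card : ℝ) := by
    rw [hP1, Finset.card_powerset, Real.rpow_natCast]; norm_num
  have h2 : (P2.card : ℝ) ≤ 2 ^ (1 / 2 * (D'.card : ℝ)) := hP2 ▸ hdc D' _ le_rfl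
  have h3 : (P3.card : ℝ) ≤ 2 ^ (g * (m : ℝ) ^ 2) :=
    hP3 ▸ hεc _ _ (by exact_mod_cast card_edges_le_sq _)
  rw [Finset.card_product, Finset.card_product] at hle
  refine (Nat.cast_le.2 hle).trans ?_
  rw [Real.rpow_add (by norm_num), Real.rpow_add (by norm_num)]
  push_cast
  rw [h1, mul_assoc]
  gcongr

/-- Graphs that are sparse outside a blow-up `R.comap p ⊔ R'.comap p`, and sparse inside
`R'.comap p`, are few. -/
theorem exists_card_blowup_sparse_le :
    ∃ d : ℝ, 0 < d ∧ d ≤ 1 ∧ ∀ g : ℝ, 0 < g → ∃ ε : ℝ, 0 < ε ∧ ∀ K : ℕ, ∃ K' : ℝ, 0 ≤ K' ∧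
      ∀ (W : Type) [Fintype W], 1 ≤ Fintype.card W → ∀ (T : ℝ) (𝒮 : Finset (SimpleGraph W)),
        (∀ H ∈ 𝒮, ∃ (p : W → Fin K) (R R' : SimpleGraph (Fin K)),
          ((edges (R.comap p)).card : ℝ) + (edges (R'.comap p)).card / 2 ≤ T ∧
          ((edges H ∩ edges (R'.comap p)).card : ℝ) ≤ d * (edges (R'.comap p)).card ∧
          ((edges H \ (edges (R.comap p) ∪ edges (R'.comap p))).card : ℝ)
            ≤ ε * (Fintype.card W : ℝ) ^ 2) →
        (𝒮.card : ℝ) ≤ K' ^ Fintype.card W * (2 : ℝ) ^ (T + g * (Fintype.card W : ℝ) ^ 2) := by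
  obtain ⟨d, hd, hdc⟩ := exists_card_small_subsets_le (h := 1 / 2) (by norm_num)
  refine ⟨min d 1, lt_min hd one_pos, min_le_right _ _, fun g hg => ?_⟩
  obtain ⟨ε, hε, hεc⟩ := exists_card_small_subsets_le hg
  refine ⟨ε, hε, fun K => ?_⟩
  refine ⟨K * (Fintype.card (SimpleGraph (Fin K)) : ℝ) ^ 2, by positivity,
    fun W _ hW T 𝒮 h𝒮 => ?_⟩
  have hcK : 1 ≤ Fintype.card (SimpleGraph (Fin K)) := Fintype.card_pos
  have key := card_le_of_forall_exists
    (I := (W → Fin K) × SimpleGraph (Fin K) × SimpleGraph (Fin K))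
    (fun i => ((edges (i.2.1.comap i.1)).card : ℝ) + (edges (i.2.2.comap i.1)).card / 2 ≤ T)
    (fun i H => ((edges H ∩ edges (i.2.2.comap i.1)).card : ℝ)
        ≤ min d 1 * (edges (i.2.2.comap i.1)).card ∧
      ((edges H \ (edges (i.2.1.comap i.1) ∪ edges (i.2.2.comap i.1))).card : ℝ)
        ≤ ε * (Fintype.card W : ℝ) ^ 2)
    (2 ^ (T + g * (Fintype.card W : ℝ) ^ 2)) (by positivity) (fun i hi t ht => by
      refine (card_sparse_graphs_le (min_le_left d 1) hdc hεc _ _ t ht).trans ?_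
      apply Real.rpow_le_rpow_of_exponent_le (by norm_num)
      linarith only [hi]) 𝒮 (fun H hH => by
      obtain ⟨p, R, R', h1, h2, h3⟩ := h𝒮 H hH
      exact ⟨(p, R, R'), h1, h2, h3⟩)
  refine key.trans ?_
  rw [Fintype.card_prod, Fintype.card_prod, Fintype.card_fun, Fintype.card_fin]
  push_cast
  gcongr
  rw [mul_pow, ← pow_two]
  gcongr
  exact le_self_pow₀ (one_le_pow₀ (by exact_mod_cast hcK)) (by omega)

theorem hasCopy_of_dense {W : Type} [Nonempty W] {U : Type} [Fintype U] (F : SimpleGraph U)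
    (H : SimpleGraph W) {d b : ℝ} (hd : 0 < d) (hd1 : d ≤ 1) (hb : 1 ≤ b) (C : U → Finset W)
    (hC : ∀ u, embedConst d (Fintype.card U) * b ≤ (C u).card)
    (h : ∀ u u', F.Adj u u' → ∀ A ⊆ C u, ∀ B ⊆ C u', b ≤ A.card → b ≤ B.card →
      d * A.card * B.card ≤ ((A ×ˢ B).filter fun p => H.Adj p.1 p.2).card) : HasCopy F H := by
  obtain ⟨g, hg, -, hg'⟩ := exists_embedding_of_dense F H hd hd1 hb Finset.univ C
    (fun u _ => hC u) (fun u _ u' _ => h u u')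
  exact ⟨⟨g, fun x y hxy => hg (by simp) (by simp) hxy⟩,
    fun a b hab => hg' a (by simp) b (by simp) hab⟩

section Container

variable {W : Type} [Fintype W]

/-- Dense regular pairs of distinct parts. -/
def reducedGraph (H : SimpleGraph W) (P : Finpartition (Finset.univ : Finset W)) (ε δ : ℝ) :
    SimpleGraph P.parts where
  Adj U V := U ≠ V ∧ H.IsUniform ε U.1 V.1 ∧ δ ≤ H.edgeDensity U.1 V.1
  symm := ⟨fun U V h => ⟨h.1.symm, h.2.1.symm, by rw [SimpleGraph.edgeDensity_comm]; exact h.2.2⟩⟩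
  loopless := ⟨fun _ h => h.1 rfl⟩

/-- The part of a partition containing a vertex. -/
noncomputable def partOf (P : Finpartition (Finset.univ : Finset W)) (w : W) : P.parts :=
  ⟨P.part w, P.part_mem.2 (Finset.mem_univ w)⟩

theorem mem_partOf (P : Finpartition (Finset.univ : Finset W)) (w : W) : w ∈ (partOf P w).1 :=
  P.mem_part (Finset.mem_univ w)

theorem card_edges_sdiff_reducedGraph_le [Nonempty W] (H : SimpleGraph W)
    (P : Finpartition (Finset.univ : Finset W)) {ε ε' δ : ℝ} (hε : 0 < ε) (hε' : 0 < ε')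
    (hδ : 0 ≤ δ) (hP : P.IsEquipartition) (hPu : P.IsUniform H ε') (hP' : 4 / ε ≤ P.parts.card) :
    2 * ((edges H \ edges ((reducedGraph H P ε' δ).comap (partOf P))).card : ℝ)
      ≤ (4 * ε' + ε / 2 + 4 * δ) * (Fintype.card W : ℝ) ^ 2 := by
  set R := (reducedGraph H P ε' δ).comap (partOf P) with hR
  let A := (P.nonUniforms H ε').biUnion fun (U, V) ↦ U ×ˢ V
  let B := P.parts.biUnion Finset.offDiag
  let C := (P.sparsePairs H δ).biUnion fun (U, V) ↦ H.interedges U V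
  have h0 : edges H \ edges R = edges (H \ R) := by
    ext e
    induction e with | _ u v => simp [mk_mem_edges]
  have hsub : (Finset.univ.filter fun p : W × W => (H \ R).Adj p.1 p.2) ⊆ A ∪ B ∪ C := by
    rintro ⟨u, v⟩ h
    simp only [Finset.mem_filter, Finset.mem_univ, true_and, SimpleGraph.sdiff_adj, hR,
      SimpleGraph.comap_adj, reducedGraph] at h
    obtain ⟨huv, hn⟩ := h
    have hu := mem_partOf P u
    have hv := mem_partOf P v
    simp only [A, B, C, Finset.mem_union, Finset.mem_biUnion, Prod.exists,
      Finset.mem_product, Finpartition.mk_mem_nonUniforms, Finset.mem_offDiag,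
      Finpartition.mk_mem_sparsePairs, SimpleGraph.mem_interedges_iff]
    by_cases h1 : partOf P u = partOf P v
    · exact Or.inl (Or.inr ⟨_, (partOf P u).2, hu, h1 ▸ hv, huv.ne⟩)
    have h1' : (partOf P u).1 ≠ (partOf P v).1 := fun h => h1 (Subtype.ext h)
    by_cases h2 : H.IsUniform ε' (partOf P u).1 (partOf P v).1
    · refine Or.inr ⟨_, _, ⟨(partOf P u).2, (partOf P v).2, h1', ?_⟩, hu, hv, huv⟩
      by_contra h3
      exact hn ⟨h1, h2, not_lt.1 h3⟩
    · exact Or.inl (Or.inl ⟨_, _, ⟨(partOf P u).2, (partOf P v).2, h1', h2⟩, hu, hv⟩)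
  have h1 : 2 * (edges H \ edges R).card
      = (Finset.univ.filter fun p : W × W => (H \ R).Adj p.1 p.2).card := by
    rw [h0, two_mul_card_edges, Finset.card_filter, Fintype.sum_prod_type]
    congr!
  have hA : ((A.card : ℕ) : ℝ) ≤ 4 * ε' * (Fintype.card W : ℝ) ^ 2 :=
    (hP.sum_nonUniforms_lt Finset.univ_nonempty hε' hPu).le
  have hB : ((B.card : ℕ) : ℝ) ≤ ε / 2 * (Fintype.card W : ℝ) ^ 2 :=
    hP.card_biUnion_offDiag_le hε hP'
  have hC : ((C.card : ℕ) : ℝ) ≤ 4 * δ * (Fintype.card W : ℝ) ^ 2 :=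
    hP.card_interedges_sparsePairs_le hδ
  have h2 : (2 * ((edges H \ edges R).card : ℝ)) ≤ A.card + B.card + C.card := by
    have := (Finset.card_le_card hsub).trans (Finset.card_union_le _ _)
    have h3 := Finset.card_union_le A B
    have h4 : 2 * (edges H \ edges R).card ≤ A.card + B.card + C.card := by omega
    exact_mod_cast h4
  linarith

theorem hasCopy_of_not_cliqueFree [Nonempty W] {U : Type} [Fintype U] {F : SimpleGraph U} {r : ℕ}
    (hF : F.Colorable (r + 1)) (H : SimpleGraph W)
    (P : Finpartition (Finset.univ : Finset W)) {ε' δ : ℝ} (hε' : 0 < ε') (hδ : 0 < δ)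
    (hδ1 : δ ≤ 1) (hεδ : ε' ≤ δ / 2) (hεe : embedConst (δ / 2) (Fintype.card U) * (2 * ε') ≤ 1)
    (hP : P.IsEquipartition)
    (hm : 1 ≤ 2 * ε' * (Fintype.card W / P.parts.card : ℕ))
    (hR : ¬ ((reducedGraph H P ε' δ).comap (partOf P)).CliqueFree (r + 1)) : HasCopy F H := by
  obtain ⟨c⟩ := hF
  simp only [SimpleGraph.CliqueFree, not_forall, not_not] at hR
  obtain ⟨t, ht⟩ := hR
  let φ : Fin (r + 1) ≃ t := (Fintype.equivFinOfCardEq (by simp [ht.card_eq])).symm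
  set a : ℕ := Fintype.card W / P.parts.card with ha
  have ha1 : 1 ≤ a := Nat.one_le_iff_ne_zero.2 fun h => by
    rw [h] at hm; norm_num at hm
  have hle : ∀ U ∈ P.parts, a ≤ U.card := fun U hU => hP.average_le_card_part hU
  have hge : ∀ U ∈ P.parts, U.card ≤ 2 * a := fun U hU => by
    have : U.card ≤ a + 1 := hP.card_part_le_average_add_one hU
    omega
  refine hasCopy_of_dense F H (d := δ / 2) (b := 2 * ε' * a) (by positivity) (by linarith) hm
    (fun u => (partOf P (φ (c u)).1).1) (fun u => ?_) (fun u u' huu' A hA B hB hbA hbB => ?_)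
  · have h1 : (a : ℝ) ≤ (partOf P (φ (c u)).1).1.card := by
      exact_mod_cast hle _ (partOf P _).2
    calc _ = embedConst (δ / 2) (Fintype.card U) * (2 * ε') * a := by ring
      _ ≤ 1 * a := by gcongr
      _ ≤ _ := by linarith
  · have hne : (φ (c u)).1 ≠ (φ (c u')).1 := fun h =>
      c.valid huu' (φ.injective (Subtype.ext h))
    obtain ⟨-, hu, hd⟩ := ht.isClique (φ (c u)).2 (φ (c u')).2 hne
    have hbig : ∀ (x : P.parts) (A : Finset W), 2 * ε' * a ≤ A.card →
        (x.1.card : ℝ) * ε' ≤ A.card := fun x A hA => by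
      have : (x.1.card : ℝ) ≤ 2 * a := by exact_mod_cast hge _ x.2
      nlinarith
    have h1 := hu hA hB (hbig _ A hbA) (hbig _ B hbB)
    have h2 : δ / 2 ≤ (H.edgeDensity A B : ℝ) := by
      have := (abs_lt.1 h1).1
      linarith
    have hA0 : (0 : ℝ) < A.card := by linarith
    have hB0 : (0 : ℝ) < B.card := by linarith
    rw [SimpleGraph.edgeDensity_def] at h2
    push_cast at h2
    rw [le_div_iff₀ (by positivity), SimpleGraph.interedges_def] at h2
    linarith

end Container

theorem exists_container {U : Type} [Fintype U] {F : SimpleGraph U} {r : ℕ}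
    (hF : F.Colorable (r + 1)) {ε : ℝ} (hε : 0 < ε) :
    ∃ K m₀ : ℕ, ∀ (W : Type) [Fintype W], m₀ ≤ Fintype.card W → ∀ H : SimpleGraph W,
      ¬ HasCopy F H → ∃ (p : W → Fin K) (R : SimpleGraph (Fin K)),
        (R.comap p).CliqueFree (r + 1) ∧
        ((edges H \ edges (R.comap p)).card : ℝ) ≤ ε * (Fintype.card W : ℝ) ^ 2 := by
  set δ : ℝ := min (ε / 8) 1 with hδ
  have hδ0 : 0 < δ := lt_min (by positivity) one_pos
  have hδ1 : δ ≤ 1 := min_le_right _ _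
  have hδε : δ ≤ ε / 8 := min_le_left _ _
  set c := embedConst (δ / 2) (Fintype.card U) with hc
  have hc1 : 1 ≤ c := one_le_embedConst (by positivity) (by linarith) _
  set ε' : ℝ := min (δ / 2) (1 / (2 * c)) with hε'
  have hε'0 : 0 < ε' := lt_min (by positivity) (by positivity)
  have hε'δ : ε' ≤ δ / 2 := min_le_left _ _
  have hε'c : c * (2 * ε') ≤ 1 := by
    have h1 : ε' ≤ 1 / (2 * c) := min_le_right _ _
    rw [le_div_iff₀ (by positivity)] at h1
    linarith
  set l : ℕ := ⌈4 / ε⌉₊ with hl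
  set K := SzemerediRegularity.bound ε' l with hK
  set q : ℕ := ⌈1 / (2 * ε')⌉₊ with hq
  refine ⟨K, l + K * q + 1, fun W _ hW H hH => ?_⟩
  have : Nonempty W := Fintype.card_pos_iff.1 (by omega)
  obtain ⟨P, hP, hPl, hPK, hPu⟩ := szemeredi_regularity H hε'0 (l := l) (by omega)
  have hP' : 4 / ε ≤ P.parts.card := (Nat.le_ceil _).trans (by exact_mod_cast hPl)
  have hP0 : 0 < P.parts.card := P.parts_nonempty Finset.univ_nonempty.ne_empty |>.card_pos
  have hqa : q ≤ Fintype.card W / P.parts.card := by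
    rw [Nat.le_div_iff_mul_le hP0]
    have : q * P.parts.card ≤ K * q := by rw [mul_comm]; gcongr
    omega
  obtain ⟨ι⟩ : Nonempty (P.parts ↪ Fin K) :=
    Function.Embedding.nonempty_of_card_le (by simpa using hPK)
  refine ⟨fun w => ι (partOf P w), (reducedGraph H P ε' δ).map ι, ?_⟩
  have hmap : ((reducedGraph H P ε' δ).map ι).comap (fun w => ι (partOf P w))
      = (reducedGraph H P ε' δ).comap (partOf P) := by
    ext u v
    simp [SimpleGraph.map_adj]
  rw [hmap]
  constructor
  · by_contra hR
    refine hH (hasCopy_of_not_cliqueFree hF H P hε'0 hδ0 hδ1 hε'δ hε'c hP ?_ hR)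
    have h1 : 1 / (2 * ε') ≤ (Fintype.card W / P.parts.card : ℕ) :=
      (Nat.le_ceil _).trans (by exact_mod_cast hqa)
    rw [div_le_iff₀ (by positivity)] at h1
    linarith
  · have := card_edges_sdiff_reducedGraph_le H P hε hε'0 hδ0.le hP hPu hP'
    have h2 : (4 * ε' + ε / 2 + 4 * δ) * (Fintype.card W : ℝ) ^ 2
        ≤ (2 * ε) * (Fintype.card W : ℝ) ^ 2 := by
      gcongr
      linarith
    linarith

theorem IsCritical.exists_coloring {V : Type} {F : SimpleGraph V} {r : ℕ} (hF : IsCritical r F) :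
    ∃ (φ : V → Fin r) (x y : V), F.Adj x y ∧ φ x = φ y ∧
      ∀ u v, F.Adj u v → φ u = φ v → (u = x ∧ v = y) ∨ (u = y ∧ v = x) := by
  obtain ⟨hχ, e, he, hχe⟩ := hF
  have hnot : ¬ F.Colorable r := fun h => by
    have := h.chromaticNumber_le
    rw [hχ] at this
    have h2 : r + 1 ≤ r := by exact_mod_cast this
    omega
  have hcol : (F.deleteEdges {e}).Colorable r :=
    SimpleGraph.chromaticNumber_le_iff_colorable.1 hχe.le
  obtain ⟨c⟩ := hcol
  induction e with | _ x y =>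
  have key : ∀ u v, F.Adj u v → c u = c v → (u = x ∧ v = y) ∨ (u = y ∧ v = x) := by
    intro u v huv hc
    by_contra h
    refine c.valid (?_ : (F.deleteEdges {s(x, y)}).Adj u v) hc
    rw [SimpleGraph.deleteEdges_adj]
    exact ⟨huv, by simpa using h⟩
  refine ⟨c, x, y, he, ?_, key⟩
  by_contra hxy
  refine hnot ⟨SimpleGraph.Coloring.mk c fun {u v} huv hc => ?_⟩
  rcases key u v huv hc with ⟨rfl, rfl⟩ | ⟨rfl, rfl⟩
  · exact hxy hc
  · exact hxy hc.symm

theorem IsCritical.colorable {V : Type} {F : SimpleGraph V} {r : ℕ} (hF : IsCritical r F) :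
    F.Colorable (r + 1) :=
  SimpleGraph.chromaticNumber_le_iff_colorable.1 hF.1.le

theorem IsCritical.not_colorable {V : Type} {F : SimpleGraph V} {r : ℕ} (hF : IsCritical r F) :
    ¬ F.Colorable r := fun h => by
  have := h.chromaticNumber_le
  rw [hF.1] at this
  have h2 : r + 1 ≤ r := by exact_mod_cast this
  omega

theorem embedConst_mono {d : ℝ} (hd : 0 < d) (hd1 : d ≤ 1) : Monotone (embedConst d) := by
  refine monotone_nat_of_le_succ fun h => ?_
  have h1 := one_le_embedConst hd hd1 h
  rw [embedConst, le_div_iff₀ hd]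
  nlinarith [(Nat.cast_nonneg h : (0 : ℝ) ≤ h)]

section Critical

variable {V W : Type} [Fintype V] [Fintype W] [Nonempty W]

theorem hasCopy_of_large_nbhd {r : ℕ} {F : SimpleGraph V} (hF : IsCritical r F) (H : SimpleGraph W)
    (c : W → Fin r) {d b : ℝ} (hd : 0 < d) (hd1 : d ≤ 1) (hb : 1 ≤ b)
    (hdens : ∀ A B : Finset W, ∀ i j, i ≠ j → (∀ w ∈ A, c w = i) → (∀ w ∈ B, c w = j) →
      b ≤ A.card → b ≤ B.card →
      d * A.card * B.card ≤ ((A ×ˢ B).filter fun p => H.Adj p.1 p.2).card)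
    (v : W) (hv : ∀ j, embedConst d (Fintype.card V) * b
      ≤ (Finset.univ.filter fun w => H.Adj v w ∧ c w = j).card) : HasCopy F H := by
  obtain ⟨φ, x, y, -, -, hφ⟩ := hF.exists_coloring
  obtain ⟨g, hg, hgC, hgA⟩ := exists_embedding_of_dense F H hd hd1 hb (Finset.univ.erase x)
    (fun u => Finset.univ.filter fun w => H.Adj v w ∧ c w = φ u)
    (fun u _ => le_trans (by gcongr; exact embedConst_mono hd hd1 (Finset.card_le_univ _))
      (hv (φ u)))
    (fun u hu u' hu' huu' A hA B hB => by
      refine hdens A B (φ u) (φ u') (fun h => ?_)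
        (fun w hw => (Finset.mem_filter.1 (hA hw)).2.2)
        (fun w hw => (Finset.mem_filter.1 (hB hw)).2.2)
      rcases hφ u u' huu' h with ⟨h1, -⟩ | ⟨-, h1⟩
      · exact (Finset.mem_erase.1 hu).1 h1
      · exact (Finset.mem_erase.1 hu').1 h1)
  have hgv : ∀ u, u ≠ x → H.Adj v (g u) := fun u hu =>
    (Finset.mem_filter.1 (hgC u (by simp [hu]))).2.1
  refine ⟨⟨fun u => if u = x then v else g u, ?_⟩, ?_⟩
  · intro u u' h
    dsimp only at h
    split_ifs at h with h1 h2 h2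
    · rw [h1, h2]
    · exact absurd h (hgv u' h2).ne
    · exact absurd h (hgv u h1).ne'
    · exact hg (by simp [h1]) (by simp [h2]) h
  · intro u u' h
    show H.Adj (if u = x then v else g u) (if u' = x then v else g u')
    split_ifs with h1 h2 h2
    · exact absurd (h1.trans h2.symm) h.ne
    · exact hgv u' h2
    · exact (hgv u h1).symm
    · exact hgA u (by simp [h1]) u' (by simp [h2]) h

theorem hasCopy_of_large_common_nbhd {r : ℕ} {F : SimpleGraph V} (hF : IsCritical r F)
    (H : SimpleGraph W) (c : W → Fin r) {d b : ℝ} (hd : 0 < d) (hd1 : d ≤ 1) (hb : 1 ≤ b)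
    (hdens : ∀ A B : Finset W, ∀ i j, i ≠ j → (∀ w ∈ A, c w = i) → (∀ w ∈ B, c w = j) →
      b ≤ A.card → b ≤ B.card →
      d * A.card * B.card ≤ ((A ×ˢ B).filter fun p => H.Adj p.1 p.2).card)
    (v w : W) (hvw : H.Adj v w)
    (hS : embedConst d (Fintype.card V) * b + 2 ≤ (Finset.univ.filter fun z => c z = c v).card)
    (hN : ∀ j, j ≠ c v → embedConst d (Fintype.card V) * b
      ≤ (Finset.univ.filter fun z => H.Adj v z ∧ H.Adj w z ∧ c z = j).card) : HasCopy F H := by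
  obtain ⟨φ₀, x, y, hxy, hφxy, hφ₀⟩ := hF.exists_coloring
  obtain ⟨φ, hφx, hφ⟩ : ∃ φ : V → Fin r, (φ x = c v ∧ φ y = c v) ∧
      ∀ u v, F.Adj u v → φ u = φ v → (u = x ∧ v = y) ∨ (u = y ∧ v = x) :=
    ⟨fun u => Equiv.swap (φ₀ x) (c v) (φ₀ u), by simp [← hφxy],
      fun u v huv h => hφ₀ u v huv (Equiv.injective _ h)⟩
  let C : V → Finset W := fun u => if φ u = c v
    then (Finset.univ.filter fun z => c z = c v) \ {v, w}
    else Finset.univ.filter fun z => H.Adj v z ∧ H.Adj w z ∧ c z = φ u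
  have hCc : ∀ u, ∀ z ∈ C u, c z = φ u := by
    intro u z hz
    simp only [C] at hz
    split_ifs at hz with h
    · simp at hz; rw [h]; exact hz.1
    · simp at hz; exact hz.2.2
  have hCv : ∀ u, ∀ z ∈ C u, z ≠ v ∧ z ≠ w := by
    intro u z hz
    simp only [C] at hz
    split_ifs at hz with h
    · simp at hz; tauto
    · simp at hz; exact ⟨hz.1.ne', hz.2.1.ne'⟩
  have hCA : ∀ u, φ u ≠ c v → ∀ z ∈ C u, H.Adj v z ∧ H.Adj w z := by
    intro u hu z hz
    simp only [C, if_neg hu] at hz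
    simp at hz; exact ⟨hz.1, hz.2.1⟩
  have hφu : ∀ u, u ≠ x → u ≠ y → F.Adj x u ∨ F.Adj y u → φ u ≠ c v := by
    intro u hux huy h hc
    rcases h with h | h
    · rcases hφ x u h (hφx.1.trans hc.symm) with h1 | h1
      · exact huy h1.2
      · exact hux h1.2
    · rcases hφ y u h (hφx.2.trans hc.symm) with h1 | h1
      · exact huy h1.2
      · exact hux h1.2
  obtain ⟨g, hg, hgC, hgA⟩ := exists_embedding_of_dense F H hd hd1 hb
    ((Finset.univ.erase x).erase y) C
    (fun u _ => by
      refine le_trans (mul_le_mul_of_nonneg_right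
        (embedConst_mono hd hd1 (Finset.card_le_univ _)) (by linarith)) ?_
      simp only [C]
      split_ifs with h
      · have h1 := Finset.le_card_sdiff {v, w} (Finset.univ.filter fun z => c z = c v)
        have h2 : ({v, w} : Finset W).card ≤ 2 := Finset.card_le_two
        have h3 : (Finset.univ.filter fun z => c z = c v).card
          ≤ ((Finset.univ.filter fun z => c z = c v) \ {v, w}).card + 2 := by omega
        have h4 : ((Finset.univ.filter fun z => c z = c v).card : ℝ)
          ≤ ((Finset.univ.filter fun z => c z = c v) \ {v, w}).card + 2 := by exact_mod_cast h3
        linarith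
      · exact hN _ h)
    (fun u hu u' hu' huu' A hA B hB => by
      refine hdens A B (φ u) (φ u') (fun h => ?_)
        (fun z hz => hCc u z (hA hz)) (fun z hz => hCc u' z (hB hz))
      simp only [Finset.mem_erase] at hu hu'
      rcases hφ u u' huu' h with h1 | h1
      · exact hu.2.1 h1.1
      · exact hu.1 h1.1)
  have hmem : ∀ u, u ≠ x → u ≠ y → u ∈ (Finset.univ.erase x).erase y := by
    intro u h1 h2; simp [h1, h2]
  have hgvw : ∀ u, u ≠ x → u ≠ y → g u ≠ v ∧ g u ≠ w := fun u h1 h2 =>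
    hCv u _ (hgC u (hmem u h1 h2))
  have hgx : ∀ u, u ≠ x → u ≠ y → F.Adj x u ∨ F.Adj y u → H.Adj v (g u) ∧ H.Adj w (g u) :=
    fun u h1 h2 h => hCA u (hφu u h1 h2 h) _ (hgC u (hmem u h1 h2))
  refine ⟨⟨fun u => if u = x then v else if u = y then w else g u, ?_⟩, ?_⟩
  · intro u u' h
    dsimp only at h
    split_ifs at h with h1 h2 h3 h3 h2 h4 h2 h4
    · rw [h1, h2]
    · exact absurd h hvw.ne
    · exact absurd h.symm (hgvw u' h2 h3).1
    · exact absurd h hvw.ne'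
    · rw [h3, h4]
    · exact absurd h.symm (hgvw u' h2 h4).2
    · exact absurd h (hgvw u h1 h3).1
    · exact absurd h (hgvw u h1 h3).2
    · exact hg (hmem u h1 h3) (hmem u' h2 h4) h
  · intro u u' h
    show H.Adj (if u = x then v else if u = y then w else g u)
      (if u' = x then v else if u' = y then w else g u')
    split_ifs with h1 h2 h3 h3 h2 h4 h2 h4
    · exact absurd (h1.trans h2.symm) h.ne
    · exact hvw
    · exact (hgx u' h2 h3 (Or.inl (h1 ▸ h))).1
    · exact hvw.symm
    · exact absurd (h3.trans h4.symm) h.ne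
    · exact (hgx u' h2 h4 (Or.inr (h3 ▸ h))).2
    · exact (hgx u h1 h3 (Or.inl (h2 ▸ h.symm))).1.symm
    · exact (hgx u h1 h3 (Or.inr (h4 ▸ h.symm))).2.symm
    · exact hgA u (hmem u h1 h3) u' (hmem u' h2 h4) h

end Critical

/-- The complete multipartite graph given by a colouring. -/
def crossGraph {W : Type} {r : ℕ} (c : W → Fin r) : SimpleGraph W :=
  (⊤ : SimpleGraph (Fin r)).comap c

theorem crossGraph_adj {W : Type} {r : ℕ} {c : W → Fin r} {u v : W} :
    (crossGraph c).Adj u v ↔ c u ≠ c v := Iff.rfl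

/-- A colour class. -/
noncomputable def colorClass {W : Type} [Fintype W] {r : ℕ} (c : W → Fin r) (i : Fin r) :
    Finset W := Finset.univ.filter fun w => c w = i

theorem mem_colorClass {W : Type} [Fintype W] {r : ℕ} {c : W → Fin r} {i : Fin r} {w : W} :
    w ∈ colorClass c i ↔ c w = i := by simp [colorClass]

/-- A colouring of a graph whose classes are large, with small inner degrees, such that the ends
of every inner edge have few common neighbours in some other class. -/
structure IsFine {W : Type} [Fintype W] {r : ℕ} (η : ℝ) (H : SimpleGraph W) (c : W → Fin r) :
    Prop where
  large : ∀ i, (Fintype.card W : ℝ) / (2 * r) ≤ (colorClass c i).card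
  inner : ∀ v, ((Finset.univ.filter fun w => H.Adj v w ∧ c w = c v).card : ℝ)
    ≤ η * Fintype.card W
  common : ∀ v w, H.Adj v w → c v = c w → ∃ j, j ≠ c v ∧
    ((Finset.univ.filter fun z => H.Adj v z ∧ H.Adj w z ∧ c z = j).card : ℝ)
      ≤ η * Fintype.card W

theorem sq_div_add_le_sum_sq {r : ℕ} (s : Fin r → ℝ) (i : Fin r) :
    (∑ j, s j) ^ 2 / r + (s i - (∑ j, s j) / r) ^ 2 ≤ ∑ j, s j ^ 2 := by
  have hr : (r : ℝ) ≠ 0 := by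
    have := i.pos
    positivity
  set m := ∑ j, s j with hm
  have h1 : ∑ j, (s j - m / r) ^ 2 = ∑ j, s j ^ 2 - m ^ 2 / r := by
    simp only [sub_sq, Finset.sum_add_distrib, Finset.sum_sub_distrib, ← Finset.sum_mul,
      ← Finset.mul_sum, ← hm, Finset.sum_const, Finset.card_univ, Fintype.card_fin, nsmul_eq_mul]
    field_simp
    ring
  have h2 : (s i - m / r) ^ 2 ≤ ∑ j, (s j - m / r) ^ 2 :=
    Finset.single_le_sum (f := fun j => (s j - m / r) ^ 2) (fun j _ => sq_nonneg _)
      (Finset.mem_univ i)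
  linarith

section Cross

variable {W : Type} [Fintype W] {r : ℕ}

theorem sum_card_colorClass (c : W → Fin r) : ∑ i, (colorClass c i).card = Fintype.card W := by
  rw [← Finset.card_univ, Finset.card_eq_sum_card_fiberwise (f := c) (t := Finset.univ)
    (fun _ _ => Finset.mem_coe.2 (Finset.mem_univ _))]
  rfl

theorem two_mul_card_edges_crossGraph (c : W → Fin r) :
    2 * (edges (crossGraph c)).card + ∑ i, (colorClass c i).card ^ 2 = Fintype.card W ^ 2 := by
  have h1 : ∑ i, (colorClass c i).card ^ 2 = ∑ u, ∑ v, if c u = c v then 1 else 0 := by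
    rw [← Finset.sum_fiberwise (g := c)]
    refine Finset.sum_congr rfl fun i _ => ?_
    rw [Finset.sum_congr rfl (g := fun _ => (colorClass c i).card), Finset.sum_const, smul_eq_mul,
      sq]
    · rfl
    · intro u hu
      rw [(Finset.mem_filter.1 hu).2, colorClass, Finset.card_filter]
      simp only [eq_comm]
  rw [two_mul_card_edges, h1, ← Finset.sum_add_distrib]
  simp_rw [← Finset.sum_add_distrib, crossGraph_adj]
  rw [Finset.sum_congr rfl (g := fun _ => Fintype.card W)]
  · simp [sq]
  · intro u _
    rw [Finset.sum_congr rfl (g := fun _ => 1)]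
    · simp
    · intro v _
      by_cases h : c u = c v <;> simp [h]

theorem card_edges_crossGraph_le (c : W → Fin r) (i : Fin r) :
    ((edges (crossGraph c)).card : ℝ) ≤ (1 - 1 / r) * (Fintype.card W : ℝ) ^ 2 / 2
      - ((colorClass c i).card - (Fintype.card W : ℝ) / r) ^ 2 / 2 := by
  have h1 := sq_div_add_le_sum_sq (fun j => ((colorClass c j).card : ℝ)) i
  have h2 : ∑ j, ((colorClass c j).card : ℝ) = Fintype.card W := by
    exact_mod_cast sum_card_colorClass c
  have h3 : 2 * ((edges (crossGraph c)).card : ℝ) + ∑ i, ((colorClass c i).card : ℝ) ^ 2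
      = (Fintype.card W : ℝ) ^ 2 := by exact_mod_cast two_mul_card_edges_crossGraph c
  rw [h2] at h1
  have h4 : (1 - 1 / (r : ℝ)) * (Fintype.card W : ℝ) ^ 2
    = (Fintype.card W : ℝ) ^ 2 - (Fintype.card W : ℝ) ^ 2 / r := by ring
  rw [h4]
  linarith

theorem edges_sdiff (G H : SimpleGraph W) : edges (G \ H) = edges G \ edges H := by
  ext e
  induction e with | _ u v => simp [mk_mem_edges]

/-- In a colouring with the fewest inner edges, no vertex has more neighbours in its own class
than in another one. -/
theorem card_inner_nbhd_le_of_minimal (H : SimpleGraph W) (c : W → Fin r)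
    (hc : ∀ c' : W → Fin r, (edges (H \ crossGraph c)).card ≤ (edges (H \ crossGraph c')).card)
    (v : W) (j : Fin r) :
    (Finset.univ.filter fun w => H.Adj v w ∧ c w = c v).card
      ≤ (Finset.univ.filter fun w => H.Adj v w ∧ c w = j).card := by
  have key : ∀ c' : W → Fin r, 2 * (edges (H \ crossGraph c')).card
      = 2 * (Finset.univ.filter fun w => H.Adj v w ∧ c' w = c' v).card
        + ∑ u ∈ Finset.univ.erase v, ∑ w ∈ Finset.univ.erase v,
          if H.Adj u w ∧ c' u = c' w then 1 else 0 := by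
    intro c'
    have h1 : ∀ u, (∑ w, if H.Adj u w ∧ c' u = c' w then 1 else 0)
        = (if H.Adj u v ∧ c' u = c' v then 1 else 0)
          + ∑ w ∈ Finset.univ.erase v, if H.Adj u w ∧ c' u = c' w then 1 else 0 := fun u =>
      (Finset.add_sum_erase _ _ (Finset.mem_univ v)).symm
    have h2 : (∑ u ∈ Finset.univ.erase v, if H.Adj u v ∧ c' u = c' v then 1 else 0)
        = (Finset.univ.filter fun w => H.Adj v w ∧ c' w = c' v).card := by
      rw [Finset.card_filter, ← Finset.add_sum_erase _ _ (Finset.mem_univ v)]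
      simp [H.adj_comm v]
    have h3 : (∑ w, if H.Adj v w ∧ c' v = c' w then 1 else 0)
        = (Finset.univ.filter fun w => H.Adj v w ∧ c' w = c' v).card := by
      rw [Finset.card_filter]
      simp only [eq_comm (a := c' v)]
    rw [two_mul_card_edges]
    simp only [SimpleGraph.sdiff_adj, crossGraph_adj, not_not]
    rw [← Finset.add_sum_erase _ _ (Finset.mem_univ v), h3,
      Finset.sum_congr rfl (fun u _ => h1 u), Finset.sum_add_distrib, h2]
    ring
  have h1 := hc (Function.update c v j)
  have h2 := key c
  have h3 := key (Function.update c v j)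
  have h4 : (∑ u ∈ Finset.univ.erase v, ∑ w ∈ Finset.univ.erase v,
        if H.Adj u w ∧ Function.update c v j u = Function.update c v j w then 1 else 0)
      = ∑ u ∈ Finset.univ.erase v, ∑ w ∈ Finset.univ.erase v,
        if H.Adj u w ∧ c u = c w then 1 else 0 := by
    refine Finset.sum_congr rfl fun u hu => Finset.sum_congr rfl fun w hw => ?_
    rw [Function.update_of_ne (Finset.mem_erase.1 hu).1,
      Function.update_of_ne (Finset.mem_erase.1 hw).1]
  have h5 : (Finset.univ.filter fun w => H.Adj v w ∧
      Function.update c v j w = Function.update c v j v)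
      = Finset.univ.filter fun w => H.Adj v w ∧ c w = j := by
    refine Finset.filter_congr fun w _ => ?_
    rw [Function.update_self]
    refine and_congr_right fun h => ?_
    rw [Function.update_of_ne h.ne']
  rw [h4, h5] at h3
  omega

theorem card_edges_inter_biclique (H Q : SimpleGraph W) {A B : Finset W} (hAB : Disjoint A B)
    (hQ : ∀ u v, Q.Adj u v ↔ (u ∈ A ∧ v ∈ B) ∨ (v ∈ A ∧ u ∈ B)) :
    (edges H ∩ edges Q).card = ((A ×ˢ B).filter fun p => H.Adj p.1 p.2).card := by
  symm
  refine Finset.card_bij (fun p _ => s(p.1, p.2)) ?_ ?_ ?_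
  · rintro ⟨u, v⟩ h
    simp only [Finset.mem_filter, Finset.mem_product] at h
    simp [mk_mem_edges, hQ, h]
  · rintro ⟨u, v⟩ h ⟨u', v'⟩ h' he
    simp only [Finset.mem_filter, Finset.mem_product] at h h'
    rcases Sym2.eq_iff.1 he with ⟨h1, h2⟩ | ⟨h1, h2⟩
    · simp only at h1 h2; rw [h1, h2]
    · simp only at h1 h2
      exact absurd h'.1.2 (Finset.disjoint_left.1 hAB (h1 ▸ h.1.1))
  · intro e he
    induction e with | _ u v =>
    simp only [Finset.mem_inter, mk_mem_edges, hQ] at he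
    rcases he with ⟨h1, ⟨h2, h3⟩ | ⟨h2, h3⟩⟩
    · exact ⟨(u, v), by simp [h1, h2, h3], rfl⟩
    · exact ⟨(v, u), by simp [h1.symm, h2, h3], Sym2.eq_swap⟩

end Cross

section Dichotomy

variable {V W : Type} [Fintype V] [Fintype W] {r : ℕ}

theorem isFine_of_dense [Nonempty W] {F : SimpleGraph V} (hF : IsCritical r F) (H : SimpleGraph W)
    (hH : ¬ HasCopy F H) (c : W → Fin r)
    (hc : ∀ c' : W → Fin r, (edges (H \ crossGraph c)).card ≤ (edges (H \ crossGraph c')).card)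
    (hlarge : ∀ i, (Fintype.card W : ℝ) / (2 * r) ≤ (colorClass c i).card)
    {d b η : ℝ} (hd : 0 < d) (hd1 : d ≤ 1) (hb : 1 ≤ b)
    (hbη : embedConst d (Fintype.card V) * b ≤ η * Fintype.card W)
    (hbr : embedConst d (Fintype.card V) * b + 2 ≤ (Fintype.card W : ℝ) / (2 * r))
    (hdens : ∀ A B : Finset W, ∀ i j, i ≠ j → (∀ w ∈ A, c w = i) → (∀ w ∈ B, c w = j) →
      b ≤ A.card → b ≤ B.card →
      d * A.card * B.card ≤ ((A ×ˢ B).filter fun p => H.Adj p.1 p.2).card) : IsFine η H c := by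
  refine ⟨hlarge, fun v => ?_, fun v w hvw hcvw => ?_⟩
  · by_contra! h
    refine hH (hasCopy_of_large_nbhd hF H c hd hd1 hb hdens v fun j => ?_)
    have h1 : ((Finset.univ.filter fun w => H.Adj v w ∧ c w = c v).card : ℝ)
        ≤ (Finset.univ.filter fun w => H.Adj v w ∧ c w = j).card := by
      exact_mod_cast card_inner_nbhd_le_of_minimal H c hc v j
    linarith
  · by_contra! h
    refine hH (hasCopy_of_large_common_nbhd hF H c hd hd1 hb hdens v w hvw ?_ fun j hj => ?_)
    · exact hbr.trans (hlarge (c v))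
    · exact hbη.trans (h j hj).le

theorem card_edges_crossGraph_le' (c : W → Fin r) (hr : 0 < r) :
    ((edges (crossGraph c)).card : ℝ) ≤ (1 - 1 / r) * (Fintype.card W : ℝ) ^ 2 / 2 := by
  have := card_edges_crossGraph_le c ⟨0, hr⟩
  have h2 := sq_nonneg (((colorClass c ⟨0, hr⟩).card : ℝ) - (Fintype.card W : ℝ) / r)
  linarith

theorem exists_inner_add_le (B : SimpleGraph W) (hr : 1 ≤ r) (hB : B.CliqueFree (r + 1)) :
    ∃ c : W → Fin r, ((edges B).card : ℝ) + (edges (B \ crossGraph c)).card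
      ≤ (1 - 1 / r) * (Fintype.card W : ℝ) ^ 2 / 2 := by
  obtain ⟨q, rfl⟩ : ∃ q, r = q + 1 := ⟨r - 1, by omega⟩
  obtain ⟨c, hc, hsum⟩ := exists_coloring_of_cliqueFreeOn B q Finset.univ (fun K _ => hB K)
  let c' : W → Fin (q + 1) := fun w => ⟨c w, hc w (Finset.mem_univ w)⟩
  refine ⟨c', ?_⟩
  have h1 := two_mul_card_edges B
  have h2 := two_mul_card_edges (B \ crossGraph c')
  have h3 := two_mul_card_edges (crossGraph c')
  simp only [SimpleGraph.sdiff_adj, crossGraph_adj, not_not, c', Fin.mk.injEq, ne_eq] at h2 h3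
  simp only [ne_eq] at hsum
  have h4 : (edges B).card + (edges (B \ crossGraph c')).card ≤ (edges (crossGraph c')).card := by
    have : 2 * (edges B).card + 2 * (edges (B \ crossGraph c')).card
        ≤ 2 * (edges (crossGraph c')).card := by
      rw [h1, h2, h3]
      convert hsum
    omega
  have h5 := card_edges_crossGraph_le' c' (by omega)
  have h6 : ((edges B).card : ℝ) + (edges (B \ crossGraph c')).card
    ≤ (edges (crossGraph c')).card := by exact_mod_cast h4
  linarith

theorem exists_minimal_coloring (H : SimpleGraph W) (hr : 1 ≤ r) :
    ∃ c : W → Fin r, ∀ c' : W → Fin r,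
      (edges (H \ crossGraph c)).card ≤ (edges (H \ crossGraph c')).card := by
  have : Nonempty (Fin r) := ⟨⟨0, hr⟩⟩
  exact Finite.exists_min fun c : W → Fin r => (edges (H \ crossGraph c)).card

end Dichotomy

theorem comap_equiv_comp {W X : Type} {K : ℕ} (e : X ≃ Fin K) (p : W → X) (R : SimpleGraph X) :
    (R.comap e.symm).comap (fun w => e (p w)) = R.comap p := by
  ext u v
  simp

section Blowup

variable {W : Type} [Fintype W] {r : ℕ}

theorem card_edges_biclique (Q : SimpleGraph W) {A B : Finset W} (hAB : Disjoint A B)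
    (hQ : ∀ u v, Q.Adj u v ↔ (u ∈ A ∧ v ∈ B) ∨ (v ∈ A ∧ u ∈ B)) :
    (edges Q).card = A.card * B.card := by
  have := card_edges_inter_biclique Q Q hAB hQ
  rw [Finset.inter_self] at this
  rw [this, ← Finset.card_product, Finset.filter_true_of_mem]
  rintro ⟨u, v⟩ h
  rw [Finset.mem_product] at h
  exact (hQ u v).2 (Or.inl h)

/-- A graph with few inner edges and a sparse pair inside two colour classes is sparse outside a
blow-up with few edges. -/
theorem exists_blowup_of_sparse_pair (H : SimpleGraph W) (c : W → Fin r) (hr : 1 ≤ r)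
    {d b : ℝ} (hb : 0 ≤ b) (A B : Finset W) (i j : Fin r) (hij : i ≠ j)
    (hA : ∀ w ∈ A, c w = i) (hB : ∀ w ∈ B, c w = j) (hbA : b ≤ A.card) (hbB : b ≤ B.card)
    (hAB : ((A ×ˢ B).filter fun p => H.Adj p.1 p.2).card < d * A.card * B.card) :
    ∃ (p : W → Fin r × Bool × Bool) (R R' : SimpleGraph (Fin r × Bool × Bool)),
      ((edges (R.comap p)).card : ℝ) + (edges (R'.comap p)).card / 2
        ≤ (1 - 1 / r) * (Fintype.card W : ℝ) ^ 2 / 2 - b ^ 2 / 2 ∧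
      ((edges H ∩ edges (R'.comap p)).card : ℝ) ≤ d * (edges (R'.comap p)).card ∧
      edges H \ (edges (R.comap p) ∪ edges (R'.comap p)) = edges (H \ crossGraph c) := by
  let R' : SimpleGraph (Fin r × Bool × Bool) :=
    { Adj := fun x y => x.1 ≠ y.1 ∧
        ((x.2.1 = true ∧ y.2.2 = true) ∨ (y.2.1 = true ∧ x.2.2 = true))
      symm := ⟨fun x y h => ⟨h.1.symm, h.2.symm⟩⟩
      loopless := ⟨fun x h => h.1 rfl⟩ }
  let p : W → Fin r × Bool × Bool := fun w => (c w, decide (w ∈ A), decide (w ∈ B))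
  have hdisj : Disjoint A B := Finset.disjoint_left.2 fun w h1 h2 =>
    hij ((hA w h1).symm.trans (hB w h2))
  have hR' : ∀ u v, (R'.comap p).Adj u v ↔ (u ∈ A ∧ v ∈ B) ∨ (v ∈ A ∧ u ∈ B) := by
    intro u v
    simp only [SimpleGraph.comap_adj, R', p, decide_eq_true_eq]
    refine ⟨fun h => h.2, fun h => ⟨?_, h⟩⟩
    rcases h with ⟨h1, h2⟩ | ⟨h1, h2⟩
    · rw [hA u h1, hB v h2]; exact hij
    · rw [hB u h2, hA v h1]; exact hij.symm
  have hle : R'.comap p ≤ crossGraph c := fun u v h => h.1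
  have hR : (((⊤ : SimpleGraph (Fin r)).comap Prod.fst \ R').comap p : SimpleGraph W)
      = crossGraph c \ R'.comap p := by
    ext u v
    simp [crossGraph_adj, p]
  have h1 := card_edges_inter_biclique H (R'.comap p) hdisj hR'
  have h2 := card_edges_biclique (R'.comap p) hdisj hR'
  have h3 : (edges (crossGraph c \ R'.comap p)).card + (edges (R'.comap p)).card
      = (edges (crossGraph c)).card := by
    rw [edges_sdiff, Finset.card_sdiff_add_card_eq_card (edges_mono hle)]
  refine ⟨p, (⊤ : SimpleGraph (Fin r)).comap Prod.fst \ R', R', ?_, ?_, ?_⟩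
  · rw [hR]
    have h4 := card_edges_crossGraph_le' c hr
    have h5 : ((edges (crossGraph c \ R'.comap p)).card : ℝ) + (edges (R'.comap p)).card
      = (edges (crossGraph c)).card := by exact_mod_cast h3
    have h6 : b ^ 2 ≤ (edges (R'.comap p)).card := by
      rw [h2, sq]; push_cast; gcongr
    linarith
  · rw [h1, h2]; push_cast; linarith
  · rw [hR, edges_sdiff, edges_sdiff, Finset.sdiff_union_of_subset (edges_mono hle)]

end Blowup

theorem exists_card_le_add_of_forall_or {α : Type*} (s : Finset α) (P Q : α → Prop)
    (h : ∀ a ∈ s, P a ∨ Q a) : ∃ s₁ s₂ : Finset α, (∀ a ∈ s₁, P a) ∧ (∀ a ∈ s₂, Q a) ∧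
      s.card ≤ s₁.card + s₂.card := by
  refine ⟨s.filter P, s.filter Q, fun a ha => (Finset.mem_filter.1 ha).2,
    fun a ha => (Finset.mem_filter.1 ha).2,
    (Finset.card_le_card ?_).trans (Finset.card_union_le _ _)⟩
  intro a ha
  rw [← Finset.filter_or]
  exact Finset.mem_filter.2 ⟨ha, h a ha⟩

/-- A graph without a fine colouring, close to `r`-partite, is sparse outside a blow-up with few
edges. -/
theorem exists_blowup_of_not_fine {V W : Type} [Fintype V] [Fintype W] [Nonempty W] {r : ℕ}
    (hr : 2 ≤ r) {F : SimpleGraph V} (hF : IsCritical r F) (H : SimpleGraph W)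
    (hH : ¬ HasCopy F H) {d β η ε : ℝ} (hd : 0 < d) (hd1 : d ≤ 1) (hβ : 0 < β)
    (hβη : embedConst d (Fintype.card V) * β ≤ η)
    (hβr : embedConst d (Fintype.card V) * β ≤ 1 / (4 * r))
    (hm : 8 * (r : ℝ) ≤ Fintype.card W) (hβm : 1 ≤ β * Fintype.card W)
    (hfine : ∀ c : W → Fin r, ¬ IsFine η H c)
    (c₀ : W → Fin r)
    (hc₀ : ((edges (H \ crossGraph c₀)).card : ℝ) ≤ ε * (Fintype.card W : ℝ) ^ 2) :
    ∃ (p : W → Fin r × Bool × Bool) (R R' : SimpleGraph (Fin r × Bool × Bool)),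
      ((edges (R.comap p)).card : ℝ) + (edges (R'.comap p)).card / 2
        ≤ (1 - 1 / r) * (Fintype.card W : ℝ) ^ 2 / 2 - β ^ 2 / 2 * (Fintype.card W : ℝ) ^ 2 ∧
      ((edges H ∩ edges (R'.comap p)).card : ℝ) ≤ d * (edges (R'.comap p)).card ∧
      ((edges H \ (edges (R.comap p) ∪ edges (R'.comap p))).card : ℝ)
        ≤ ε * (Fintype.card W : ℝ) ^ 2 := by
  have hr0 : (0 : ℝ) < r := by positivity
  have hE := one_le_embedConst hd hd1 (Fintype.card V)
  set m : ℝ := ((Fintype.card W : ℕ) : ℝ) with hmdef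
  have hm0 : 0 < m := by linarith
  have hβ1 : β ≤ 1 / (4 * r) := le_trans (le_mul_of_one_le_left hβ.le hE) hβr
  obtain ⟨c, hc⟩ := exists_minimal_coloring H (r := r) (by omega)
  have hcε : ((edges (H \ crossGraph c)).card : ℝ) ≤ ε * m ^ 2 :=
    le_trans (by exact_mod_cast hc c₀) hc₀
  by_cases hlarge : ∀ i, m / (2 * r) ≤ (colorClass c i).card
  · by_cases hdens : ∀ A B : Finset W, ∀ i j, i ≠ j → (∀ w ∈ A, c w = i) → (∀ w ∈ B, c w = j) →
      β * m ≤ A.card → β * m ≤ B.card →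
      d * A.card * B.card ≤ ((A ×ˢ B).filter fun p => H.Adj p.1 p.2).card
    · refine absurd (isFine_of_dense hF H hH c hc hlarge hd hd1 hβm ?_ ?_ hdens) (hfine c)
      · rw [← mul_assoc]; gcongr
      · rw [← mul_assoc]
        have h1 : embedConst d (Fintype.card V) * β * m ≤ 1 / (4 * r) * m := by gcongr
        have h2 : m / (2 * r) = 1 / (4 * r) * m + m / (4 * r) := by field_simp; norm_num
        have h3 : 2 ≤ m / (4 * r) := by rw [le_div_iff₀ (by positivity)]; linarith
        linarith
    · push Not at hdens
      obtain ⟨A, B, i, j, hij, hA, hB, hbA, hbB, hAB⟩ := hdens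
      obtain ⟨p, R, R', h1, h2, h3⟩ := exists_blowup_of_sparse_pair H c (by omega) (by positivity)
        A B i j hij hA hB hbA hbB hAB
      refine ⟨p, R, R', ?_, h2, ?_⟩
      · rw [mul_pow] at h1
        linarith
      · rw [h3]; exact hcε
  · push Not at hlarge
    obtain ⟨i, hi⟩ := hlarge
    refine ⟨fun w => (c w, true, true), (⊤ : SimpleGraph (Fin r)).comap Prod.fst, ⊥, ?_, ?_, ?_⟩
    · have h1 := card_edges_crossGraph_le c i
      have h2 : (m / (2 * r)) ^ 2 ≤ (((colorClass c i).card : ℝ) - m / r) ^ 2 := by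
        rw [← neg_sq (((colorClass c i).card : ℝ) - m / r)]
        have h3 : m / r = m / (2 * r) + m / (2 * r) := by field_simp; norm_num
        have h4 : 0 < m / (2 * r) := by positivity
        apply pow_le_pow_left₀ h4.le
        linarith
      have h3 : β ^ 2 ≤ (1 / (2 * r)) ^ 2 := by
        apply pow_le_pow_left₀ hβ.le
        refine hβ1.trans ?_
        gcongr
        linarith
      have h4 : (m / (2 * r)) ^ 2 = (1 / (2 * r)) ^ 2 * m ^ 2 := by ring
      have h5 : β ^ 2 * m ^ 2 ≤ (1 / (2 * r)) ^ 2 * m ^ 2 := by gcongr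
      have h6 : edges ((⊥ : SimpleGraph (Fin r × Bool × Bool)).comap
          fun w : W => (c w, true, true)) = ∅ := by
        ext e; induction e with | _ u v => simp [mk_mem_edges]
      rw [h6]
      simp only [Finset.card_empty, Nat.cast_zero, zero_div, add_zero]
      refine le_trans (le_of_eq ?_) (h1.trans ?_)
      · rfl
      · linarith
    · have h6 : edges ((⊥ : SimpleGraph (Fin r × Bool × Bool)).comap
          fun w : W => (c w, true, true)) = ∅ := by
        ext e; induction e with | _ u v => simp [mk_mem_edges]
      rw [h6]; simp
    · refine le_trans ?_ hcε
      rw [edges_sdiff]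
      exact_mod_cast Finset.card_le_card (Finset.sdiff_subset_sdiff subset_rfl
        Finset.subset_union_left)

/-- `F`-free graphs without a fine colouring are few. -/
theorem exists_card_not_fine_le {V : Type} [Fintype V] {r : ℕ} (hr : 2 ≤ r) {F : SimpleGraph V}
    (hF : IsCritical r F) {η : ℝ} (hη : 0 < η) :
    ∃ (K' c₀ : ℝ) (m₀ : ℕ), 0 ≤ K' ∧ 0 < c₀ ∧ ∀ (W : Type) [Fintype W], m₀ ≤ Fintype.card W →
      ∀ 𝒮 : Finset (SimpleGraph W), (∀ H ∈ 𝒮, ¬ HasCopy F H ∧ ∀ c : W → Fin r, ¬ IsFine η H c) →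
        (𝒮.card : ℝ) ≤ K' ^ Fintype.card W * (2 : ℝ) ^
          ((1 - 1 / r) * (Fintype.card W : ℝ) ^ 2 / 2 - c₀ * (Fintype.card W : ℝ) ^ 2) := by
  obtain ⟨d, hd, hd1, hcount⟩ := exists_card_blowup_sparse_le
  have hr0 : (0 : ℝ) < r := by positivity
  set E := embedConst d (Fintype.card V) with hEdef
  have hE : 1 ≤ E := one_le_embedConst hd hd1 _
  obtain ⟨β, hβ, hβη, hβr⟩ : ∃ β : ℝ, 0 < β ∧ E * β ≤ η ∧ E * β ≤ 1 / (4 * r) := by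
    refine ⟨min η (1 / (4 * r)) / E, by positivity, ?_, ?_⟩
    · rw [mul_div_cancel₀ _ (by positivity)]; exact min_le_left _ _
    · rw [mul_div_cancel₀ _ (by positivity)]; exact min_le_right _ _
  obtain ⟨ε₁, hε₁, hcount₁⟩ := hcount (β ^ 2 / 4) (by positivity)
  obtain ⟨ε₂, hε₂, hcount₂⟩ := hcount (ε₁ / 4) (by positivity)
  obtain ⟨K, m₁, hcont⟩ := exists_container hF.colorable (ε := min (ε₁ / 2) ε₂)
    (lt_min (by positivity) hε₂)
  obtain ⟨K₁, hK₁, hcount₁⟩ := hcount₁ (Fintype.card (Fin r × Bool × Bool))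
  obtain ⟨K₂, hK₂, hcount₂⟩ := hcount₂ K
  refine ⟨K₁ + K₂, min (β ^ 2 / 4) (ε₁ / 4), m₁ + 8 * r + ⌈1 / β⌉₊ + 1, by positivity,
    by positivity, fun W _ hW 𝒮 h𝒮 => ?_⟩
  have : Nonempty W := Fintype.card_pos_iff.1 (by omega)
  set m : ℝ := ((Fintype.card W : ℕ) : ℝ) with hm
  set T : ℝ := (1 - 1 / r) * m ^ 2 / 2 with hT
  have hm8 : 8 * (r : ℝ) ≤ m := by
    rw [hm]; exact_mod_cast (by omega : 8 * r ≤ Fintype.card W)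
  have hβm : 1 ≤ β * m := by
    have h1 : 1 / β ≤ m := (Nat.le_ceil _).trans
      (by rw [hm]; exact_mod_cast (by omega : ⌈1 / β⌉₊ ≤ Fintype.card W))
    rw [div_le_iff₀ hβ] at h1
    linarith
  set P₁ : SimpleGraph W → Prop := fun H =>
    ∃ (p : W → Fin (Fintype.card (Fin r × Bool × Bool)))
      (R R' : SimpleGraph (Fin (Fintype.card (Fin r × Bool × Bool)))),
      ((edges (R.comap p)).card : ℝ) + (edges (R'.comap p)).card / 2 ≤ T - β ^ 2 / 2 * m ^ 2 ∧
      ((edges H ∩ edges (R'.comap p)).card : ℝ) ≤ d * (edges (R'.comap p)).card ∧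
      ((edges H \ (edges (R.comap p) ∪ edges (R'.comap p))).card : ℝ) ≤ ε₁ * m ^ 2 with hP₁
  set P₂ : SimpleGraph W → Prop := fun H =>
    ∃ (p : W → Fin K) (R R' : SimpleGraph (Fin K)),
      ((edges (R.comap p)).card : ℝ) + (edges (R'.comap p)).card / 2 ≤ T - ε₁ / 2 * m ^ 2 ∧
      ((edges H ∩ edges (R'.comap p)).card : ℝ) ≤ d * (edges (R'.comap p)).card ∧
      ((edges H \ (edges (R.comap p) ∪ edges (R'.comap p))).card : ℝ) ≤ ε₂ * m ^ 2 with hP₂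
  have hor : ∀ H ∈ 𝒮, P₁ H ∨ P₂ H := by
    intro H hH
    obtain ⟨hHF, hHfine⟩ := h𝒮 H hH
    obtain ⟨p, R, hR, hHR⟩ := hcont W (by omega) H hHF
    obtain ⟨c, hc⟩ := exists_inner_add_le (r := r) (R.comap p) (by omega) hR
    by_cases hin : ((edges (R.comap p \ crossGraph c)).card : ℝ) ≤ ε₁ / 2 * m ^ 2
    · left
      have hc₀ : ((edges (H \ crossGraph c)).card : ℝ) ≤ ε₁ * m ^ 2 := by
        have h1 : edges (H \ crossGraph c)
            ⊆ (edges H \ edges (R.comap p)) ∪ edges (R.comap p \ crossGraph c) := by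
          intro e
          simp only [edges_sdiff, Finset.mem_union, Finset.mem_sdiff]
          tauto
        have h2 : ((edges (H \ crossGraph c)).card : ℝ)
            ≤ (edges H \ edges (R.comap p)).card + (edges (R.comap p \ crossGraph c)).card := by
          exact_mod_cast (Finset.card_le_card h1).trans (Finset.card_union_le _ _)
        have h3 : min (ε₁ / 2) ε₂ * m ^ 2 ≤ ε₁ / 2 * m ^ 2 := by gcongr; exact min_le_left _ _
        linarith
      obtain ⟨q, Q, Q', h1, h2, h3⟩ := exists_blowup_of_not_fine hr hF H hHF hd hd1 hβ hβη hβr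
        hm8 hβm hHfine c hc₀
      let e := Fintype.equivFin (Fin r × Bool × Bool)
      refine ⟨fun w => e (q w), Q.comap e.symm, Q'.comap e.symm, ?_⟩
      rw [comap_equiv_comp, comap_equiv_comp]
      exact ⟨h1, h2, h3⟩
    · right
      have h6 : edges ((⊥ : SimpleGraph (Fin K)).comap p) = ∅ := by
        ext e; induction e with | _ u v => simp [mk_mem_edges]
      refine ⟨p, R, ⊥, ?_, ?_, ?_⟩ <;> rw [h6]
      · simp only [Finset.card_empty, Nat.cast_zero, zero_div, add_zero]
        linarith
      · simp
      · rw [Finset.union_empty]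
        refine hHR.trans ?_
        gcongr
        exact min_le_right _ _
  obtain ⟨𝒮₁, 𝒮₂, h𝒮₁, h𝒮₂, h3⟩ := exists_card_le_add_of_forall_or 𝒮 P₁ P₂ hor
  have h1 := hcount₁ W (by omega) (T - β ^ 2 / 2 * m ^ 2) 𝒮₁ h𝒮₁
  have h2 := hcount₂ W (by omega) (T - ε₁ / 2 * m ^ 2) 𝒮₂ h𝒮₂
  have h3 : (𝒮.card : ℝ) ≤ 𝒮₁.card + 𝒮₂.card := by exact_mod_cast h3
  have h4 : ∀ a : ℝ, min (β ^ 2 / 4) (ε₁ / 4) ≤ a → (2 : ℝ) ^ (T - 2 * a * m ^ 2 + a * m ^ 2)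
      ≤ 2 ^ (T - min (β ^ 2 / 4) (ε₁ / 4) * m ^ 2) := by
    intro a ha
    apply Real.rpow_le_rpow_of_exponent_le (by norm_num)
    have : min (β ^ 2 / 4) (ε₁ / 4) * m ^ 2 ≤ a * m ^ 2 := by gcongr
    linarith
  have h5 := h4 (β ^ 2 / 4) (min_le_left _ _)
  have h6 := h4 (ε₁ / 4) (min_le_right _ _)
  rw [show 2 * (β ^ 2 / 4) = β ^ 2 / 2 by ring] at h5
  rw [show 2 * (ε₁ / 4) = ε₁ / 2 by ring] at h6
  calc (𝒮.card : ℝ) ≤ K₁ ^ Fintype.card W * 2 ^ (T - min (β ^ 2 / 4) (ε₁ / 4) * m ^ 2)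
        + K₂ ^ Fintype.card W * 2 ^ (T - min (β ^ 2 / 4) (ε₁ / 4) * m ^ 2) := by
        refine h3.trans (add_le_add (h1.trans ?_) (h2.trans ?_))
        · gcongr
        · gcongr
    _ = (K₁ ^ Fintype.card W + K₂ ^ Fintype.card W)
        * 2 ^ (T - min (β ^ 2 / 4) (ε₁ / 4) * m ^ 2) := by ring
    _ ≤ _ := by
        gcongr
        exact pow_add_pow_le hK₁ hK₂ (by omega)

theorem exists_fun_of_card_le {W : Type} [Nonempty W] (C : Finset W) {k : ℕ} (hk : C.card ≤ k) :
    ∃ p : Fin k → W, ∀ x ∈ C, ∃ i, p i = x := by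
  refine ⟨fun i => if h : (i : ℕ) < C.card then (C.equivFin.symm ⟨i, h⟩ : W)
    else Classical.arbitrary W, fun x hx => ?_⟩
  refine ⟨⟨C.equivFin ⟨x, hx⟩, (C.equivFin ⟨x, hx⟩).2.trans_le hk⟩, ?_⟩
  simp

section FineCount

variable {W : Type} [Fintype W] {r : ℕ}

/-- Graphs with prescribed inner edges such that prescribed pairs of vertices have few common
neighbours in a given class are few. -/
theorem card_graphs_of_common_le (c : W → Fin r) (j : Fin r) {q : ℕ} {a : ℝ}
    (u : Fin q × Bool → W) (hu : Function.Injective u) (huj : ∀ x, c (u x) ≠ j)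
    (J : SimpleGraph W) (P : Finset (Finset W)) (hP : ∀ s : Finset W, (s.card : ℝ) ≤ a → s ∈ P)
    (𝒮 : Finset (SimpleGraph W)) (hJ : ∀ H ∈ 𝒮, H \ crossGraph c = J)
    (h : ∀ H ∈ 𝒮, ∀ t, ((Finset.univ.filter fun z =>
      H.Adj (u (t, false)) z ∧ H.Adj (u (t, true)) z ∧ c z = j).card : ℝ) ≤ a) :
    𝒮.card * 2 ^ (2 * q * (colorClass c j).card)
      ≤ 2 ^ (edges (crossGraph c)).card * (P.card * 3 ^ (colorClass c j).card) ^ q := by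
  let S := colorClass c j
  let A : Finset W := Finset.univ.image u
  have hAS : Disjoint A S := by
    rw [Finset.disjoint_left]
    intro x hx hx'
    obtain ⟨y, -, rfl⟩ := Finset.mem_image.1 hx
    exact huj y (mem_colorClass.1 hx')
  obtain ⟨Q, hQ⟩ : ∃ Q : SimpleGraph W, ∀ x y, Q.Adj x y ↔ (x ∈ A ∧ y ∈ S) ∨ (y ∈ A ∧ x ∈ S) :=
    ⟨{ Adj := fun x y => (x ∈ A ∧ y ∈ S) ∨ (y ∈ A ∧ x ∈ S)
       symm := ⟨fun x y h => h.symm⟩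
       loopless := ⟨fun x h => h.elim (fun h => Finset.disjoint_left.1 hAS h.1 h.2)
        fun h => Finset.disjoint_left.1 hAS h.1 h.2⟩ }, fun _ _ => Iff.rfl⟩
  have hQc : Q ≤ crossGraph c := by
    intro x y hxy
    rw [crossGraph_adj]
    rcases (hQ x y).1 hxy with ⟨h1, h2⟩ | ⟨h1, h2⟩ <;> obtain ⟨z, -, rfl⟩ := Finset.mem_image.1 h1
    · rw [mem_colorClass.1 h2]; exact huj z
    · rw [mem_colorClass.1 h2]; exact (huj z).symm
  have hQcard : (edges Q).card = 2 * q * S.card := by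
    rw [card_edges_biclique Q hAS hQ, Finset.card_image_of_injective _ hu]
    simp [mul_comm]
  let com : SimpleGraph W → Fin q → Finset W := fun H t =>
    Finset.univ.filter fun z => H.Adj (u (t, false)) z ∧ H.Adj (u (t, true)) z ∧ c z = j
  let pat : SimpleGraph W → Fin q → S → Fin 3 := fun H t z =>
    if H.Adj (u (t, false)) z ∧ ¬ H.Adj (u (t, true)) z then 1 else
      if ¬ H.Adj (u (t, false)) z ∧ H.Adj (u (t, true)) z then 2 else 0
  have hcard : 𝒮.card ≤ ((edges (crossGraph c) \ edges Q).powerset ×ˢ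
      Fintype.piFinset fun _ : Fin q => P ×ˢ (Finset.univ : Finset (S → Fin 3))).card := by
    refine Finset.card_le_card_of_injOn
      (fun H => (edges H ∩ (edges (crossGraph c) \ edges Q), fun t => (com H t, pat H t))) ?_ ?_
    · intro H hH
      simp only [Finset.coe_product, Set.mem_prod, Finset.mem_coe, Finset.mem_powerset,
        Fintype.mem_piFinset, Finset.mem_product, Finset.mem_univ, and_true]
      exact ⟨Finset.inter_subset_right, fun t => hP _ (h H hH t)⟩
    · have key : ∀ H ∈ 𝒮, ∀ H' ∈ 𝒮,
          edges H ∩ (edges (crossGraph c) \ edges Q) = edges H' ∩ (edges (crossGraph c) \ edges Q) →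
          (∀ t, com H t = com H' t) → (∀ t, pat H t = pat H' t) → H ≤ H' := by
        intro H hH H' hH' h1 h2 h3
        have h4 : ∀ x ∈ A, ∀ z ∈ S, H.Adj x z → H'.Adj x z := by
          intro x hx z hz hxz
          obtain ⟨⟨t, b⟩, -, rfl⟩ := Finset.mem_image.1 hx
          have h5 := congrFun (h3 t) ⟨z, hz⟩
          have h6 : z ∈ com H t ↔ z ∈ com H' t := by rw [h2 t]
          simp only [com, Finset.mem_filter, Finset.mem_univ, true_and, mem_colorClass.1 hz,
            and_true] at h6
          simp only [pat] at h5
          by_cases e1 : H.Adj (u (t, false)) z <;> by_cases e2 : H.Adj (u (t, true)) z <;>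
            by_cases e3 : H'.Adj (u (t, false)) z <;> by_cases e4 : H'.Adj (u (t, true)) z <;>
            simp [e1, e2, e3, e4] at h5 h6 <;> cases b <;> first | assumption | contradiction
        intro x y hxy
        by_cases hcxy : c x = c y
        · have h5 : (H \ crossGraph c).Adj x y := by
            rw [SimpleGraph.sdiff_adj, crossGraph_adj]; exact ⟨hxy, not_not.2 hcxy⟩
          rw [hJ H hH, ← hJ H' hH'] at h5
          exact h5.1
        · by_cases hq : Q.Adj x y
          · rcases (hQ x y).1 hq with ⟨h5, h6⟩ | ⟨h5, h6⟩
            · exact h4 x h5 y h6 hxy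
            · exact (h4 y h5 x h6 hxy.symm).symm
          · have h5 : s(x, y) ∈ edges H ∩ (edges (crossGraph c) \ edges Q) := by
              simp only [Finset.mem_inter, Finset.mem_sdiff, mk_mem_edges, crossGraph_adj]
              exact ⟨hxy, hcxy, hq⟩
            rw [h1] at h5
            exact mk_mem_edges.1 (Finset.mem_inter.1 h5).1
      intro H hH H' hH' he
      simp only [Prod.mk.injEq, funext_iff] at he
      refine le_antisymm (key H hH H' hH' he.1 (fun t => (he.2 t).1) fun t => funext (he.2 t).2)
        (key H' hH' H hH he.1.symm (fun t => (he.2 t).1.symm) fun t => funext fun z =>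
          ((he.2 t).2 z).symm)
  rw [Finset.card_product, Finset.card_powerset, Fintype.card_piFinset] at hcard
  simp only [Finset.card_product, Finset.card_univ, Fintype.card_fun, Fintype.card_fin,
    Fintype.card_coe, Finset.prod_const] at hcard
  have h1 : (edges (crossGraph c) \ edges Q).card + 2 * q * S.card
      = (edges (crossGraph c)).card := by
    rw [← hQcard, Finset.card_sdiff_add_card_eq_card (edges_mono hQc)]
  calc 𝒮.card * 2 ^ (2 * q * S.card)
      ≤ (2 ^ (edges (crossGraph c) \ edges Q).card * (P.card * 3 ^ S.card) ^ q)
        * 2 ^ (2 * q * S.card) := Nat.mul_le_mul_right _ hcard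
    _ = _ := by rw [← h1, pow_add]; ring

/-- A fine colouring yields vertex-disjoint inner edges of the same type, and a small set of
vertices meeting all inner edges. -/
theorem IsFine.exists_matching {η : ℝ} {H : SimpleGraph W} {c : W → Fin r} (hH : IsFine η H c)
    (hr : 0 < r) :
    ∃ (q : ℕ) (j : Fin r) (u : Fin q × Bool → W) (C : Finset W), 2 * q ≤ Fintype.card W ∧
      Function.Injective u ∧ (∀ x, c (u x) ≠ j) ∧
      (∀ t, ((Finset.univ.filter fun z =>
        H.Adj (u (t, false)) z ∧ H.Adj (u (t, true)) z ∧ c z = j).card : ℝ)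
          ≤ η * Fintype.card W) ∧
      C.card ≤ 2 * r * q ∧ ∀ x y, H.Adj x y → c x = c y → x ∈ C ∨ y ∈ C := by
  have : Nonempty (Fin r) := ⟨⟨0, hr⟩⟩
  let Good : Finset (W × W) → Prop := fun M => (∀ e ∈ M, H.Adj e.1 e.2 ∧ c e.1 = c e.2) ∧
    ∀ e ∈ M, ∀ f ∈ M, e ≠ f → e.1 ≠ f.1 ∧ e.1 ≠ f.2 ∧ e.2 ≠ f.1 ∧ e.2 ≠ f.2
  obtain ⟨M, hM, hmax⟩ := Finset.exists_max_image (Finset.univ.filter Good) Finset.card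
    ⟨∅, by simp [Good]⟩
  have hM : Good M := (Finset.mem_filter.1 hM).2
  have hmax : ∀ M', Good M' → M'.card ≤ M.card := fun M' h => hmax M' (by simp [h])
  choose! τ hτ hτ' using fun (e : W × W) (he : H.Adj e.1 e.2 ∧ c e.1 = c e.2) =>
    hH.common e.1 e.2 he.1 he.2
  obtain ⟨j, hj⟩ : ∃ j, M.card ≤ r * (M.filter fun e => τ e = j).card := by
    by_contra! hcon
    have h1 := Finset.card_eq_sum_card_fiberwise (f := τ) (s := M) (t := Finset.univ)
      (fun _ _ => Finset.mem_coe.2 (Finset.mem_univ _))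
    have h2 : ∑ j : Fin r, r * (M.filter fun e => τ e = j).card < ∑ j : Fin r, M.card :=
      Finset.sum_lt_sum_of_nonempty ⟨⟨0, hr⟩, Finset.mem_univ _⟩ fun j _ => hcon j
    rw [← Finset.mul_sum, ← h1] at h2
    simp at h2
  set Mj := M.filter fun e => τ e = j with hMj
  let f : Fin Mj.card → W × W := fun t => (Mj.equivFin.symm t : W × W)
  have hf : ∀ t, f t ∈ M ∧ τ (f t) = j := fun t =>
    Finset.mem_filter.1 (Mj.equivFin.symm t).2
  have hfi : Function.Injective f := fun s t h => Mj.equivFin.symm.injective (Subtype.ext h)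
  let u : Fin Mj.card × Bool → W := fun x => if x.2 then (f x.1).2 else (f x.1).1
  have hui : Function.Injective u := by
    rintro ⟨s, b⟩ ⟨t, b'⟩ h
    have hne := (hM.1 _ (hf t).1).1.ne
    by_cases hst : s = t
    · subst hst
      cases b <;> cases b' <;> simp [u] at h ⊢
      · exact hne h
      · exact hne h.symm
    · have := hM.2 _ (hf s).1 _ (hf t).1 (fun h => hst (hfi h))
      cases b <;> cases b' <;> simp [u] at h <;> simp [h] at this
  refine ⟨Mj.card, j, u, M.image Prod.fst ∪ M.image Prod.snd, ?_, hui, ?_, ?_, ?_, ?_⟩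
  · have := Fintype.card_le_of_injective u hui
    simp at this
    omega
  · rintro ⟨t, b⟩
    have h1 := hM.1 _ (hf t).1
    have h2 := hτ _ h1
    rw [(hf t).2] at h2
    cases b
    · exact h2.symm
    · simp only [u, if_true]; rw [← h1.2]; exact h2.symm
  · intro t
    have h1 := hM.1 _ (hf t).1
    have h2 := hτ' _ h1
    rw [(hf t).2] at h2
    exact h2
  · calc _ ≤ (M.image Prod.fst).card + (M.image Prod.snd).card := Finset.card_union_le _ _
      _ ≤ M.card + M.card := add_le_add Finset.card_image_le Finset.card_image_le
      _ ≤ 2 * r * Mj.card := by rw [mul_assoc]; omega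
  · intro x y hxy hc
    by_contra! hcon
    obtain ⟨hx, hy⟩ := hcon
    simp only [Finset.mem_union, Finset.mem_image, not_or, not_exists, not_and] at hx hy
    have hxyM : (x, y) ∉ M := fun h => hx.1 _ h rfl
    have h1 := hmax (insert (x, y) M) ⟨?_, ?_⟩
    · rw [Finset.card_insert_of_notMem hxyM] at h1; omega
    · intro e he
      rcases Finset.mem_insert.1 he with rfl | he
      · exact ⟨hxy, hc⟩
      · exact hM.1 e he
    · have h2 : ∀ e ∈ M, x ≠ e.1 ∧ x ≠ e.2 ∧ y ≠ e.1 ∧ y ≠ e.2 := fun e he =>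
        ⟨fun h => hx.1 e he h.symm, fun h => hx.2 e he h.symm, fun h => hy.1 e he h.symm,
          fun h => hy.2 e he h.symm⟩
      intro e he g hg heg
      rcases Finset.mem_insert.1 he with rfl | he <;> rcases Finset.mem_insert.1 hg with rfl | hg
      · exact absurd rfl heg
      · exact h2 g hg
      · have := h2 e he
        exact ⟨this.1.symm, this.2.2.1.symm, this.2.1.symm, this.2.2.2.symm⟩
      · exact hM.2 e he g hg heg

end FineCount

theorem three_quarters_pow_le {r s : ℕ} {m : ℝ} (hs : m / (2 * r) ≤ s) (hr : 0 < r) :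
    (3 / 4 : ℝ) ^ s ≤ 2 ^ (-(m / (5 * r))) := by
  have hr0 : (0 : ℝ) < r := by positivity
  have h1 : (3 / 4 : ℝ) ≤ 2 ^ (-(2 / 5) : ℝ) := by
    have h2 : ((2 : ℝ) ^ (-(2 / 5) : ℝ)) ^ 5 = 1 / 4 := by
      rw [← Real.rpow_natCast, ← Real.rpow_mul (by norm_num)]
      norm_num
    refine le_of_pow_le_pow_left₀ (n := 5) (by norm_num) (by positivity) ?_
    rw [h2]; norm_num
  calc (3 / 4 : ℝ) ^ s ≤ (2 ^ (-(2 / 5) : ℝ)) ^ s := by gcongr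
    _ = 2 ^ (-(2 / 5) * (s : ℝ)) := by rw [Real.rpow_mul (by norm_num), Real.rpow_natCast]
    _ ≤ _ := by
      apply Real.rpow_le_rpow_of_exponent_le (by norm_num)
      have h3 : m / (5 * r) = 2 / 5 * (m / (2 * r)) := by field_simp
      rw [h3]
      linarith

theorem eventually_pow_le_two_rpow (k : ℕ) {a : ℝ} (ha : 0 < a) :
    ∀ᶠ m : ℕ in Filter.atTop, (m : ℝ) ^ k ≤ 2 ^ (a * m) := by
  have h1 := (isLittleO_pow_exp_pos_mul_atTop k (b := a * Real.log 2)
    (by have := Real.log_pos one_lt_two; positivity)).bound one_pos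
  filter_upwards [tendsto_natCast_atTop_atTop.eventually h1] with m hm
  rw [one_mul, Real.norm_of_nonneg (by positivity), Real.norm_of_nonneg (by positivity)] at hm
  rw [Real.rpow_def_of_pos (by norm_num)]
  convert hm using 2
  ring

/-- Almost all graphs with a given fine colouring respect that colouring. -/
theorem exists_card_fine_le {r : ℕ} (hr : 0 < r) :
    ∃ (η : ℝ) (m₀ : ℕ), 0 < η ∧ ∀ (W : Type) [Fintype W], m₀ ≤ Fintype.card W →
      ∀ (c : W → Fin r) (𝒮 : Finset (SimpleGraph W)), (∀ H ∈ 𝒮, IsFine η H c) →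
        (𝒮.card : ℝ) ≤ (Fintype.card W + 1 : ℕ) * (r * 2 ^ (edges (crossGraph c)).card) := by
  have hr0 : (0 : ℝ) < r := by positivity
  set h : ℝ := 1 / (10 * r * (2 * r + 1)) with hh
  obtain ⟨η, hη, hsmall⟩ := exists_card_small_subsets_le (h := h) (by positivity)
  obtain ⟨m₀, hm₀⟩ := Filter.eventually_atTop.1
    (eventually_pow_le_two_rpow (2 + 2 * r) (a := 1 / (10 * r)) (by positivity))
  refine ⟨η, m₀ + 1, hη, fun W _ hW c 𝒮 h𝒮 => ?_⟩
  have : Nonempty W := Fintype.card_pos_iff.1 (by omega)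
  set m := Fintype.card W with hm
  set t := (edges (crossGraph c)).card with ht
  set P : Finset (Finset W) := Finset.univ.powerset.filter fun s => (s.card : ℝ) ≤ η * m with hPdef
  have hP : (P.card : ℝ) ≤ 2 ^ (h * m) := hsmall Finset.univ m (by simp [hm])
  have hPmem : ∀ s : Finset W, (s.card : ℝ) ≤ η * m → s ∈ P := fun s hs => by
    simp [hPdef, hs]
  let D : (q : ℕ) → Fin r × (Fin q × Bool → W) × (Fin (2 * r * q) → W × P) → SimpleGraph W → Prop :=
    fun q i H => (∀ t, ((Finset.univ.filter fun z =>
        H.Adj (i.2.1 (t, false)) z ∧ H.Adj (i.2.1 (t, true)) z ∧ c z = i.1).card : ℝ) ≤ η * m) ∧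
      (∀ k, ((i.2.2 k).2 : Finset W)
        = Finset.univ.filter fun w => H.Adj (i.2.2 k).1 w ∧ c w = c (i.2.2 k).1) ∧
      ∀ x y, H.Adj x y → c x = c y → ∃ k, (i.2.2 k).1 = x ∨ (i.2.2 k).1 = y
  let G : (q : ℕ) → Fin r × (Fin q × Bool → W) × (Fin (2 * r * q) → W × P) → Prop :=
    fun q i => IsFine η (⊥ : SimpleGraph W) c ∧ Function.Injective i.2.1 ∧ ∀ x, c (i.2.1 x) ≠ i.1
  have hex : ∀ H ∈ 𝒮, ∃ q : Fin (m + 1), True ∧ ∃ i, G q i ∧ D q i H := by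
    intro H hH
    obtain ⟨q, j, u, C, hq, hu, huj, hcom, hC, hCov⟩ := (h𝒮 H hH).exists_matching hr
    obtain ⟨p, hp⟩ := exists_fun_of_card_le C hC
    refine ⟨⟨q, by omega⟩, trivial, ⟨j, u, fun k => (p k, ⟨Finset.univ.filter fun w =>
      H.Adj (p k) w ∧ c w = c (p k), hPmem _ ((h𝒮 H hH).inner (p k))⟩)⟩, ⟨?_, hu, huj⟩,
      hcom, fun k => rfl, ?_⟩
    · refine ⟨(h𝒮 H hH).large, fun v => ?_, fun v w h => absurd h (by simp)⟩
      simp only [SimpleGraph.bot_adj, false_and, Finset.filter_false, Finset.card_empty,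
        Nat.cast_zero]
      positivity
    · intro x y hxy hc
      rcases hCov x y hxy hc with h | h
      · obtain ⟨k, hk⟩ := hp x h; exact ⟨k, Or.inl hk⟩
      · obtain ⟨k, hk⟩ := hp y h; exact ⟨k, Or.inr hk⟩
  have hcount : ∀ (q : ℕ) i, G q i → ∀ 𝒯 : Finset (SimpleGraph W), (∀ H ∈ 𝒯, D q i H) →
      (𝒯.card : ℝ) ≤ 2 ^ t * (2 ^ (h * m) * 2 ^ (-(m / (5 * r) : ℝ))) ^ q := by
    rintro q ⟨j, u, p⟩ ⟨hbot, hu, huj⟩ 𝒯 h𝒯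
    rcases 𝒯.eq_empty_or_nonempty with rfl | ⟨H₀, hH₀⟩
    · simp only [Finset.card_empty, Nat.cast_zero]; positivity
    have key : ∀ H ∈ 𝒯, ∀ H' ∈ 𝒯, H \ crossGraph c ≤ H' \ crossGraph c := by
      intro H hH H' hH' x y hxy
      obtain ⟨-, h1, h2⟩ := h𝒯 H hH
      obtain ⟨-, h1', -⟩ := h𝒯 H' hH'
      rw [SimpleGraph.sdiff_adj, crossGraph_adj, not_not] at hxy ⊢
      have h3 : ∀ k w, (H.Adj (p k).1 w ∧ c w = c (p k).1) → H'.Adj (p k).1 w := by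
        intro k w hw
        have h4 := (h1 k).symm.trans (h1' k)
        have h5 := (Finset.ext_iff.1 h4 w).1 (by simpa using hw)
        exact (Finset.mem_filter.1 h5).2.1
      refine ⟨?_, hxy.2⟩
      obtain ⟨k, rfl | rfl⟩ := h2 x y hxy.1 hxy.2
      · exact h3 k y ⟨hxy.1, hxy.2.symm⟩
      · exact (h3 k x ⟨hxy.1.symm, hxy.2⟩).symm
    have h1 := card_graphs_of_common_le c j u hu huj (H₀ \ crossGraph c) P hPmem 𝒯
      (fun H hH => le_antisymm (key H hH H₀ hH₀) (key H₀ hH₀ H hH)) fun H hH => (h𝒯 H hH).1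
    set s := (colorClass c j).card with hs
    have h2 : (𝒯.card : ℝ) * 2 ^ (2 * q * s) ≤ 2 ^ t * (P.card * 3 ^ s) ^ q := by
      exact_mod_cast h1
    have h3 : (2 : ℝ) ^ (2 * q * s) = (4 ^ s) ^ q := by
      rw [show (4 : ℝ) = 2 ^ 2 by norm_num, ← pow_mul, ← pow_mul]
      congr 1; ring
    rw [h3, ← le_div_iff₀ (by positivity)] at h2
    calc (𝒯.card : ℝ) ≤ 2 ^ t * (P.card * 3 ^ s) ^ q / (4 ^ s) ^ q := h2
      _ = 2 ^ t * (P.card * (3 / 4) ^ s) ^ q := by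
        rw [mul_div_assoc, ← div_pow, mul_div_assoc, ← div_pow]
      _ ≤ _ := by
        gcongr
        exact three_quarters_pow_le (hbot.large j) hr
  have hq : ∀ q : ℕ, ∀ 𝒯 : Finset (SimpleGraph W), (∀ H ∈ 𝒯, ∃ i, G q i ∧ D q i H) →
      (𝒯.card : ℝ) ≤ r * 2 ^ t := by
    intro q 𝒯 h𝒯
    have h1 := card_le_of_forall_exists (G q) (D q) _ (by positivity) (hcount q) 𝒯 h𝒯
    refine h1.trans ?_
    simp only [Fintype.card_prod, Fintype.card_fun, Fintype.card_fin, Fintype.card_bool,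
      Fintype.card_coe, ← hm]
    push_cast
    have h2 : ((m : ℝ) ^ (q * 2) * (m * P.card) ^ (2 * r * q))
        * (2 ^ (h * m) * 2 ^ (-(m / (5 * r) : ℝ))) ^ q ≤ 1 := by
      calc ((m : ℝ) ^ (q * 2) * (m * P.card) ^ (2 * r * q))
          * (2 ^ (h * m) * 2 ^ (-(m / (5 * r) : ℝ))) ^ q
          = ((m : ℝ) ^ (2 + 2 * r) * ((P.card : ℝ) ^ (2 * r) * 2 ^ (h * m)
            * 2 ^ (-(m / (5 * r) : ℝ)))) ^ q := by
              rw [mul_comm q 2, pow_mul, pow_mul, ← mul_pow, ← mul_pow]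
              congr 1
              rw [mul_pow, pow_add]; ring
        _ ≤ (2 ^ (1 / (10 * r) * m : ℝ) * ((2 ^ (h * m)) ^ (2 * r) * 2 ^ (h * m)
            * 2 ^ (-(m / (5 * r) : ℝ)))) ^ q := by
              gcongr
              exact hm₀ m (by omega)
        _ = 1 := by
              rw [← Real.rpow_natCast (2 ^ (h * (m : ℝ))), ← Real.rpow_mul (by norm_num),
                ← Real.rpow_add (by norm_num), ← Real.rpow_add (by norm_num),
                ← Real.rpow_add (by norm_num)]
              have : 1 / (10 * r) * (m : ℝ) + (h * m * ((2 * r : ℕ) : ℝ) + h * m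
                  + -(m / (5 * r))) = 0 := by
                push_cast
                rw [hh]
                field_simp
                ring
              rw [this, Real.rpow_zero, one_pow]
    calc _ = (r : ℝ) * 2 ^ t * (((m : ℝ) ^ (q * 2) * (m * P.card) ^ (2 * r * q))
            * (2 ^ (h * m) * 2 ^ (-(m / (5 * r) : ℝ))) ^ q) := by ring
      _ ≤ (r : ℝ) * 2 ^ t * 1 := by gcongr
      _ = _ := mul_one _
  have h1 := card_le_of_forall_exists (fun _ : Fin (m + 1) => True)
    (fun q H => ∃ i, G q i ∧ D q i H) (r * 2 ^ t) (by positivity) (fun q _ => hq q) 𝒮 hex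
  rwa [Fintype.card_fin] at h1

/-- An upper bound for the number of `F`-free graphs. -/
theorem exists_card_free_le {V : Type} [Fintype V] {r : ℕ} (hr : 2 ≤ r) {F : SimpleGraph V}
    (hF : IsCritical r F) :
    ∃ (K c₀ : ℝ) (m₀ : ℕ), 0 ≤ K ∧ 0 < c₀ ∧ ∀ (W : Type) [Fintype W], m₀ ≤ Fintype.card W →
      ∀ 𝒮 : Finset (SimpleGraph W), (∀ H ∈ 𝒮, ¬ HasCopy F H) →
        (𝒮.card : ℝ) ≤ K ^ Fintype.card W * (2 : ℝ) ^
          ((1 - 1 / r) * (Fintype.card W : ℝ) ^ 2 / 2 - c₀ * (Fintype.card W : ℝ) ^ 2)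
          + ∑ c : W → Fin r,
            ((Fintype.card W + 1 : ℕ) * (r * 2 ^ (edges (crossGraph c)).card) : ℝ) := by
  obtain ⟨η, m₁, hη, h1⟩ := exists_card_fine_le (r := r) (by omega)
  obtain ⟨K, c₀, m₂, hK, hc₀, h2⟩ := exists_card_not_fine_le hr hF hη
  refine ⟨K, c₀, m₁ + m₂, hK, hc₀, fun W _ hW 𝒮 h𝒮 => ?_⟩
  obtain ⟨𝒮₁, 𝒮₂, h𝒮₁, h𝒮₂, h3⟩ := exists_card_le_add_of_forall_or 𝒮
    (fun H => ¬ HasCopy F H ∧ ∀ c : W → Fin r, ¬ IsFine η H c)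
    (fun H => ∃ c : W → Fin r, IsFine η H c) (fun H hH => by
      by_cases h : ∃ c : W → Fin r, IsFine η H c
      · exact Or.inr h
      · exact Or.inl ⟨h𝒮 H hH, not_exists.1 h⟩)
  have h4 := h2 W (by omega) 𝒮₁ h𝒮₁
  have h5 : 𝒮₂ ⊆ Finset.univ.biUnion fun c : W → Fin r => 𝒮₂.filter fun H => IsFine η H c := by
    intro H hH
    obtain ⟨c, hc⟩ := h𝒮₂ H hH
    exact Finset.mem_biUnion.2 ⟨c, Finset.mem_univ _, Finset.mem_filter.2 ⟨hH, hc⟩⟩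
  have h6 : (𝒮₂.card : ℝ) ≤ ∑ c : W → Fin r, ((𝒮₂.filter fun H => IsFine η H c).card : ℝ) := by
    exact_mod_cast (Finset.card_le_card h5).trans Finset.card_biUnion_le
  have h7 := h6.trans (Finset.sum_le_sum fun c _ => h1 W (by omega) c
    (𝒮₂.filter fun H => IsFine η H c) fun H hH => (Finset.mem_filter.1 hH).2)
  have h8 : (𝒮.card : ℝ) ≤ 𝒮₁.card + 𝒮₂.card := by exact_mod_cast h3
  linarith

section Pairs

variable {V : Type}

/-- The pairs of distinct elements of a finite set. -/
noncomputable def pairs (S : Finset V) : Finset (Sym2 V) := S.offDiag.image (Function.uncurry Sym2.mk)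

theorem mk_mem_pairs {S : Finset V} {x y : V} : s(x, y) ∈ pairs S ↔ x ∈ S ∧ y ∈ S ∧ x ≠ y := by
  simp only [pairs, Finset.mem_image, Finset.mem_offDiag, Prod.exists]
  constructor
  · rintro ⟨a, b, h, h'⟩
    rcases Sym2.eq_iff.1 h' with ⟨rfl, rfl⟩ | ⟨rfl, rfl⟩
    · exact h
    · exact ⟨h.2.1, h.1, h.2.2.symm⟩
  · exact fun h => ⟨x, y, h, rfl⟩

theorem card_pairs (S : Finset V) : (pairs S).card = S.card.choose 2 := Sym2.card_image_offDiag S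

theorem pairs_inter (S T : Finset V) : pairs S ∩ pairs T = pairs (S ∩ T) := by
  ext e
  induction e with | _ x y =>
  simp only [Finset.mem_inter, mk_mem_pairs]
  tauto

variable [Fintype V]

theorem pairs_subset_edges_top (S : Finset V) : pairs S ⊆ edges ⊤ := by
  intro e
  induction e with | _ x y =>
  rw [mk_mem_pairs, mk_mem_edges]
  exact fun h => h.2.2

/-- The number of graphs inducing on `S` one of few given graphs. -/
theorem card_le_card_image_induce (S : Finset V) (𝒮 : Finset (SimpleGraph V)) :
    𝒮.card ≤ (𝒮.image fun G => G.induce (S : Set V)).card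
      * 2 ^ ((Fintype.card V).choose 2 - S.card.choose 2) := by
  rw [← card_edges_top (W := V), ← card_pairs S,
    ← Finset.card_sdiff_of_subset (pairs_subset_edges_top S), ← Finset.card_powerset,
    ← Finset.card_product]
  refine Finset.card_le_card_of_injOn (fun G => (G.induce (S : Set V), edges G \ pairs S)) ?_ ?_
  · intro G hG
    simp only [Finset.coe_product, Set.mem_prod, Finset.mem_coe, Finset.mem_powerset]
    exact ⟨Finset.mem_image_of_mem _ hG, Finset.sdiff_subset_sdiff (edges_mono le_top) subset_rfl⟩
  · intro G _ G' _ h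
    simp only [Prod.mk.injEq] at h
    ext x y
    by_cases hS : s(x, y) ∈ pairs S
    · obtain ⟨hx, hy, -⟩ := mk_mem_pairs.1 hS
      have h1 : (G.induce (S : Set V)).Adj ⟨x, hx⟩ ⟨y, hy⟩
        ↔ (G'.induce (S : Set V)).Adj ⟨x, hx⟩ ⟨y, hy⟩ := by rw [h.1]
      simpa using h1
    · have h1 := Finset.ext_iff.1 h.2 s(x, y)
      simpa [hS, mk_mem_edges] using h1

end Pairs

/-- The expected number of independent sets of size `s`. -/
noncomputable def indepMean (n s : ℕ) : ℝ := n.choose s / 2 ^ s.choose 2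

theorem indepMean_nonneg (n s : ℕ) : 0 ≤ indepMean n s := by unfold indepMean; positivity

theorem indepMean_pos {n s : ℕ} (h : s ≤ n) : 0 < indepMean n s := by
  have := Nat.choose_pos h
  unfold indepMean; positivity

theorem indepMean_succ (n s : ℕ) :
    indepMean n (s + 1) = indepMean n s * ((n - s : ℕ) / ((s + 1) * 2 ^ s)) := by
  have h1 : (n.choose (s + 1) : ℝ) * (s + 1) = n.choose s * (n - s : ℕ) := by
    exact_mod_cast Nat.choose_succ_right_eq n s
  have h2 : (s + 1).choose 2 = s + s.choose 2 := by
    rw [Nat.choose_succ_succ' s 1, Nat.choose_one_right]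
  unfold indepMean
  rw [h2, pow_add, div_mul_div_comm, div_eq_div_iff (by positivity) (by positivity)]
  linear_combination (2 ^ s * 2 ^ s.choose 2 : ℝ) * h1

theorem indepMean_ratio_anti (n : ℕ) {s t : ℕ} (h : s ≤ t) :
    ((n - t : ℕ) : ℝ) / ((t + 1) * 2 ^ t) ≤ (n - s : ℕ) / ((s + 1) * 2 ^ s) := by
  gcongr
  norm_num

theorem indepMean_le {n k : ℕ} (hk : k < n) (s : ℕ) :
    indepMean n s * ((n - k : ℕ) / ((k + 1) * 2 ^ k) : ℝ) ^ k
      ≤ indepMean n k * ((n - k : ℕ) / ((k + 1) * 2 ^ k) : ℝ) ^ s := by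
  set ρ : ℝ := ((n - k : ℕ) / ((k + 1) * 2 ^ k) : ℝ) with hρ
  have h0 : 0 < ((n - k : ℕ) : ℝ) := by exact_mod_cast (by omega : 0 < n - k)
  have hρ0 : 0 < ρ := by positivity
  rcases le_total k s with h | h
  · induction s, h using Nat.le_induction with
    | base => exact le_rfl
    | succ s hs ih =>
      rw [indepMean_succ, pow_succ ρ s]
      calc _ = indepMean n s * ρ ^ k * ((n - s : ℕ) / ((s + 1) * 2 ^ s)) := by ring
        _ ≤ indepMean n k * ρ ^ s * ρ := by
          have := indepMean_nonneg n k
          gcongr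
          exact indepMean_ratio_anti n hs
        _ = _ := by ring
  · induction h using Nat.decreasingInduction with
    | self => exact le_rfl
    | of_succ s hs ih =>
      have h1 := indepMean_ratio_anti n hs.le
      rw [indepMean_succ, pow_succ ρ s] at ih
      refine le_of_mul_le_mul_right ?_ hρ0
      calc indepMean n s * ρ ^ k * ρ
          ≤ indepMean n s * ρ ^ k * ((n - s : ℕ) / ((s + 1) * 2 ^ s)) := by
            have := indepMean_nonneg n s
            gcongr
        _ = indepMean n s * ((n - s : ℕ) / ((s + 1) * 2 ^ s)) * ρ ^ k := by ring
        _ ≤ _ := ih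
        _ = _ := by ring

theorem sum_card_le_eq_sum_range {n : ℕ} (m : ℕ) (f : ℕ → ℝ) :
    ∑ A ∈ Finset.univ.filter (fun A : Finset (Fin n) => A.card ≤ m), f A.card
      = ∑ s ∈ Finset.range (m + 1), n.choose s * f s := by
  rw [← Finset.sum_fiberwise_of_maps_to (t := Finset.range (m + 1)) (g := Finset.card)
    (fun A hA => Finset.mem_range.2 (Nat.lt_succ_of_le (Finset.mem_filter.1 hA).2))]
  refine Finset.sum_congr rfl fun s hs => ?_
  have h1 : ((Finset.univ.filter fun A : Finset (Fin n) => A.card ≤ m).filter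
      fun A => A.card = s) = Finset.univ.powersetCard s := by
    ext A
    simp only [Finset.mem_filter, Finset.mem_univ, true_and, Finset.mem_powersetCard,
      Finset.subset_univ]
    have := Finset.mem_range.1 hs
    exact ⟨fun h => h.2, fun h => ⟨by omega, h⟩⟩
  rw [h1, Finset.sum_congr rfl (g := fun _ => f s) (fun A hA => by
    rw [(Finset.mem_powersetCard.1 hA).2]), Finset.sum_const, Finset.card_powersetCard]
  simp

/-- The expected number of `r`-tuples of independent sets with `r * k + 1` elements in total. -/
theorem sum_tuples_le {n k r : ℕ} (hk : k < n) :
    ∑ A ∈ Finset.univ.filter (fun A : Fin r → Finset (Fin n) => ∑ i, (A i).card = r * k + 1),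
      ∏ i, (1 / 2 ^ (A i).card.choose 2 : ℝ)
      ≤ ((n - k : ℕ) / ((k + 1) * 2 ^ k) : ℝ) * ((r * k + 2 : ℕ) * indepMean n k) ^ r := by
  set ρ : ℝ := ((n - k : ℕ) / ((k + 1) * 2 ^ k) : ℝ) with hρ
  have h0 : 0 < ((n - k : ℕ) : ℝ) := by exact_mod_cast (by omega : 0 < n - k)
  have hρ0 : 0 < ρ := by positivity
  let f : ℕ → ℝ := fun s => ρ ^ k / (2 ^ s.choose 2 * ρ ^ s)
  have hf : ∀ s, 0 ≤ f s := fun s => by positivity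
  have h1 : ∑ A ∈ Finset.univ.filter (fun A : Fin r → Finset (Fin n) =>
      ∑ i, (A i).card = r * k + 1), ∏ i, (1 / 2 ^ (A i).card.choose 2 : ℝ)
      = ρ * ∑ A ∈ Finset.univ.filter (fun A : Fin r → Finset (Fin n) =>
      ∑ i, (A i).card = r * k + 1), ∏ i, f (A i).card := by
    rw [Finset.mul_sum]
    refine Finset.sum_congr rfl fun A hA => ?_
    have h2 := (Finset.mem_filter.1 hA).2
    simp only [f, Finset.prod_div_distrib, Finset.prod_mul_distrib, Finset.prod_const,
      Finset.card_univ, Fintype.card_fin, Finset.prod_pow_eq_pow_sum, h2, one_pow]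
    rw [← pow_mul, mul_comm k r, pow_succ ρ (r * k)]
    field_simp
  have h2 : ∑ A ∈ Finset.univ.filter (fun A : Fin r → Finset (Fin n) =>
      ∑ i, (A i).card = r * k + 1), ∏ i, f (A i).card
      ≤ ∑ A ∈ Fintype.piFinset fun _ : Fin r =>
        Finset.univ.filter (fun A : Finset (Fin n) => A.card ≤ r * k + 1), ∏ i, f (A i).card := by
    refine Finset.sum_le_sum_of_subset_of_nonneg ?_ fun A _ _ => Finset.prod_nonneg fun i _ => hf _
    intro A hA
    rw [Fintype.mem_piFinset]
    intro i
    rw [Finset.mem_filter, ← (Finset.mem_filter.1 hA).2]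
    exact ⟨Finset.mem_univ _, Finset.single_le_sum (f := fun i => (A i).card)
      (fun _ _ => Nat.zero_le _) (Finset.mem_univ i)⟩
  have h3 : ∑ A ∈ Finset.univ.filter (fun A : Finset (Fin n) => A.card ≤ r * k + 1), f A.card
      ≤ (r * k + 2 : ℕ) * indepMean n k := by
    rw [sum_card_le_eq_sum_range]
    refine (Finset.sum_le_card_nsmul _ _ (indepMean n k) fun s _ => ?_).trans ?_
    · have h4 := indepMean_le hk s
      rw [← hρ] at h4
      have h5 : (n.choose s : ℝ) * f s = indepMean n s * ρ ^ k / ρ ^ s := by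
        simp only [f, indepMean]
        field_simp
      rw [h5, div_le_iff₀ (by positivity)]
      exact h4
    · rw [Finset.card_range, nsmul_eq_mul]
  rw [h1]
  gcongr
  refine h2.trans ?_
  rw [← Finset.prod_univ_sum (fun _ : Fin r =>
    Finset.univ.filter (fun A : Finset (Fin n) => A.card ≤ r * k + 1)) fun _ A => f A.card,
    Finset.prod_const, Finset.card_univ, Fintype.card_fin]
  exact pow_le_pow_left₀ (Finset.sum_nonneg fun _ _ => hf _) h3 r

theorem sum_colorings_le {n r m : ℕ} (g : (Fin r → Finset (Fin n)) → ℝ) (hg : ∀ A, 0 ≤ g A) :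
    ∑ S ∈ (Finset.univ : Finset (Fin n)).powersetCard m, ∑ c : ↥(S : Set (Fin n)) → Fin r,
        g (fun i => (colorClass c i).map (Function.Embedding.subtype _))
      ≤ ∑ A ∈ Finset.univ.filter (fun A : Fin r → Finset (Fin n) => ∑ i, (A i).card = m), g A := by
  rw [Finset.sum_sigma']
  let Φ : ((S : Finset (Fin n)) × (↥(S : Set (Fin n)) → Fin r)) → Fin r → Finset (Fin n) :=
    fun x i => (colorClass x.2 i).map (Function.Embedding.subtype _)
  have hΦ : ∀ x y i, y ∈ Φ x i ↔ ∃ h : y ∈ x.1, x.2 ⟨y, h⟩ = i := by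
    intro x y i
    simp only [Φ, Finset.mem_map, mem_colorClass, Function.Embedding.coe_subtype, Subtype.exists,
      exists_and_right, exists_eq_right, Finset.mem_coe]
  have hinj : Function.Injective Φ := by
    have h1 : ∀ x y, y ∈ x.1 ↔ ∃ i, y ∈ Φ x i := by
      intro x y
      simp only [hΦ]
      exact ⟨fun h => ⟨_, h, rfl⟩, fun ⟨_, h, _⟩ => h⟩
    rintro ⟨S, c⟩ ⟨S', c'⟩ h
    have h2 : S = S' := by
      ext y
      rw [h1 ⟨S, c⟩, h1 ⟨S', c'⟩, h]
    subst h2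
    congr 1
    funext ⟨y, hy⟩
    have h3 := (hΦ ⟨S, c⟩ y (c ⟨y, hy⟩)).2 ⟨hy, rfl⟩
    rw [h, hΦ] at h3
    exact h3.2.symm
  rw [← Finset.sum_image (f := g) (g := Φ) fun x _ y _ h => hinj h]
  refine Finset.sum_le_sum_of_subset_of_nonneg ?_ fun A _ _ => hg A
  intro A hA
  obtain ⟨⟨S, c⟩, hS, rfl⟩ := Finset.mem_image.1 hA
  simp only [Finset.mem_sigma, Finset.mem_powersetCard] at hS
  simp only [Finset.mem_filter, Finset.mem_univ, true_and, Φ, Finset.card_map]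
  rw [sum_card_colorClass]
  simpa using hS.1.2

theorem two_pow_card_edges_crossGraph {W : Type} [Fintype W] {r : ℕ} (c : W → Fin r) :
    (2 : ℝ) ^ (edges (crossGraph c)).card
      = 2 ^ (Fintype.card W).choose 2 * ∏ i, (1 / 2 ^ (colorClass c i).card.choose 2 : ℝ) := by
  have h1 : (edges (crossGraph c)).card + ∑ i, (colorClass c i).card.choose 2
      = (Fintype.card W).choose 2 := by
    have h2 : 2 * ((edges (crossGraph c)).card : ℝ) + ∑ i, ((colorClass c i).card : ℝ) ^ 2
        = (Fintype.card W : ℝ) ^ 2 := by exact_mod_cast two_mul_card_edges_crossGraph c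
    have h3 : ∑ i, ((colorClass c i).card : ℝ) = Fintype.card W := by
      exact_mod_cast sum_card_colorClass c
    have h4 : ((edges (crossGraph c)).card : ℝ) + ∑ i, ((colorClass c i).card.choose 2 : ℝ)
        = (Fintype.card W).choose 2 := by
      simp only [Nat.cast_choose_two]
      rw [← Finset.sum_div]
      have h5 : ∑ i, ((colorClass c i).card : ℝ) * (((colorClass c i).card : ℝ) - 1)
          = ∑ i, ((colorClass c i).card : ℝ) ^ 2 - ∑ i, ((colorClass c i).card : ℝ) := by
        rw [← Finset.sum_sub_distrib]
        exact Finset.sum_congr rfl fun i _ => by ring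
      rw [h5, h3]
      linarith
    exact_mod_cast h4
  rw [← h1, pow_add, Finset.prod_div_distrib, Finset.prod_pow_eq_pow_sum, Finset.prod_const_one]
  field_simp

/-- Few graphs have an `F`-free induced subgraph on `r * k + 1` vertices. -/
theorem exists_card_free_subset_le {V : Type} [Fintype V] {r : ℕ} (hr : 2 ≤ r)
    {F : SimpleGraph V} (hF : IsCritical r F) :
    ∃ (K c₀ : ℝ) (m₀ : ℕ), 0 ≤ K ∧ 0 < c₀ ∧ ∀ n k m : ℕ, k < n → m = r * k + 1 → m₀ ≤ m →
      ∀ 𝒮 : Finset (SimpleGraph (Fin n)), (∀ G ∈ 𝒮, ∃ S : Finset (Fin n), S.card = m ∧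
        ¬ HasCopy F (G.induce (S : Set (Fin n)))) →
      (𝒮.card : ℝ) ≤ 2 ^ n.choose 2 * ((n : ℝ) ^ m * (K ^ m * (2 : ℝ) ^
          ((1 - 1 / r) * (m : ℝ) ^ 2 / 2 - c₀ * (m : ℝ) ^ 2 - m.choose 2))
        + (m + 1 : ℕ) * r * (((n - k : ℕ) / ((k + 1) * 2 ^ k) : ℝ)
          * ((m + 1 : ℕ) * indepMean n k) ^ r)) := by
  obtain ⟨K, c₀, m₀, hK, hc₀, hcount⟩ := exists_card_free_le hr hF
  refine ⟨K, c₀, m₀, hK, hc₀, fun n k m hk hm hm₀ 𝒮 h𝒮 => ?_⟩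
  set B : ℝ := K ^ m * (2 : ℝ) ^ ((1 - 1 / r) * (m : ℝ) ^ 2 / 2 - c₀ * (m : ℝ) ^ 2) with hB
  let w : (Fin r → Finset (Fin n)) → ℝ := fun A => ∏ i, (1 / 2 ^ (A i).card.choose 2 : ℝ)
  have h1 : 𝒮 ⊆ (Finset.univ.powersetCard m).biUnion fun S : Finset (Fin n) =>
      𝒮.filter fun G => ¬ HasCopy F (G.induce (S : Set (Fin n))) := by
    intro G hG
    obtain ⟨S, hS, hGS⟩ := h𝒮 G hG
    exact Finset.mem_biUnion.2 ⟨S, by simp [hS], Finset.mem_filter.2 ⟨hG, hGS⟩⟩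
  have h2 : ∀ S ∈ (Finset.univ : Finset (Fin n)).powersetCard m, ∀ 𝒯 : Finset (SimpleGraph (Fin n)),
      (∀ G ∈ 𝒯, ¬ HasCopy F (G.induce (S : Set (Fin n)))) →
      (𝒯.card : ℝ) ≤ 2 ^ n.choose 2 * (B / 2 ^ m.choose 2 + (m + 1 : ℕ) * r *
        ∑ c : ↥(S : Set (Fin n)) → Fin r,
          w (fun i => (colorClass c i).map (Function.Embedding.subtype _))) := by
    intro S hS 𝒯 h𝒯
    have hSm : Fintype.card (S : Set (Fin n)) = m := by
      simpa using (Finset.mem_powersetCard.1 hS).2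
    have h3 : (𝒯.card : ℝ) ≤ (𝒯.image fun G => G.induce (S : Set (Fin n))).card
        * 2 ^ (n.choose 2 - m.choose 2) := by
      have := card_le_card_image_induce S 𝒯
      rw [Fintype.card_fin, (Finset.mem_powersetCard.1 hS).2] at this
      exact_mod_cast this
    have h4 := hcount (S : Set (Fin n)) (by omega) (𝒯.image fun G => G.induce (S : Set (Fin n)))
      (by
        intro H hH
        obtain ⟨G, hG, rfl⟩ := Finset.mem_image.1 hH
        exact h𝒯 G hG)
    rw [hSm] at h4
    have h5 : (2 : ℝ) ^ (n.choose 2 - m.choose 2) * 2 ^ m.choose 2 = 2 ^ n.choose 2 := by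
      rw [← pow_add]
      congr 1
      apply Nat.sub_add_cancel
      apply Nat.choose_le_choose
      rw [← hSm]
      simpa using Fintype.card_subtype_le (fun x => x ∈ S)
    have h6 : ∑ c : ↥(S : Set (Fin n)) → Fin r,
        ((m + 1 : ℕ) * (r * 2 ^ (edges (crossGraph c)).card) : ℝ)
        = 2 ^ m.choose 2 * ((m + 1 : ℕ) * r * ∑ c : ↥(S : Set (Fin n)) → Fin r,
          w (fun i => (colorClass c i).map (Function.Embedding.subtype _))) := by
      rw [Finset.mul_sum, Finset.mul_sum]
      refine Finset.sum_congr rfl fun c _ => ?_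
      rw [two_pow_card_edges_crossGraph, hSm]
      simp only [w, Finset.card_map]
      ring
    have h4 : ((𝒯.image fun G => G.induce (S : Set (Fin n))).card : ℝ) ≤ B
        + ∑ c : ↥(S : Set (Fin n)) → Fin r,
          ((m + 1 : ℕ) * (r * 2 ^ (edges (crossGraph c)).card) : ℝ) := by convert h4
    rw [h6] at h4
    calc (𝒯.card : ℝ) ≤ _ := h3
      _ ≤ _ := mul_le_mul_of_nonneg_right h4 (by positivity)
      _ = _ := by
        rw [← h5]
        field_simp
  have h3 : (𝒮.card : ℝ) ≤ ∑ S ∈ (Finset.univ : Finset (Fin n)).powersetCard m, ((𝒮.filter fun G =>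
      ¬ HasCopy F (G.induce (S : Set (Fin n)))).card : ℝ) := by
    exact_mod_cast (Finset.card_le_card h1).trans Finset.card_biUnion_le
  refine h3.trans ((Finset.sum_le_sum fun S hS => h2 S hS _ fun G hG =>
    (Finset.mem_filter.1 hG).2).trans ?_)
  rw [← Finset.mul_sum, Finset.sum_add_distrib, ← Finset.mul_sum, Finset.sum_const,
    Finset.card_powersetCard, Finset.card_univ, Fintype.card_fin, nsmul_eq_mul]
  have h4 := (sum_colorings_le (m := m) w fun A => by positivity).trans
    (by simpa only [hm] using sum_tuples_le (r := r) hk)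
  have h5 : (r * k + 2 : ℕ) = m + 1 := by omega
  rw [h5] at h4
  have h6 : (n.choose m : ℝ) ≤ (n : ℝ) ^ m := by exact_mod_cast Nat.choose_le_pow n m
  have h7 : B / 2 ^ m.choose 2 = K ^ m * (2 : ℝ) ^
      ((1 - 1 / r) * (m : ℝ) ^ 2 / 2 - c₀ * (m : ℝ) ^ 2 - m.choose 2) := by
    rw [hB, Real.rpow_sub (by norm_num) _ (m.choose 2 : ℝ), Real.rpow_natCast, mul_div_assoc]
  rw [← h7]
  have h8 : 0 ≤ B := by positivity
  gcongr

theorem add_sq_le_of_sq_le {q a d Y : ℝ} (hq : 0 ≤ q) (hY : 0 ≤ Y)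
    (h : a ^ 2 ≤ q * Y) : (d + a) ^ 2 ≤ (q + 1) * (d * d + Y) := by
  rcases hq.eq_or_lt with rfl | hq
  · have ha : a = 0 := by nlinarith
    rw [ha]
    linarith
  · have h1 : q * (2 * a * d) ≤ q * (Y + q * d ^ 2) := by
      nlinarith [sq_nonneg (a - q * d)]
    linarith [le_of_mul_le_mul_left h1 hq]

/-- A family in which few pairs are related contains many pairwise unrelated members. -/
theorem sq_card_le_of_no_unrelated {α : Type*} (R : α → α → Prop) (hsymm : ∀ x y, R x y → R y x)
    (q : ℕ) : ∀ s : Finset α, (∀ x ∈ s, R x x) →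
      (¬ ∃ t ⊆ s, t.card = q + 1 ∧ ∀ x ∈ t, ∀ y ∈ t, x ≠ y → ¬ R x y) →
      (s.card : ℝ) ^ 2 ≤ q * ∑ x ∈ s, ((s.filter fun y => R x y).card : ℝ) := by
  induction q with
  | zero =>
    intro s _ hs
    rcases s.eq_empty_or_nonempty with rfl | ⟨x, hx⟩
    · simp
    · refine absurd ⟨{x}, by simpa using hx, by simp, ?_⟩ hs
      simp only [Finset.mem_singleton]
      rintro a rfl b rfl h
      exact absurd rfl h
  | succ q ih =>
    intro s hrefl hs
    rcases s.eq_empty_or_nonempty with rfl | hne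
    · simp
    obtain ⟨x, hx, hmin⟩ := Finset.exists_min_image s (fun x => (s.filter fun y => R x y).card) hne
    set N := s.filter fun y => R x y with hN
    set s' := s.filter fun y => ¬ R x y with hs'
    have h1 := ih s' (fun y hy => hrefl y (Finset.mem_filter.1 hy).1) (by
      rintro ⟨t, hts, htc, ht⟩
      have hxt : x ∉ t := fun h => (Finset.mem_filter.1 (hts h)).2 (hrefl x hx)
      refine hs ⟨insert x t, ?_, by rw [Finset.card_insert_of_notMem hxt, htc], ?_⟩
      · intro y hy
        rcases Finset.mem_insert.1 hy with rfl | hy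
        · exact hx
        · exact (Finset.mem_filter.1 (hts hy)).1
      · intro y hy z hz hyz
        rcases Finset.mem_insert.1 hy with hyx | hyt <;>
          rcases Finset.mem_insert.1 hz with hzx | hzt
        · exact absurd (hyx.trans hzx.symm) hyz
        · exact hyx ▸ (Finset.mem_filter.1 (hts hzt)).2
        · exact fun h => (Finset.mem_filter.1 (hts hyt)).2 (hsymm _ _ (hzx ▸ h))
        · exact ht y hyt z hzt hyz)
    have h2 : (N.card : ℝ) + s'.card = s.card := by
      exact_mod_cast Finset.card_filter_add_card_filter_not (s := s) fun y => R x y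
    have h3 : ∑ y ∈ s, ((s.filter fun z => R y z).card : ℝ)
        = ∑ y ∈ N, ((s.filter fun z => R y z).card : ℝ)
          + ∑ y ∈ s', ((s.filter fun z => R y z).card : ℝ) :=
      (Finset.sum_filter_add_sum_filter_not s _ _).symm
    have h4 : (N.card : ℝ) * N.card ≤ ∑ y ∈ N, ((s.filter fun z => R y z).card : ℝ) := by
      rw [← nsmul_eq_mul]
      refine Finset.card_nsmul_le_sum _ _ _ fun y hy => ?_
      exact_mod_cast hmin y (Finset.mem_filter.1 hy).1
    have h5 : ∑ y ∈ s', ((s'.filter fun z => R y z).card : ℝ)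
        ≤ ∑ y ∈ s', ((s.filter fun z => R y z).card : ℝ) := by
      refine Finset.sum_le_sum fun y _ => ?_
      exact_mod_cast Finset.card_le_card (Finset.filter_subset_filter _ (Finset.filter_subset _ _))
    rw [h3, ← h2]
    set a : ℝ := ((s'.card : ℕ) : ℝ)
    set d : ℝ := ((N.card : ℕ) : ℝ)
    set Y := ∑ y ∈ s', ((s'.filter fun z => R y z).card : ℝ)
    have h6 : (d + a) ^ 2 ≤ (q + 1) * (d * d + Y) :=
      add_sq_le_of_sq_le q.cast_nonneg (Finset.sum_nonneg fun y _ => Nat.cast_nonneg _) h1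
    push_cast
    exact h6.trans (mul_le_mul_of_nonneg_left (add_le_add h4 h5) (by positivity))

theorem card_graphs_fin (n : ℕ) : Fintype.card (SimpleGraph (Fin n)) = 2 ^ n.choose 2 := by
  have h := card_graphs (W := Fin n)
  rw [Fintype.card_fin] at h
  convert h

section SecondMoment

variable {n : ℕ}

/-- The indicator of the event that a set is independent. -/
noncomputable def indepInd (G : SimpleGraph (Fin n)) (S : Finset (Fin n)) : ℝ :=
  if Disjoint (edges G) (pairs S) then 1 else 0

theorem indepInd_nonneg (G : SimpleGraph (Fin n)) (S : Finset (Fin n)) : 0 ≤ indepInd G S := by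
  unfold indepInd; positivity

theorem sum_indepInd_mul {ℓ : ℕ} {S T : Finset (Fin n)} (hS : S.card = ℓ) (hT : T.card = ℓ) :
    ∑ G, indepInd G S * indepInd G T
      = 2 ^ n.choose 2 * (2 ^ (S ∩ T).card.choose 2 / (2 ^ ℓ.choose 2) ^ 2) := by
  have hD : pairs S ∪ pairs T ⊆ edges ⊤ :=
    Finset.union_subset (pairs_subset_edges_top S) (pairs_subset_edges_top T)
  have h1 : ∑ G, indepInd G S * indepInd G T
      = ((Finset.univ.filter fun G : SimpleGraph (Fin n) =>
        Disjoint (edges G) (pairs S ∪ pairs T)).card : ℝ) := by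
    rw [Finset.card_filter]
    push_cast
    refine Finset.sum_congr rfl fun G _ => ?_
    simp only [indepInd, Finset.disjoint_union_right]
    by_cases h1 : Disjoint (edges G) (pairs S) <;> by_cases h2 : Disjoint (edges G) (pairs T) <;>
      simp [h1, h2]
  have h2 : (pairs S ∪ pairs T).card + (pairs (S ∩ T)).card
      = (pairs S).card + (pairs T).card := by
    have h := pairs_inter S T
    have h' := Finset.card_union_add_card_inter (pairs S) (pairs T)
    convert h' using 2
    convert congrArg Finset.card h.symm
  rw [card_pairs, card_pairs, card_pairs, hS, hT] at h2
  have h3 := Finset.card_le_card hD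
  rw [card_edges_top, Fintype.card_fin] at h3
  have h4 : ((Finset.univ.filter fun G : SimpleGraph (Fin n) =>
      Disjoint (edges G) (pairs S ∪ pairs T)).card : ℝ)
      = (2 ^ (n.choose 2 - (pairs S ∪ pairs T).card) : ℕ) := by
    have h := card_graphs_disjoint (W := Fin n) (pairs S ∪ pairs T) (by convert hD)
    rw [Fintype.card_fin] at h
    rw [← h]
    congr!
  rw [h1, h4, ← mul_div_assoc, eq_div_iff (by positivity)]
  push_cast
  rw [← pow_mul, ← pow_add, ← pow_add]
  congr 1
  omega

theorem sum_indepInd {ℓ : ℕ} {S : Finset (Fin n)} (hS : S.card = ℓ) :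
    ∑ G, indepInd G S = 2 ^ n.choose 2 * (1 / 2 ^ ℓ.choose 2) := by
  have h1 := sum_indepInd_mul hS hS
  rw [Finset.inter_self, hS] at h1
  rw [Finset.sum_congr rfl (g := fun G => indepInd G S * indepInd G S)
    (fun G _ => by unfold indepInd; split_ifs <;> norm_num), h1]
  field_simp

/-- The contribution to the second moment of pairs of sets with `j` common elements. -/
noncomputable def overlap (n ℓ j : ℕ) : ℝ :=
  ℓ.choose j * (n - j).choose (ℓ - j) / n.choose ℓ * 2 ^ j.choose 2

theorem card_inter_eq_le {ℓ j : ℕ} (S : Finset (Fin n)) (hS : S.card = ℓ) :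
    ((Finset.univ.powersetCard ℓ).filter fun T : Finset (Fin n) => (S ∩ T).card = j).card
      ≤ ℓ.choose j * (n - j).choose (ℓ - j) := by
  calc _ ≤ ((S.powersetCard j).biUnion fun J =>
        ((Finset.univ \ J).powersetCard (ℓ - j)).image fun U => J ∪ U).card := by
        refine Finset.card_le_card fun T hT => ?_
        simp only [Finset.mem_filter, Finset.mem_powersetCard, Finset.subset_univ, true_and] at hT
        refine Finset.mem_biUnion.2 ⟨S ∩ T, Finset.mem_powersetCard.2
          ⟨Finset.inter_subset_left, hT.2⟩, Finset.mem_image.2 ⟨T \ (S ∩ T), ?_, ?_⟩⟩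
        · rw [Finset.mem_powersetCard]
          refine ⟨Finset.sdiff_subset_sdiff (Finset.subset_univ _) subset_rfl, ?_⟩
          rw [Finset.card_sdiff_of_subset Finset.inter_subset_right, hT.1, hT.2]
        · exact Finset.union_sdiff_of_subset Finset.inter_subset_right
    _ ≤ ∑ J ∈ S.powersetCard j, (n - j).choose (ℓ - j) := by
        refine Finset.card_biUnion_le.trans (Finset.sum_le_sum fun J hJ => ?_)
        refine Finset.card_image_le.trans ?_
        rw [Finset.card_powersetCard, Finset.card_sdiff_of_subset (Finset.subset_univ _),
          (Finset.mem_powersetCard.1 hJ).2, Finset.card_univ, Fintype.card_fin]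
    _ = _ := by rw [Finset.sum_const, Finset.card_powersetCard, hS, smul_eq_mul]

theorem sum_not_disjoint_le {ℓ : ℕ} (S : Finset (Fin n)) (hS : S.card = ℓ) (hn : ℓ ≤ n) :
    ∑ T ∈ (Finset.univ.powersetCard ℓ).filter (fun T => ¬ Disjoint S T),
        (2 ^ (S ∩ T).card.choose 2 : ℝ)
      ≤ n.choose ℓ * ∑ j ∈ Finset.Icc 1 ℓ, overlap n ℓ j := by
  have h0 : (0 : ℝ) < n.choose ℓ := by exact_mod_cast Nat.choose_pos hn
  rw [← Finset.sum_fiberwise_of_maps_to (t := Finset.Icc 1 ℓ) (g := fun T => (S ∩ T).card),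
    Finset.mul_sum]
  · refine Finset.sum_le_sum fun j _ => ?_
    have h1 : n.choose ℓ * overlap n ℓ j
        = (ℓ.choose j * (n - j).choose (ℓ - j) : ℕ) * 2 ^ j.choose 2 := by
      unfold overlap; push_cast; field_simp
    rw [h1, Finset.sum_congr rfl (g := fun _ => (2 ^ j.choose 2 : ℝ))
      (fun T hT => by rw [(Finset.mem_filter.1 hT).2]), Finset.sum_const, nsmul_eq_mul]
    gcongr
    refine (Finset.card_le_card ?_).trans (card_inter_eq_le S hS)
    exact Finset.filter_subset_filter _ (Finset.filter_subset _ _)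
  · intro T hT
    rw [Finset.mem_filter, Finset.mem_powersetCard, Finset.disjoint_iff_inter_eq_empty,
      ← Finset.card_eq_zero] at hT
    rw [Finset.mem_Icc]
    exact ⟨by omega, hS ▸ Finset.card_le_card Finset.inter_subset_left⟩

/-- Few graphs have no `r` pairwise disjoint independent sets of size `ℓ`. -/
theorem card_no_disjoint_indep_le {ℓ r : ℕ} (hℓ : 1 ≤ ℓ) (hn : ℓ ≤ n) (hr : 1 ≤ r)
    (𝒮 : Finset (SimpleGraph (Fin n)))
    (h𝒮 : ∀ G ∈ 𝒮, ¬ ∃ t : Finset (Finset (Fin n)), t.card = r ∧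
      (∀ S ∈ t, ∀ T ∈ t, S ≠ T → Disjoint S T) ∧
      ∀ S ∈ t, S.card = ℓ ∧ Disjoint (edges G) (pairs S)) :
    (𝒮.card : ℝ) ≤ 2 ^ n.choose 2 * (4 * (r + 1) * ∑ j ∈ Finset.Icc 1 ℓ, overlap n ℓ j) := by
  set P : Finset (Finset (Fin n)) := Finset.univ.powersetCard ℓ with hP
  set μ := indepMean n ℓ with hμ
  set N : ℝ := 2 ^ n.choose 2 with hN
  have hμ0 : 0 < μ := indepMean_pos hn
  have hN0 : 0 < N := by positivity
  have hPc : ∀ S ∈ P, S.card = ℓ := fun S hS => (Finset.mem_powersetCard.1 hS).2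
  have hPcard : (P.card : ℝ) = n.choose ℓ := by
    rw [hP, Finset.card_powersetCard, Finset.card_univ, Fintype.card_fin]
  have hμ' : μ = n.choose ℓ / 2 ^ ℓ.choose 2 := rfl
  let X : SimpleGraph (Fin n) → ℝ := fun G => ∑ S ∈ P, indepInd G S
  let Y : SimpleGraph (Fin n) → ℝ := fun G =>
    ∑ S ∈ P, ∑ T ∈ P.filter (fun T => ¬ Disjoint S T), indepInd G S * indepInd G T
  have hXsum : ∑ G, X G = N * μ := by
    rw [Finset.sum_comm, Finset.sum_congr rfl (g := fun _ => N * (1 / 2 ^ ℓ.choose 2))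
      (fun S hS => sum_indepInd (hPc S hS)), Finset.sum_const, nsmul_eq_mul, hPcard, hμ']
    ring
  have hYsum : ∑ G, Y G ≤ N * (μ ^ 2 * ∑ j ∈ Finset.Icc 1 ℓ, overlap n ℓ j) := by
    rw [Finset.sum_comm]
    calc ∑ S ∈ P, ∑ G, ∑ T ∈ P.filter (fun T => ¬ Disjoint S T), indepInd G S * indepInd G T
        ≤ ∑ S ∈ P, N / (2 ^ ℓ.choose 2) ^ 2
          * (n.choose ℓ * ∑ j ∈ Finset.Icc 1 ℓ, overlap n ℓ j) := by
          refine Finset.sum_le_sum fun S hS => ?_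
          rw [Finset.sum_comm]
          refine le_trans (le_of_eq ?_) (mul_le_mul_of_nonneg_left
            (sum_not_disjoint_le S (hPc S hS) hn) (by positivity))
          rw [Finset.mul_sum]
          refine Finset.sum_congr rfl fun T hT => ?_
          rw [sum_indepInd_mul (hPc S hS) (hPc T (Finset.mem_filter.1 hT).1)]
          ring
      _ = _ := by
          rw [Finset.sum_const, nsmul_eq_mul, hPcard, hμ']
          ring
  have hX2sum : ∑ G, X G ^ 2 ≤ N * μ ^ 2 + ∑ G, Y G := by
    have h1 : ∀ G, X G ^ 2 = Y G
        + ∑ S ∈ P, ∑ T ∈ P.filter (fun T => Disjoint S T), indepInd G S * indepInd G T := by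
      intro G
      rw [sq, Finset.sum_mul_sum, ← Finset.sum_add_distrib]
      refine Finset.sum_congr rfl fun S _ => ?_
      rw [add_comm]
      exact (Finset.sum_filter_add_sum_filter_not P _ _).symm
    rw [Finset.sum_congr rfl fun G _ => h1 G, Finset.sum_add_distrib, add_comm]
    gcongr
    rw [Finset.sum_comm]
    calc ∑ S ∈ P, ∑ G, ∑ T ∈ P.filter (fun T => Disjoint S T), indepInd G S * indepInd G T
        ≤ ∑ S ∈ P, n.choose ℓ * (N / (2 ^ ℓ.choose 2) ^ 2) := by
          refine Finset.sum_le_sum fun S hS => ?_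
          rw [Finset.sum_comm, Finset.sum_congr rfl (g := fun _ => N / (2 ^ ℓ.choose 2) ^ 2)]
          · rw [Finset.sum_const, nsmul_eq_mul, ← hPcard]
            gcongr
            exact Finset.filter_subset _ _
          · intro T hT
            rw [sum_indepInd_mul (hPc S hS) (hPc T (Finset.mem_filter.1 hT).1),
              Finset.disjoint_iff_inter_eq_empty.1 (Finset.mem_filter.1 hT).2]
            simp [hN, div_eq_mul_inv]
      _ = _ := by
          rw [Finset.sum_const, nsmul_eq_mul, hPcard, hμ']
          ring
  have hbad : ∀ G ∈ 𝒮, μ ^ 2 ≤ 4 * (X G - μ) ^ 2 + 4 * r * Y G := by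
    intro G hG
    have hYG : 0 ≤ Y G := Finset.sum_nonneg fun S _ => Finset.sum_nonneg fun T _ =>
      mul_nonneg (indepInd_nonneg _ _) (indepInd_nonneg _ _)
    set I := P.filter fun S => Disjoint (edges G) (pairs S) with hI
    have h1 : X G = I.card := by
      rw [hI, Finset.card_filter]; push_cast; rfl
    have h2 : Y G = ∑ S ∈ I, ((I.filter fun T => ¬ Disjoint S T).card : ℝ) := by
      rw [hI, Finset.sum_filter]
      refine Finset.sum_congr rfl fun S _ => ?_
      rw [← Finset.mul_sum, Finset.filter_filter, Finset.card_filter, Finset.sum_filter]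
      unfold indepInd
      split_ifs with h
      · rw [one_mul]
        push_cast
        refine Finset.sum_congr rfl fun T _ => ?_
        by_cases e1 : Disjoint S T <;> by_cases e2 : Disjoint (edges G) (pairs T) <;>
          simp [e1, e2]
      · rw [zero_mul]
    obtain ⟨q, rfl⟩ : ∃ q, r = q + 1 := ⟨r - 1, by omega⟩
    have h3 := sq_card_le_of_no_unrelated (fun S T : Finset (Fin n) => ¬ Disjoint S T)
      (fun S T h h' => h h'.symm) q I (by
        intro S hS h
        rw [disjoint_self, Finset.bot_eq_empty, ← Finset.card_eq_zero,
          hPc S (Finset.mem_filter.1 hS).1] at h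
        omega) (by
        rintro ⟨t, hts, htc, ht⟩
        exact h𝒮 G hG ⟨t, htc, fun S hS T hT h => not_not.1 (ht S hS T hT h), fun S hS =>
          ⟨hPc S (Finset.mem_filter.1 (hts hS)).1, (Finset.mem_filter.1 (hts hS)).2⟩⟩)
    have h4 : X G ^ 2 ≤ q * Y G := by
      rw [h1, h2]
      convert h3
    push_cast
    nlinarith [sq_nonneg (2 * X G - μ)]
  have h1 : 𝒮.card * μ ^ 2 ≤ ∑ G, (4 * (X G - μ) ^ 2 + 4 * r * Y G) := by
    rw [← nsmul_eq_mul]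
    refine (Finset.card_nsmul_le_sum 𝒮 _ _ hbad).trans
      (Finset.sum_le_sum_of_subset_of_nonneg (Finset.subset_univ _) fun G _ _ => ?_)
    have : 0 ≤ Y G := Finset.sum_nonneg fun S _ => Finset.sum_nonneg fun T _ =>
      mul_nonneg (indepInd_nonneg _ _) (indepInd_nonneg _ _)
    positivity
  have h2 : ∑ G, (4 * (X G - μ) ^ 2 + 4 * r * Y G)
      = 4 * (∑ G, X G ^ 2 - 2 * μ * ∑ G, X G + N * μ ^ 2) + 4 * r * ∑ G, Y G := by
    have h3 : (N : ℝ) * μ ^ 2 = ∑ _G : SimpleGraph (Fin n), μ ^ 2 := by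
      rw [Finset.sum_const, Finset.card_univ, card_graphs_fin, nsmul_eq_mul]
      push_cast; rfl
    rw [h3]
    simp only [Finset.mul_sum, ← Finset.sum_add_distrib, ← Finset.sum_sub_distrib]
    exact Finset.sum_congr rfl fun G _ => by ring
  set O := ∑ j ∈ Finset.Icc 1 ℓ, overlap n ℓ j with hO
  have h3 : 𝒮.card * μ ^ 2 ≤ N * (4 * (r + 1) * O) * μ ^ 2 := by
    rw [h2, hXsum] at h1
    have h4 : (4 + 4 * (r : ℝ)) * ∑ G, Y G ≤ (4 + 4 * (r : ℝ)) * (N * (μ ^ 2 * O)) := by gcongr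
    nlinarith
  exact le_of_mul_le_mul_right h3 (by positivity)

end SecondMoment

section Asymptotics

open Filter Real

theorem two_pow_choose_two (j : ℕ) :
    (2 : ℝ) ^ j.choose 2 = ((2 : ℝ) ^ (((j : ℝ) - 1) / 2)) ^ j := by
  rw [← rpow_natCast, Nat.cast_choose_two, ← rpow_mul_natCast zero_le_two]
  congr 1
  ring

theorem div_pow_le_choose {n j : ℕ} (h : 2 * j ≤ n) :
    ((n : ℝ) / (2 * j)) ^ j ≤ n.choose j := by
  rcases Nat.eq_zero_or_pos j with rfl | hj
  · simp
  have hj' : (0 : ℝ) < j := by exact_mod_cast hj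
  refine le_trans ?_ (Nat.pow_le_choose (α := ℝ) j n)
  rw [← div_div, div_pow]
  have h1 : (n : ℝ) / 2 ≤ ((n + 1 - j : ℕ) : ℝ) := by
    rw [div_le_iff₀ two_pos]
    exact_mod_cast (by omega : n ≤ (n + 1 - j) * 2)
  have h2 : (j.factorial : ℝ) ≤ (j : ℝ) ^ j := by exact_mod_cast Nat.factorial_le_pow j
  have h3 : (0 : ℝ) < j.factorial := by exact_mod_cast j.factorial_pos
  gcongr

theorem two_rpow_mul_logb {n : ℕ} (hn : 0 < n) (x : ℝ) :
    (2 : ℝ) ^ (x * logb 2 n) = (n : ℝ) ^ x := by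
  rw [mul_comm, rpow_mul zero_le_two, rpow_logb two_pos (by norm_num) (by exact_mod_cast hn)]

theorem eventually_affine_logb_pow_le (a b : ℝ) (p : ℕ) {ε : ℝ} (hε : 0 < ε) :
    ∀ᶠ n : ℕ in atTop, |a * logb 2 n + b| ^ p ≤ (n : ℝ) ^ ε := by
  set s : ℝ := ε / (p + 1) with hs
  have hs0 : 0 < s := by positivity
  have h1 : (fun x : ℝ => a * logb 2 x + b) =o[atTop] fun x : ℝ => x ^ s := by
    refine Asymptotics.IsLittleO.add ?_ ?_
    · have h := (isLittleO_log_rpow_atTop hs0).const_mul_left (a / log 2)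
      refine h.congr_left fun x => ?_
      rw [logb]; ring
    · exact Asymptotics.isLittleO_const_left.2 (Or.inr
        (tendsto_norm_atTop_atTop.comp (tendsto_rpow_atTop hs0)))
  have h2 := h1.bound one_pos
  filter_upwards [tendsto_natCast_atTop_atTop.eventually h2, eventually_ge_atTop 1] with n hn hn1
  have hn1' : (1 : ℝ) ≤ n := by exact_mod_cast hn1
  rw [one_mul, norm_eq_abs, norm_eq_abs, abs_of_nonneg (rpow_nonneg (by positivity) s)] at hn
  calc |a * logb 2 n + b| ^ p ≤ ((n : ℝ) ^ s) ^ p := by gcongr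
    _ = (n : ℝ) ^ (s * p) := by rw [rpow_mul_natCast (by positivity)]
    _ ≤ (n : ℝ) ^ ε := by
        refine rpow_le_rpow_of_exponent_le hn1' ?_
        rw [hs, div_mul_eq_mul_div, div_le_iff₀ (by positivity)]
        nlinarith

/-- There is an `ℓ` close to `2 log₂ n` where the expected number of independent sets of size `ℓ`
drops from above `n ^ δ` to below `n ^ δ`. -/
theorem eventually_exists_threshold {δ ε : ℝ} (hδ : 0 < δ) (hδ1 : δ ≤ 1) (hε : 0 < ε)
    (hε1 : ε ≤ 1) :
    ∀ᶠ n : ℕ in atTop, ∃ ℓ : ℕ, 1 ≤ ℓ ∧ (2 - ε) * logb 2 n ≤ ℓ ∧ (ℓ : ℝ) ≤ 2 * logb 2 n + 1 ∧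
      (n : ℝ) ^ δ ≤ indepMean n ℓ ∧ indepMean n (ℓ + 1) < (n : ℝ) ^ δ := by
  filter_upwards [eventually_affine_logb_pow_le 8 4 1 (half_pos hε), eventually_ge_atTop 2]
    with n hn hn2
  have hn2' : (2 : ℝ) ≤ n := by exact_mod_cast hn2
  have hn0 : (0 : ℝ) < n := by linarith
  set L := logb 2 (n : ℝ) with hL
  have hL1 : 1 ≤ L := by
    rw [hL, le_logb_iff_rpow_le one_lt_two hn0, rpow_one]; exact hn2'
  have h2L : (2 : ℝ) ^ L = n := by
    have := two_rpow_mul_logb (by omega : 0 < n) 1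
    rwa [one_mul, rpow_one] at this
  rw [pow_one, abs_of_nonneg (by positivity)] at hn
  have hsmall : 8 * L + 4 ≤ (n : ℝ) := by
    refine hn.trans ?_
    calc (n : ℝ) ^ (ε / 2) ≤ (n : ℝ) ^ (1 : ℝ) :=
          rpow_le_rpow_of_exponent_le (by linarith) (by linarith)
      _ = n := rpow_one _
  set ℓ₀ := ⌈(2 - ε) * L⌉₊ with hℓ₀
  have hℓ₀1 : (2 - ε) * L ≤ ℓ₀ := Nat.le_ceil _
  have hℓ₀2 : (ℓ₀ : ℝ) < (2 - ε) * L + 1 := Nat.ceil_lt_add_one (by nlinarith)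
  have hℓ₀L : L ≤ ℓ₀ := by nlinarith
  have hℓ₀0 : (0 : ℝ) < ℓ₀ := by linarith
  have hℓ₀n : 2 * ℓ₀ ≤ n := by
    have : (2 * ℓ₀ : ℝ) ≤ n := by nlinarith
    exact_mod_cast this
  let p : ℕ → Prop := fun ℓ => (n : ℝ) ^ δ ≤ indepMean n ℓ
  have hp : p ℓ₀ := by
    have h1 : (2 : ℝ) ≤ (n : ℝ) / (2 * ℓ₀) / (2 : ℝ) ^ (((ℓ₀ : ℝ) - 1) / 2) := by
      rw [div_div, le_div_iff₀ (by positivity)]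
      have h2 : (2 : ℝ) ^ (((ℓ₀ : ℝ) - 1) / 2) ≤ (n : ℝ) ^ (1 - ε / 2) := by
        rw [← two_rpow_mul_logb (by omega : 0 < n)]
        refine rpow_le_rpow_of_exponent_le one_le_two ?_
        nlinarith
      have h3 : 2 * (2 * (ℓ₀ : ℝ)) ≤ (n : ℝ) ^ (ε / 2) := by nlinarith
      calc 2 * (2 * (ℓ₀ : ℝ) * (2 : ℝ) ^ (((ℓ₀ : ℝ) - 1) / 2))
          = 2 * (2 * (ℓ₀ : ℝ)) * (2 : ℝ) ^ (((ℓ₀ : ℝ) - 1) / 2) := by ring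
        _ ≤ (n : ℝ) ^ (ε / 2) * (n : ℝ) ^ (1 - ε / 2) := by gcongr
        _ = n := by
            rw [← rpow_add hn0]
            norm_num
    calc (n : ℝ) ^ δ ≤ (n : ℝ) ^ (1 : ℝ) := rpow_le_rpow_of_exponent_le (by linarith) hδ1
      _ = (2 : ℝ) ^ L := by rw [rpow_one, h2L]
      _ ≤ (2 : ℝ) ^ (ℓ₀ : ℝ) := rpow_le_rpow_of_exponent_le one_le_two hℓ₀L
      _ = (2 : ℝ) ^ ℓ₀ := rpow_natCast _ _
      _ ≤ ((n : ℝ) / (2 * ℓ₀) / (2 : ℝ) ^ (((ℓ₀ : ℝ) - 1) / 2)) ^ ℓ₀ := by gcongr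
      _ = ((n : ℝ) / (2 * ℓ₀)) ^ ℓ₀ / 2 ^ ℓ₀.choose 2 := by rw [div_pow, two_pow_choose_two]
      _ ≤ indepMean n ℓ₀ := by
          unfold indepMean
          have := div_pow_le_choose hℓ₀n
          gcongr
  set ℓ := Nat.findGreatest p n with hℓ
  have hℓ₀ℓ : ℓ₀ ≤ ℓ := Nat.le_findGreatest (by omega) hp
  have hpℓ : p ℓ := Nat.findGreatest_spec (by omega : ℓ₀ ≤ n) hp
  have hℓ₀ℓ' : (ℓ₀ : ℝ) ≤ ℓ := by exact_mod_cast hℓ₀ℓ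
  have hup : (ℓ : ℝ) ≤ 2 * L + 1 := by
    by_contra! hlt
    have h1 : indepMean n ℓ ≤ 1 := by
      unfold indepMean
      rw [div_le_one (by positivity), two_pow_choose_two]
      calc (n.choose ℓ : ℝ) ≤ (n : ℝ) ^ ℓ := by exact_mod_cast Nat.choose_le_pow _ _
        _ ≤ _ := by
          gcongr
          rw [← h2L]
          exact rpow_le_rpow_of_exponent_le one_le_two (by linarith)
    have h2 : (1 : ℝ) < (n : ℝ) ^ δ := one_lt_rpow (by linarith) hδ
    exact absurd (hpℓ.trans h1) (not_le.2 h2)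
  have hℓn : ℓ + 1 ≤ n := by
    have : (ℓ : ℝ) + 1 ≤ n := by linarith
    exact_mod_cast this
  refine ⟨ℓ, ?_, hℓ₀1.trans hℓ₀ℓ', hup, hpℓ, ?_⟩
  · have : (1 : ℝ) ≤ ℓ := by linarith
    exact_mod_cast this
  · exact not_le.1 (Nat.findGreatest_is_greatest (Nat.lt_succ_self _) hℓn)

end Asymptotics

section Overlap

open Filter Real

theorem overlap_le_of_le {n ℓ j : ℕ} (hj : 1 ≤ j) (hjℓ : j ≤ ℓ) (hn : 2 * ℓ ≤ n) {B : ℝ}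
    (hB1 : B ≤ 1) (hB : 2 * (ℓ : ℝ) ^ 3 * (2 : ℝ) ^ (((j : ℝ) - 1) / 2) ≤ B * n) :
    overlap n ℓ j ≤ B := by
  have hj0 : (0 : ℝ) < j := by exact_mod_cast hj
  have hℓ0 : (0 : ℝ) < ℓ := by exact_mod_cast (by omega : 0 < ℓ)
  have hn0 : (0 : ℝ) < n := by exact_mod_cast (by omega : 0 < n)
  have h1 : (n.choose ℓ : ℝ) * ℓ.choose j = n.choose j * (n - j).choose (ℓ - j) := by
    exact_mod_cast Nat.choose_mul hjℓ
  have h2 : (0 : ℝ) < n.choose ℓ := by exact_mod_cast Nat.choose_pos (by omega)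
  have h3 : (0 : ℝ) < n.choose j := by exact_mod_cast Nat.choose_pos (by omega)
  have h4 : ((n : ℝ) / (2 * ℓ)) ^ j ≤ n.choose j := by
    refine le_trans ?_ (div_pow_le_choose (by omega : 2 * j ≤ n))
    gcongr
  have h5 : (ℓ.choose j : ℝ) ≤ (ℓ : ℝ) ^ j := by exact_mod_cast Nat.choose_le_pow _ _
  have h6 : overlap n ℓ j
      = ℓ.choose j * (ℓ.choose j / n.choose j) * ((2 : ℝ) ^ (((j : ℝ) - 1) / 2)) ^ j := by
    unfold overlap
    rw [two_pow_choose_two, mul_div_assoc]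
    congr 2
    rw [div_eq_div_iff h2.ne' h3.ne']
    linarith
  have hB0 : 0 ≤ B := by
    by_contra! h
    have : B * n < 0 := mul_neg_of_neg_of_pos h hn0
    have : 0 < 2 * (ℓ : ℝ) ^ 3 * (2 : ℝ) ^ (((j : ℝ) - 1) / 2) := by positivity
    linarith
  calc overlap n ℓ j
      ≤ (ℓ : ℝ) ^ j * ((ℓ : ℝ) ^ j / ((n : ℝ) / (2 * ℓ)) ^ j)
          * ((2 : ℝ) ^ (((j : ℝ) - 1) / 2)) ^ j := by
        rw [h6]
        gcongr
    _ = (2 * (ℓ : ℝ) ^ 3 * (2 : ℝ) ^ (((j : ℝ) - 1) / 2) / n) ^ j := by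
        rw [← div_pow, ← mul_pow, ← mul_pow]
        congr 1
        field_simp
    _ ≤ B ^ j := by
        gcongr
        rwa [div_le_iff₀ hn0]
    _ ≤ B := pow_le_of_le_one hB0 hB1 (by omega)

theorem overlap_le_of_ge {n ℓ j : ℕ} (hjℓ : j ≤ ℓ) (hn : ℓ ≤ n)
    (h : (ℓ : ℝ) * n ≤ (2 : ℝ) ^ (((ℓ : ℝ) + j - 1) / 2)) :
    overlap n ℓ j ≤ (indepMean n ℓ)⁻¹ := by
  have h2 : (0 : ℝ) < n.choose ℓ := by exact_mod_cast Nat.choose_pos (by omega)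
  have h3 : (2 : ℝ) ^ ℓ.choose 2
      = (2 : ℝ) ^ j.choose 2 * ((2 : ℝ) ^ (((ℓ : ℝ) + j - 1) / 2)) ^ (ℓ - j) := by
    rw [← rpow_natCast, ← rpow_natCast _ (j.choose 2), Nat.cast_choose_two, Nat.cast_choose_two,
      ← rpow_mul_natCast zero_le_two, ← rpow_add two_pos, Nat.cast_sub hjℓ]
    congr 1
    ring
  have h4 : (ℓ.choose j : ℝ) ≤ (ℓ : ℝ) ^ (ℓ - j) := by
    rw [← Nat.choose_symm hjℓ]
    exact_mod_cast Nat.choose_le_pow _ _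
  have h5 : ((n - j).choose (ℓ - j) : ℝ) ≤ (n : ℝ) ^ (ℓ - j) := by
    exact_mod_cast (Nat.choose_le_pow _ _).trans (Nat.pow_le_pow_left (Nat.sub_le _ _) _)
  unfold overlap indepMean
  rw [inv_div, div_mul_eq_mul_div, h3, mul_comm]
  refine div_le_div_of_nonneg_right ?_ h2.le
  refine mul_le_mul_of_nonneg_left ?_ (by positivity)
  calc (ℓ.choose j : ℝ) * (n - j).choose (ℓ - j) ≤ (ℓ : ℝ) ^ (ℓ - j) * (n : ℝ) ^ (ℓ - j) := by
        gcongr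
    _ = ((ℓ : ℝ) * n) ^ (ℓ - j) := (mul_pow _ _ _).symm
    _ ≤ _ := by gcongr

theorem eventually_sum_overlap_le (c : ℝ) {δ ε : ℝ} (hδ : 0 < δ) (hδ1 : δ ≤ 1 / 8)
    (hε1 : ε ≤ 1 / 4) :
    ∀ᶠ n : ℕ in atTop, ∀ ℓ : ℕ, 1 ≤ ℓ → (2 - ε) * logb 2 n ≤ ℓ → (ℓ : ℝ) ≤ 2 * logb 2 n + 1 →
      (n : ℝ) ^ δ ≤ indepMean n ℓ →
      c * ∑ j ∈ Finset.Icc 1 ℓ, overlap n ℓ j ≤ (n : ℝ) ^ (-(δ / 2)) := by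
  filter_upwards [eventually_affine_logb_pow_le 4 2 3 (by norm_num : (0 : ℝ) < 1 / 8),
    eventually_affine_logb_pow_le (4 * |c|) (2 * |c|) 1 (half_pos hδ),
    eventually_ge_atTop 2] with n hn1 hn2 hn ℓ hℓ hℓ1 hℓ2 hμ
  have hn2' : (2 : ℝ) ≤ n := by exact_mod_cast hn
  have hn1' : (1 : ℝ) ≤ n := by linarith
  have hn0 : (0 : ℝ) < n := by linarith
  set L := logb 2 (n : ℝ) with hL
  have hL1 : 1 ≤ L := by
    rw [hL, le_logb_iff_rpow_le one_lt_two hn0, rpow_one]; exact hn2'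
  have hpow : ∀ x : ℝ, (2 : ℝ) ^ (x * L) = (n : ℝ) ^ x := two_rpow_mul_logb (by omega)
  have hℓ0 : (1 : ℝ) ≤ ℓ := by exact_mod_cast hℓ
  rw [abs_of_nonneg (by positivity)] at hn1
  rw [pow_one, abs_of_nonneg (by positivity)] at hn2
  have h1 : 8 * (ℓ : ℝ) ^ 3 ≤ (n : ℝ) ^ (1 / 8 : ℝ) := by
    refine le_trans ?_ hn1
    calc 8 * (ℓ : ℝ) ^ 3 = (2 * ℓ) ^ 3 := by ring
      _ ≤ _ := by gcongr; linarith
  have h2 : 8 * (ℓ : ℝ) ≤ (n : ℝ) ^ (1 / 8 : ℝ) := by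
    refine le_trans ?_ h1
    have := le_self_pow₀ hℓ0 (by norm_num : (3 : ℕ) ≠ 0)
    linarith
  have hℓn : 2 * ℓ ≤ n := by
    have : (2 * ℓ : ℝ) ≤ n := by
      have h3 : (n : ℝ) ^ (1 / 8 : ℝ) ≤ (n : ℝ) ^ (1 : ℝ) :=
        rpow_le_rpow_of_exponent_le hn1' (by norm_num)
      rw [rpow_one] at h3
      linarith
    exact_mod_cast this
  have hB : (n : ℝ) ^ (-(1 / 8) : ℝ) ≤ (n : ℝ) ^ (-δ) :=
    rpow_le_rpow_of_exponent_le hn1' (by linarith)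
  have hterm : ∀ j ∈ Finset.Icc 1 ℓ, overlap n ℓ j ≤ (n : ℝ) ^ (-δ) := by
    intro j hj
    rw [Finset.mem_Icc] at hj
    rcases le_total (j : ℝ) (3 / 2 * L) with hjL | hjL
    · refine (overlap_le_of_le hj.1 hj.2 hℓn (rpow_le_one_of_one_le_of_nonpos hn1'
        (by norm_num)) ?_).trans hB
      have h3 : (2 : ℝ) ^ (((j : ℝ) - 1) / 2) ≤ (n : ℝ) ^ (3 / 4 : ℝ) := by
        rw [← hpow]
        exact rpow_le_rpow_of_exponent_le one_le_two (by linarith)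
      calc 2 * (ℓ : ℝ) ^ 3 * (2 : ℝ) ^ (((j : ℝ) - 1) / 2)
          ≤ (n : ℝ) ^ (1 / 8 : ℝ) * (n : ℝ) ^ (3 / 4 : ℝ) := by
            gcongr
            have : 0 ≤ (ℓ : ℝ) ^ 3 := by positivity
            linarith
        _ = (n : ℝ) ^ (-(1 / 8) : ℝ) * (n : ℝ) ^ (1 : ℝ) := by
            rw [← rpow_add hn0, ← rpow_add hn0]; norm_num
        _ = _ := by rw [rpow_one]
    · refine (overlap_le_of_ge hj.2 (by omega) ?_).trans ?_
      · calc (ℓ : ℝ) * n ≤ (n : ℝ) ^ (1 / 8 : ℝ) * (n : ℝ) ^ (1 : ℝ) := by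
              rw [rpow_one]; gcongr; linarith
          _ = (2 : ℝ) ^ ((9 / 8 : ℝ) * L) := by
              rw [hpow, ← rpow_add hn0]; norm_num
          _ ≤ _ := rpow_le_rpow_of_exponent_le one_le_two (by nlinarith)
      · rw [rpow_neg hn0.le]
        gcongr
  have h0 : ∀ j, 0 ≤ overlap n ℓ j := fun j => by unfold overlap; positivity
  calc c * ∑ j ∈ Finset.Icc 1 ℓ, overlap n ℓ j
      ≤ |c| * ∑ j ∈ Finset.Icc 1 ℓ, overlap n ℓ j :=
        mul_le_mul_of_nonneg_right (le_abs_self c) (Finset.sum_nonneg fun j _ => h0 j)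
    _ ≤ |c| * (ℓ * (n : ℝ) ^ (-δ)) := by
        refine mul_le_mul_of_nonneg_left ?_ (abs_nonneg c)
        refine (Finset.sum_le_card_nsmul _ _ _ hterm).trans ?_
        simp
    _ = |c| * ℓ * (n : ℝ) ^ (-δ) := by ring
    _ ≤ (n : ℝ) ^ (δ / 2) * (n : ℝ) ^ (-δ) := by
        gcongr
        have := abs_nonneg c
        nlinarith
    _ = (n : ℝ) ^ (-(δ / 2)) := by
        rw [← rpow_add hn0]; ring_nf

end Overlap

section UpperBounds

open Filter Real

theorem eventually_fine_le {r : ℕ} {δ ε : ℝ} (hδ : r * δ ≤ 1 / 4) (hε1 : ε ≤ 1 / 4) :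
    ∀ᶠ n : ℕ in atTop, ∀ k m : ℕ, m = r * k + 1 → (2 - ε) * logb 2 n ≤ k →
      (k : ℝ) ≤ 2 * logb 2 n + 2 → indepMean n k ≤ (n : ℝ) ^ δ →
      (m + 1 : ℕ) * r * (((n - k : ℕ) / ((k + 1) * 2 ^ k) : ℝ)
        * ((m + 1 : ℕ) * indepMean n k) ^ r) ≤ (n : ℝ) ^ (-(1 / 4) : ℝ) := by
  filter_upwards [eventually_affine_logb_pow_le (2 * r) (2 * r + 2) (r + 2)
      (by norm_num : (0 : ℝ) < 1 / 4), eventually_ge_atTop 2] with n hn1 hn k m hm hk1 hk2 hμ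
  have hn2' : (2 : ℝ) ≤ n := by exact_mod_cast hn
  have hn1' : (1 : ℝ) ≤ n := by linarith
  have hn0 : (0 : ℝ) < n := by linarith
  set L := logb 2 (n : ℝ) with hL
  have hL1 : 1 ≤ L := by
    rw [hL, le_logb_iff_rpow_le one_lt_two hn0, rpow_one]; exact hn2'
  have hpow : ∀ x : ℝ, (2 : ℝ) ^ (x * L) = (n : ℝ) ^ x := two_rpow_mul_logb (by omega)
  rw [abs_of_nonneg (by positivity)] at hn1
  have hk0 : 1 ≤ k := by
    have : (0 : ℝ) < k := by nlinarith
    exact_mod_cast this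
  have hM : ((m + 1 : ℕ) : ℝ) ≤ 2 * r * L + (2 * r + 2) := by
    rw [hm]
    push_cast
    have : (r : ℝ) * k ≤ r * (2 * L + 2) := by gcongr
    linarith
  have hr : (r : ℝ) ≤ (m + 1 : ℕ) := by
    rw [hm]
    exact_mod_cast (by nlinarith : r ≤ r * k + 1 + 1)
  set M : ℝ := ((m + 1 : ℕ) : ℝ) with hMdef
  have hM0 : 0 ≤ M := Nat.cast_nonneg _
  have hμ0 := indepMean_nonneg n k
  have h1 : ((n - k : ℕ) : ℝ) / ((k + 1) * 2 ^ k) ≤ (n : ℝ) ^ (-(3 / 4) : ℝ) := by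
    rw [div_le_iff₀ (by positivity)]
    calc ((n - k : ℕ) : ℝ) ≤ (n : ℝ) ^ (1 : ℝ) := by
          rw [rpow_one]; exact_mod_cast Nat.sub_le _ _
      _ = (n : ℝ) ^ (-(3 / 4) : ℝ) * (1 * (2 : ℝ) ^ ((7 / 4 : ℝ) * L)) := by
          rw [hpow, one_mul, ← rpow_add hn0]; norm_num
      _ ≤ (n : ℝ) ^ (-(3 / 4) : ℝ) * ((k + 1) * 2 ^ k) := by
          rw [← rpow_natCast 2 k]
          gcongr
          · linarith [(Nat.cast_nonneg k : (0 : ℝ) ≤ k)]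
          · exact one_le_two
          · nlinarith
  have h2 : indepMean n k ^ r ≤ (n : ℝ) ^ (1 / 4 : ℝ) := by
    calc indepMean n k ^ r ≤ ((n : ℝ) ^ δ) ^ r := by gcongr
      _ = (n : ℝ) ^ (δ * r) := (rpow_mul_natCast hn0.le _ _).symm
      _ ≤ _ := rpow_le_rpow_of_exponent_le hn1' (by linarith)
  calc M * r * (((n - k : ℕ) / ((k + 1) * 2 ^ k) : ℝ) * (M * indepMean n k) ^ r)
      ≤ M * M * ((n : ℝ) ^ (-(3 / 4) : ℝ) * (M ^ r * (n : ℝ) ^ (1 / 4 : ℝ))) := by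
        rw [mul_pow]
        gcongr
    _ = M ^ (r + 2) * ((n : ℝ) ^ (-(3 / 4) : ℝ) * (n : ℝ) ^ (1 / 4 : ℝ)) := by ring
    _ ≤ (n : ℝ) ^ (1 / 4 : ℝ) * ((n : ℝ) ^ (-(3 / 4) : ℝ) * (n : ℝ) ^ (1 / 4 : ℝ)) := by
        gcongr
        refine le_trans ?_ hn1
        gcongr
    _ = _ := by
        rw [← rpow_add hn0, ← rpow_add hn0]; norm_num

theorem eventually_coarse_le {r : ℕ} (hr : 1 ≤ r) {K c₀ ε : ℝ} (hK : 0 ≤ K) (hc₀ : 0 < c₀)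
    (hε : ε ≤ c₀) (hε1 : ε ≤ 1 / 4) :
    ∀ᶠ n : ℕ in atTop, ∀ k m : ℕ, m = r * k + 1 → (2 - ε) * logb 2 n ≤ k →
      (n : ℝ) ^ m * (K ^ m * (2 : ℝ) ^ ((1 - 1 / r) * (m : ℝ) ^ 2 / 2 - c₀ * (m : ℝ) ^ 2
        - m.choose 2)) ≤ (n : ℝ) ^ (-1 : ℝ) := by
  have hlog : Tendsto (fun n : ℕ => logb 2 (n : ℝ)) atTop atTop :=
    (tendsto_logb_atTop one_lt_two).comp tendsto_natCast_atTop_atTop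
  filter_upwards [hlog.eventually_ge_atTop (2 * (K + 3 / 2) / c₀), eventually_ge_atTop 2]
    with n hn1 hn k m hm hk
  have hn2' : (2 : ℝ) ≤ n := by exact_mod_cast hn
  have hn0 : (0 : ℝ) < n := by linarith
  set L := logb 2 (n : ℝ) with hL
  have hL1 : 1 ≤ L := by
    rw [hL, le_logb_iff_rpow_le one_lt_two hn0, rpow_one]; exact hn2'
  have hpow : ∀ x : ℝ, (2 : ℝ) ^ (x * L) = (n : ℝ) ^ x := two_rpow_mul_logb (by omega)
  have hr0 : (1 : ℝ) ≤ r := by exact_mod_cast hr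
  have hmk : (r : ℝ) * k ≤ m := by rw [hm]; push_cast; linarith
  have hm1 : (2 - ε) * L ≤ m / r := by
    rw [le_div_iff₀ (by linarith)]
    nlinarith
  have hm2 : (2 - ε) * L ≤ m := hm1.trans (div_le_self (Nat.cast_nonneg m) hr0)
  have hmL : L ≤ m := by nlinarith
  have hKn : K ^ m ≤ (2 : ℝ) ^ (K * m) := by
    rw [rpow_mul_natCast zero_le_two]
    gcongr
    rcases le_total K 1 with h | h
    · exact h.trans (one_le_rpow one_le_two hK)
    · have := one_add_mul_self_le_rpow_one_add (s := 1) (by norm_num) h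
      norm_num at this
      linarith
  have hnm : (n : ℝ) ^ m = (2 : ℝ) ^ (m * L) := by rw [hpow, rpow_natCast]
  rw [← hpow, Nat.cast_choose_two, hnm]
  calc _ ≤ (2 : ℝ) ^ (m * L) * ((2 : ℝ) ^ (K * m) * (2 : ℝ) ^ ((1 - 1 / r) * (m : ℝ) ^ 2 / 2
        - c₀ * (m : ℝ) ^ 2 - m * (m - 1) / 2)) := by gcongr
    _ ≤ _ := by
      rw [← rpow_add two_pos, ← rpow_add two_pos]
      refine rpow_le_rpow_of_exponent_le one_le_two ?_
      rw [div_le_iff₀ hc₀] at hn1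
      have e : m * L + (K * m + ((1 - 1 / r) * (m : ℝ) ^ 2 / 2 - c₀ * (m : ℝ) ^ 2
          - m * (m - 1) / 2)) = m * (L + K + 1 / 2 - (m / r) / 2 - c₀ * m) := by
        field_simp
        ring
      rw [e]
      have h1 : L + K + 1 / 2 - (m / r : ℝ) / 2 - c₀ * m ≤ -1 := by
        have : c₀ * L ≤ c₀ * m := by gcongr
        nlinarith
      nlinarith

end UpperBounds

section Alpha

variable {V : Type} {F : SimpleGraph V} {n : ℕ} {G : SimpleGraph (Fin n)}

theorem HasCopy.mono_induce {s t : Finset (Fin n)} (h : t ⊆ s)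
    (ht : HasCopy F (G.induce (t : Set (Fin n)))) : HasCopy F (G.induce (s : Set (Fin n))) := by
  obtain ⟨f, hf⟩ := ht
  exact ⟨f.trans (Set.embeddingOfSubset _ _ (Finset.coe_subset.2 h)), fun a b hab => hf a b hab⟩

theorem alphaF_le {M : ℕ}
    (h : ¬ ∃ S : Finset (Fin n), S.card = M + 1 ∧ ¬ HasCopy F (G.induce (S : Set (Fin n)))) :
    alphaF F n G ≤ M := by
  refine csSup_le' ?_
  rintro m ⟨s, rfl, hs⟩
  by_contra! hlt
  obtain ⟨t, hts, htc⟩ := Finset.exists_subset_card_eq (Nat.succ_le_of_lt hlt)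
  exact h ⟨t, htc, fun ht => hs (ht.mono_induce hts)⟩

theorem le_alphaF {S : Finset (Fin n)} (h : ¬ HasCopy F (G.induce (S : Set (Fin n)))) :
    S.card ≤ alphaF F n G := by
  refine le_csSup ⟨n, ?_⟩ ⟨S, rfl, h⟩
  rintro m ⟨s, rfl, -⟩
  simpa using Finset.card_le_univ s

theorem mul_le_alphaF {r ℓ : ℕ} (hF : IsCritical r F) {t : Finset (Finset (Fin n))}
    (htc : t.card = r) (hdisj : ∀ S ∈ t, ∀ T ∈ t, S ≠ T → Disjoint S T)
    (hind : ∀ S ∈ t, S.card = ℓ ∧ Disjoint (edges G) (pairs S)) :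
    r * ℓ ≤ alphaF F n G := by
  have hcard : (t.biUnion id).card = r * ℓ := by
    rw [Finset.card_biUnion (t := id) hdisj,
      Finset.sum_congr rfl (f := fun S => (id S).card) (g := fun _ => ℓ)
        fun S hS => (hind S hS).1, Finset.sum_const, htc, smul_eq_mul]
  rw [← hcard]
  refine le_alphaF ?_
  rintro ⟨f, hf⟩
  have hmem : ∀ v : ↥((t.biUnion id : Finset (Fin n)) : Set (Fin n)), ∃ S : t, v.1 ∈ S.1 := by
    rintro ⟨v, hv⟩
    obtain ⟨S, hS, hv⟩ := Finset.mem_biUnion.1 (Finset.mem_coe.1 hv)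
    exact ⟨⟨S, hS⟩, hv⟩
  choose c hc using hmem
  let C : F.Coloring t := SimpleGraph.Coloring.mk (fun v => c (f v)) (by
    intro a b hab heq
    have h1 := hf a b hab
    rw [SimpleGraph.induce_adj] at h1
    refine Finset.disjoint_left.1 (hind _ (c (f a)).2).2 (mk_mem_edges.2 h1)
      (mk_mem_pairs.2 ⟨hc (f a), ?_, h1.ne⟩)
    rw [heq]
    exact hc (f b))
  have h2 := C.colorable
  rw [Fintype.card_coe, htc] at h2
  exact hF.not_colorable h2

end Alpha

theorem grPr_eq (n : ℕ) (S : Set (SimpleGraph (Fin n))) :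
    grPr n S = (S.toFinset.card : ℝ) / 2 ^ n.choose 2 := by
  rw [grPr, PMF.toOuterMeasure_uniformOfFintype_apply, card_graphs_fin, ENNReal.toReal_div,
    ENNReal.toReal_natCast, ENNReal.toReal_natCast, Set.toFinset_card]
  push_cast
  rfl

theorem one_sub_le_grPr {n : ℕ} {S : Set (SimpleGraph (Fin n))} {b : ℝ}
    (𝒮 : Finset (SimpleGraph (Fin n))) (h𝒮 : ∀ G, G ∉ S → G ∈ 𝒮)
    (hb : (𝒮.card : ℝ) ≤ 2 ^ n.choose 2 * b) : 1 - b ≤ grPr n S := by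
  have h2 : 2 ^ n.choose 2 ≤ S.toFinset.card + 𝒮.card := by
    rw [← card_graphs_fin, ← Finset.card_univ]
    refine (Finset.card_le_card fun G _ => ?_).trans (Finset.card_union_le _ _)
    rw [Finset.mem_union, Set.mem_toFinset]
    exact or_iff_not_imp_left.2 (h𝒮 G)
  have h3 : (2 : ℝ) ^ n.choose 2 ≤ S.toFinset.card + 𝒮.card := by exact_mod_cast h2
  rw [grPr_eq, le_div_iff₀ (by positivity)]
  linarith

theorem grPr_le_one {n : ℕ} (S : Set (SimpleGraph (Fin n))) : grPr n S ≤ 1 := by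
  rw [grPr_eq, div_le_one (by positivity)]
  have h := Finset.card_le_univ S.toFinset
  rw [card_graphs_fin] at h
  exact_mod_cast h

theorem stmt3 (r : ℕ) (hr : 2 ≤ r) (V : Type) [Fintype V] (F : SimpleGraph V)
    (hF : IsCritical r F) :
    ∃ m : ℕ → ℕ,
      Filter.Tendsto
        (fun n => grPr n {G | (m n : ℤ) - r ≤ (alphaF F n G : ℤ) ∧ alphaF F n G ≤ m n})
        Filter.atTop (nhds 1) := by
  obtain ⟨K, c₀, m₀, hK, hc₀, hfree⟩ := exists_card_free_subset_le hr hF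
  have hr' : (2 : ℝ) ≤ r := by exact_mod_cast hr
  set ε : ℝ := min (1 / 4) c₀ with hε
  have hε0 : 0 < ε := lt_min (by norm_num) hc₀
  have hε1 : ε ≤ 1 / 4 := min_le_left _ _
  have hεc : ε ≤ c₀ := min_le_right _ _
  set δ : ℝ := 1 / (4 * r) with hδ
  have hδ0 : 0 < δ := by positivity
  have hδ1 : δ ≤ 1 / 8 := by
    rw [hδ]
    exact one_div_le_one_div_of_le (by norm_num) (by linarith)
  have hrδ : r * δ ≤ 1 / 4 := by
    rw [hδ]; field_simp; norm_num
  obtain ⟨ℓ, hℓ⟩ := (eventually_exists_threshold hδ0 (by linarith) hε0 (by linarith)).choice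
  refine ⟨fun n => r * (ℓ n + 1), ?_⟩
  have hlog : Filter.Tendsto (fun n : ℕ => Real.logb 2 (n : ℝ)) Filter.atTop Filter.atTop :=
    (Real.tendsto_logb_atTop one_lt_two).comp tendsto_natCast_atTop_atTop
  have hpow : ∀ x : ℝ, 0 < x →
      Filter.Tendsto (fun n : ℕ => (n : ℝ) ^ (-x)) Filter.atTop (nhds 0) := fun x hx =>
    (tendsto_rpow_neg_atTop hx).comp tendsto_natCast_atTop_atTop
  have hlim : Filter.Tendsto (fun n : ℕ => 1 - ((n : ℝ) ^ (-1 : ℝ) + (n : ℝ) ^ (-(1 / 4) : ℝ)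
      + (n : ℝ) ^ (-(δ / 2)))) Filter.atTop (nhds 1) := by
    simpa using (((hpow 1 one_pos).add (hpow (1 / 4) (by norm_num))).add
      (hpow (δ / 2) (by positivity))).const_sub 1
  refine tendsto_of_tendsto_of_tendsto_of_le_of_le' hlim tendsto_const_nhds ?_
    (Filter.Eventually.of_forall fun n => grPr_le_one _)
  filter_upwards [hℓ, eventually_sum_overlap_le (4 * (r + 1)) hδ0 hδ1 hε1,
    eventually_fine_le hrδ hε1, eventually_coarse_le (by omega : 1 ≤ r) hK hc₀ hεc hε1,
    eventually_affine_logb_pow_le 2 3 1 one_pos, hlog.eventually_ge_atTop (m₀ + 1),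
    Filter.eventually_ge_atTop 1]
    with n ⟨hℓ1, hℓ2, hℓ3, hℓ4, hℓ5⟩ hov hfine hcoarse hlogn hm₀ hn1
  set L := Real.logb 2 (n : ℝ) with hL
  have hm₀' : (0 : ℝ) ≤ m₀ := Nat.cast_nonneg _
  have hL1 : 1 ≤ L := by linarith
  set k := ℓ n + 1 with hk
  have hkℓ : (k : ℝ) = ℓ n + 1 := by rw [hk]; push_cast; rfl
  have hkn : k < n := by
    rw [pow_one, Real.rpow_one, abs_of_nonneg (by positivity)] at hlogn
    have : (k : ℝ) < n := by linarith
    exact_mod_cast this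
  have hkm₀ : m₀ ≤ r * k + 1 := by
    have h1 : (m₀ : ℝ) ≤ k := by nlinarith
    have h2 : m₀ ≤ k := by exact_mod_cast h1
    nlinarith
  let 𝒜 : Finset (SimpleGraph (Fin n)) := Finset.univ.filter fun G =>
    ∃ S : Finset (Fin n), S.card = r * k + 1 ∧ ¬ HasCopy F (G.induce (S : Set (Fin n)))
  let ℬ : Finset (SimpleGraph (Fin n)) := Finset.univ.filter fun G =>
    ¬ ∃ t : Finset (Finset (Fin n)), t.card = r ∧
      (∀ S ∈ t, ∀ T ∈ t, S ≠ T → Disjoint S T) ∧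
      ∀ S ∈ t, S.card = ℓ n ∧ Disjoint (edges G) (pairs S)
  have hA := hfree n k (r * k + 1) hkn rfl hkm₀ 𝒜 fun G hG => (Finset.mem_filter.1 hG).2
  have hB := card_no_disjoint_indep_le hℓ1 (by omega : ℓ n ≤ n) (by omega : 1 ≤ r) ℬ
    fun G hG => (Finset.mem_filter.1 hG).2
  have hcoarse' := hcoarse k (r * k + 1) rfl (by linarith)
  have hfine' := hfine k (r * k + 1) rfl (by linarith) (by linarith) hℓ5.le
  have hov' := hov (ℓ n) hℓ1 hℓ2 hℓ3 hℓ4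
  refine one_sub_le_grPr (𝒜 ∪ ℬ) ?_ ?_
  · intro G hG
    by_contra hGU
    rw [Finset.mem_union, not_or, Finset.mem_filter, Finset.mem_filter] at hGU
    simp only [Finset.mem_univ, true_and, not_not] at hGU
    obtain ⟨hG1, t, ht1, ht2, ht3⟩ := hGU
    have h1 := alphaF_le hG1
    have h2 := mul_le_alphaF hF ht1 ht2 ht3
    refine hG ⟨?_, h1⟩
    have h3 : r * k = r * ℓ n + r := by rw [hk]; ring
    omega
  · have h1 : ((𝒜 ∪ ℬ).card : ℝ) ≤ 𝒜.card + ℬ.card := by exact_mod_cast Finset.card_union_le _ _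
    refine h1.trans ((add_le_add hA hB).trans ?_)
    rw [← mul_add]
    exact mul_le_mul_of_nonneg_left
      (add_le_add (add_le_add hcoarse' hfine') hov') (by positivity)
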